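/- There exist absolute constants ĉ₁, ĉ₂, ĉ₃, ĉ₄, ĉ₅, ĉ₆, ĉ₇ > 0 (chosen small enough) with the following property (second phase / saddle avoidance). Assume 𝒜 satisfies the RIP of order 2r+1 with constant δ ≤ ĉ₁/(κ³√r), that μ ≤ ĉ₂/(κ⁴‖X‖), and that σ_min(L_XᵀZ_{t₁}) ≤ √(σ_min(X)/8). Suppose that at iteration t₁: ‖Z_{t₁}Q_{t₁,⊥}‖ ≤ min{2σ_min(Z_{t₁}Q_{t₁}), ĉ₃√(σ_min(X))/(kκ^{35/8})}; ‖L_{X,⊥}ᵀP_{Z_{t₁}Q_{t₁}}‖ ≤ ĉ₄/κ²; ‖Z_{t₁}‖ ≤ 2√‖X‖; ‖Z̃_{t₁}ᵀZ_{t₁}Q_{t₁,⊥}‖ ≤ (ĉ₄ĉ₅√‖X‖/κ³)·‖Z_{t₁}Q_{t₁,⊥}‖; ‖Z̃_{t₁}ᵀP_{Z_{t₁}Q_{t₁}}‖ ≤ ĉ₄ĉ₆√‖X‖/κ³; and ‖Z̃_{t₁}ᵀZ_{t₁}‖ + 400μ²·⌈ln(√(σ_min(X))/(√8 σ_min(L_XᵀZ_{t₁})))/ln(1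 + (μ/8)σ_min(X))⌉·‖X‖³ ≤ (ĉ₇/κ⁴)‖X‖. Then there exist a natural number t₂ ≥ t₁ with t₂ − t₁ ≤ ⌈ln(√(σ_min(X))/(√8 σ_min(L_XᵀZ_{t₁})))/ln(1 + (μ/8)σ_min(X))⌉ and a real number γ with ‖Z_{t₁}Q_{t₁,⊥}‖ ≤ γ ≤ (1/128)^{1/10}·(σ_min(X))^{1/10}·‖Z_{t₁}Q_{t₁,⊥}‖^{4/5} such that at iteration t₂: σ_min(L_XᵀZ_{t₂}) ≥ √(σ_min(X)/8); ‖Z_{t₂}Q_{t₂,⊥}‖ ≤ γ; ‖L_{X,⊥}ᵀP_{Z_{t₂}Q_{t₂}}‖ ≤ ĉ₄/κ²; ‖Z_{t₂}‖ ≤ 2√‖X‖; ‖Z̃_{t₂}ᵀZ_{t₂}‖ ≤ ‖Z̃_{t₁}ᵀZ_{t₁}‖ + 400μ²(t₂ − t₁)‖X‖³; ‖Z̃_{t₂}ᵀZ_{t₂}Q_{t₂,⊥}‖ ≤ ĉ₄ĉ₅√‖X‖·γ/κ³; and ‖Z̃_{t₂}ᵀP_{Z_{t₂}Q_{t₂}}‖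 ≤ ĉ₄ĉ₆√‖X‖/κ³. -/

import Mathlib

open Matrix MeasureTheory ProbabilityTheory

noncomputable section

namespace AsymMatrixSensing

/-- Euclidean norm of a real vector. -/
def euclNorm {ι : Type*} [Fintype ι] (v : ι → ℝ) : ℝ :=
  Real.sqrt (∑ i, v i ^ 2)

/-- Spectral norm of a real matrix. -/
def specNorm {ι₁ ι₂ : Type*} [Fintype ι₁] [Fintype ι₂] (M : Matrix ι₁ ι₂ ℝ) : ℝ :=
  sSup {c : ℝ | ∃ x : ι₂ → ℝ, euclNorm x ≤ 1 ∧ c = euclNorm (M.mulVec x)}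

/-- Frobenius norm of a real matrix. -/
def frobNorm {ι₁ ι₂ : Type*} [Fintype ι₁] [Fintype ι₂] (M : Matrix ι₁ ι₂ ℝ) : ℝ :=
  Real.sqrt (∑ i, ∑ j, M i j ^ 2)

/-- Nuclear norm of a real matrix (characterized by duality with the spectral norm). -/
def nucNorm {ι₁ ι₂ : Type*} [Fintype ι₁] [Fintype ι₂] (M : Matrix ι₁ ι₂ ℝ) : ℝ :=
  sSup {c : ℝ | ∃ B : Matrix ι₁ ι₂ ℝ, specNorm B ≤ 1 ∧ c = ∑ i, ∑ j, M i j * B i j}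

/-- Smallest singular value `σ_{min(a,b)}(M)` of a matrix. -/
def sigmaMin {ι₁ ι₂ : Type*} [Fintype ι₁] [Fintype ι₂] (M : Matrix ι₁ ι₂ ℝ) : ℝ :=
  max (sInf {c : ℝ | ∃ x : ι₂ → ℝ, euclNorm x = 1 ∧ c = euclNorm (M.mulVec x)})
      (sInf {c : ℝ | ∃ y : ι₁ → ℝ, euclNorm y = 1 ∧ c = euclNorm (Mᵀ.mulVec y)})

/-- Smallest nonzero singular value `σ_rank(M)`: the minimum of `‖Mx‖` over unit
vectors `x` orthogonal to the kernel of `M`. -/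
def sigmaPos {ι₁ ι₂ : Type*} [Fintype ι₁] [Fintype ι₂] (M : Matrix ι₁ ι₂ ℝ) : ℝ :=
  sInf {c : ℝ | ∃ x : ι₂ → ℝ, euclNorm x = 1 ∧
    (∀ y : ι₂ → ℝ, M.mulVec y = 0 → x ⬝ᵥ y = 0) ∧ c = euclNorm (M.mulVec x)}

/-- Condition number `κ = ‖M‖ / σ_min(M)`. -/
def condNum {ι₁ ι₂ : Type*} [Fintype ι₁] [Fintype ι₂] (M : Matrix ι₁ ι₂ ℝ) : ℝ :=
  specNorm M / sigmaPos M

/-- Trace inner product `⟨M, N⟩ = trace(Mᵀ N)`. -/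
def minner {ι₁ ι₂ : Type*} [Fintype ι₁] [Fintype ι₂] (M N : Matrix ι₁ ι₂ ℝ) : ℝ :=
  ∑ i, ∑ j, M i j * N i j

/-- `P` is a matrix with orthonormal columns spanning the column space of `M`. -/
def IsOrthCol {ι κ₁ κ₂ : Type*} [Fintype ι] [Fintype κ₁] [Fintype κ₂] [DecidableEq κ₂]
    (P : Matrix ι κ₂ ℝ) (M : Matrix ι κ₁ ℝ) : Prop :=
  Pᵀ * P = 1 ∧ (∃ C : Matrix κ₁ κ₂ ℝ, P = M * C) ∧ P * Pᵀ * M = M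

/-- `L` has orthonormal columns spanning the subspace spanned by eigenvectors of the
symmetric matrix `F` corresponding to its `r` largest eigenvalues. -/
def IsTopEigenspace {ι : Type*} [Fintype ι] [DecidableEq ι] {r : ℕ} (F : Matrix ι ι ℝ)
    (L : Matrix ι (Fin r) ℝ) : Prop :=
  Lᵀ * L = 1 ∧ ∃ d : Fin r → ℝ, F * L = L * Matrix.diagonal d ∧
    ∀ (v : ι → ℝ) (lam : ℝ), v ≠ 0 → F.mulVec v = lam • v →
      Lᵀ.mulVec v = 0 → ∀ i, lam ≤ d i

variable {n₁ n₂ m k r : ℕ}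

/-- The measurement operator `𝒜`, given by `[𝒜(Z)]ᵢ = ⟨Aᵢ, Z⟩`. -/
def calA (A : Fin m → Matrix (Fin n₁) (Fin n₂) ℝ) (Z : Matrix (Fin n₁) (Fin n₂) ℝ) :
    Fin m → ℝ := fun i => minner (A i) Z

/-- The restricted isometry property of order `s` with constant `δ`. -/
def HasRIP (A : Fin m → Matrix (Fin n₁) (Fin n₂) ℝ) (s : ℕ) (δ : ℝ) : Prop :=
  ∀ M : Matrix (Fin n₁) (Fin n₂) ℝ, M.rank ≤ s →
    (1 - δ) * frobNorm M ^ 2 ≤ ∑ i, calA A M i ^ 2 ∧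
      ∑ i, calA A M i ^ 2 ≤ (1 + δ) * frobNorm M ^ 2

/-- `𝒜*𝒜`. -/
def AstarA (A : Fin m → Matrix (Fin n₁) (Fin n₂) ℝ) (Z : Matrix (Fin n₁) (Fin n₂) ℝ) :
    Matrix (Fin n₁) (Fin n₂) ℝ := ∑ i, minner (A i) Z • A i

/-- The symmetrization `sym(X) = [[0, X], [Xᵀ, 0]]`. -/
def symMat (X : Matrix (Fin n₁) (Fin n₂) ℝ) :
    Matrix (Fin n₁ ⊕ Fin n₂) (Fin n₁ ⊕ Fin n₂) ℝ := Matrix.fromBlocks 0 X Xᵀ 0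

/-- The symmetrized measurement matrices `Bᵢ = (1/√2)[[0, Aᵢ], [Aᵢᵀ, 0]]`. -/
def Bmat (A : Fin m → Matrix (Fin n₁) (Fin n₂) ℝ) (i : Fin m) :
    Matrix (Fin n₁ ⊕ Fin n₂) (Fin n₁ ⊕ Fin n₂) ℝ :=
  (Real.sqrt 2)⁻¹ • Matrix.fromBlocks 0 (A i) (A i)ᵀ 0

/-- `ℬ*ℬ`. -/
def BstarB (A : Fin m → Matrix (Fin n₁) (Fin n₂) ℝ)
    (S : Matrix (Fin n₁ ⊕ Fin n₂) (Fin n₁ ⊕ Fin n₂) ℝ) :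
    Matrix (Fin n₁ ⊕ Fin n₂) (Fin n₁ ⊕ Fin n₂) ℝ :=
  ∑ i, minner (Bmat A i) S • Bmat A i

/-- The factorized gradient descent iterates `(V_t, W_t)`. -/
def iter (A : Fin m → Matrix (Fin n₁) (Fin n₂) ℝ) (X : Matrix (Fin n₁) (Fin n₂) ℝ)
    (μ : ℝ) (V₀ : Matrix (Fin n₁) (Fin k) ℝ) (W₀ : Matrix (Fin n₂) (Fin k) ℝ) :
    ℕ → Matrix (Fin n₁) (Fin k) ℝ × Matrix (Fin n₂) (Fin k) ℝ
  | 0 => (V₀, W₀)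
  | t + 1 =>
    let p := iter A X μ V₀ W₀ t
    let G := AstarA A (p.1 * p.2ᵀ - X)
    (p.1 - μ • (G * p.2), p.2 - μ • (Gᵀ * p.1))

/-- The vertical stacking `(1/√2)[V; W]`. -/
def Zstack {κ : ℕ} (V : Matrix (Fin n₁) (Fin κ) ℝ) (W : Matrix (Fin n₂) (Fin κ) ℝ) :
    Matrix (Fin n₁ ⊕ Fin n₂) (Fin κ) ℝ :=
  (Real.sqrt 2)⁻¹ • Matrix.fromRows V W

/-- `Z_t = (1/√2)[V_t; W_t]`. -/
def Zit (A : Fin m → Matrix (Fin n₁) (Fin n₂) ℝ) (X : Matrix (Fin n₁) (Fin n₂) ℝ)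
    (μ : ℝ) (V₀ : Matrix (Fin n₁) (Fin k) ℝ) (W₀ : Matrix (Fin n₂) (Fin k) ℝ) (t : ℕ) :
    Matrix (Fin n₁ ⊕ Fin n₂) (Fin k) ℝ :=
  Zstack (iter A X μ V₀ W₀ t).1 (iter A X μ V₀ W₀ t).2

/-- `Z̃_t = (1/√2)[V_t; −W_t]`. -/
def Ztil (A : Fin m → Matrix (Fin n₁) (Fin n₂) ℝ) (X : Matrix (Fin n₁) (Fin n₂) ℝ)
    (μ : ℝ) (V₀ : Matrix (Fin n₁) (Fin k) ℝ) (W₀ : Matrix (Fin n₂) (Fin k) ℝ) (t : ℕ) :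
    Matrix (Fin n₁ ⊕ Fin n₂) (Fin k) ℝ :=
  Zstack (iter A X μ V₀ W₀ t).1 (-(iter A X μ V₀ W₀ t).2)

/-- `Δ_t = (Id − ℬ*ℬ)(Z_tZ_tᵀ − Z̃_tZ̃_tᵀ − sym(X))`. -/
def Δit (A : Fin m → Matrix (Fin n₁) (Fin n₂) ℝ) (X : Matrix (Fin n₁) (Fin n₂) ℝ)
    (μ : ℝ) (V₀ : Matrix (Fin n₁) (Fin k) ℝ) (W₀ : Matrix (Fin n₂) (Fin k) ℝ) (t : ℕ) :
    Matrix (Fin n₁ ⊕ Fin n₂) (Fin n₁ ⊕ Fin n₂) ℝ :=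
  let D := Zit A X μ V₀ W₀ t * (Zit A X μ V₀ W₀ t)ᵀ
    - Ztil A X μ V₀ W₀ t * (Ztil A X μ V₀ W₀ t)ᵀ - symMat X
  D - BstarB A D

/-- The block diagonal matrix `diag(Id_{n₁}, −Id_{n₂})`. -/
def flipSign (n₁ n₂ : ℕ) : Matrix (Fin n₁ ⊕ Fin n₂) (Fin n₁ ⊕ Fin n₂) ℝ :=
  Matrix.fromBlocks 1 0 0 (-1)

/-- Product Gaussian measure modelling the random initialization pair `(V, W)`
with i.i.d. standard Gaussian entries. -/
def gaussPair (n₁ n₂ k : ℕ) :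
    Measure ((Fin n₁ → Fin k → ℝ) × (Fin n₂ → Fin k → ℝ)) :=
  (Measure.pi fun _ : Fin n₁ => Measure.pi fun _ : Fin k => gaussianReal 0 1).prod
    (Measure.pi fun _ : Fin n₂ => Measure.pi fun _ : Fin k => gaussianReal 0 1)

set_option linter.unusedSectionVars false


/-! ### Abstract one-step analysis -/
set_option linter.unusedSectionVars false

section Abstract

variable {E K : Type*} [NormedAddCommGroup E] [InnerProductSpace ℝ E] [CompleteSpace E]
  [FiniteDimensional ℝ E]
  [NormedAddCommGroup K] [InnerProductSpace ℝ K] [CompleteSpace K] [FiniteDimensional ℝ K]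

/-- `y` is orthogonal to the kernel of `π Z`. -/
def InR (π : E →L[ℝ] E) (Z : K →L[ℝ] E) (y : K) : Prop :=
  ∀ x, π (Z x) = 0 → inner ℝ x y = 0

lemma InR.add {π : E →L[ℝ] E} {Z : K →L[ℝ] E} {y z : K} (hy : InR π Z y) (hz : InR π Z z) :
    InR π Z (y + z) := by
  intro x hx
  rw [inner_add_right, hy x hx, hz x hx, add_zero]

lemma InR.smul {π : E →L[ℝ] E} {Z : K →L[ℝ] E} {y : K} (c : ℝ) (hy : InR π Z y) :
    InR π Z (c • y) := by
  intro x hx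
  rw [inner_smul_right, hy x hx, mul_zero]

lemma InR.sub {π : E →L[ℝ] E} {Z : K →L[ℝ] E} {y z : K} (hy : InR π Z y) (hz : InR π Z z) :
    InR π Z (y - z) := by
  intro x hx
  rw [inner_sub_right, hy x hx, hz x hx, sub_zero]

lemma exists_decomp (π : E →L[ℝ] E) (Z : K →L[ℝ] E) (v : K) :
    ∃ y x, v = y + x ∧ InR π Z y ∧ π (Z x) = 0 := by
  obtain ⟨x, hx, y, hy, h⟩ := Submodule.exists_add_mem_mem_orthogonal
    (K := LinearMap.ker ((π.comp Z : K →L[ℝ] E) : K →ₗ[ℝ] E)) v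
  refine ⟨y, x, by rw [h, add_comm], ?_, ?_⟩
  · intro w hw
    exact (Submodule.mem_orthogonal _ _).1 hy w (by simpa using hw)
  · simpa using hx

lemma norm_le_of_inner_le {a : K} {c : ℝ} (h : inner ℝ a a ≤ c * ‖a‖) (hc : 0 ≤ c) :
    ‖a‖ ≤ c := by
  rw [real_inner_self_eq_norm_sq] at h
  by_contra hlt
  push Not at hlt
  nlinarith [norm_nonneg a]

/-- For a form `0 ≤ ⟨Dx,x⟩ ≤ B‖x‖²` on an invariant set: `‖Dy‖² ≤ B⟨Dy,y⟩`. -/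
lemma psd_bound (D : K →L[ℝ] K) (B : ℝ) (hB : 0 < B) (y : K)
    (hsymm : ∀ a b, inner ℝ (D a) b = inner ℝ a (D b))
    (h0 : 0 ≤ inner ℝ (D (y - B⁻¹ • D y)) (y - B⁻¹ • D y))
    (hle : inner ℝ (D (D y)) (D y) ≤ B * ‖D y‖ ^ 2) :
    ‖D y‖ ^ 2 ≤ B * inner ℝ (D y) y := by
  have e : inner ℝ (D (y - B⁻¹ • D y)) (y - B⁻¹ • D y)
      = inner ℝ (D y) y - 2 * B⁻¹ * ‖D y‖ ^ 2 + B⁻¹ ^ 2 * inner ℝ (D (D y)) (D y) := by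
    simp only [map_sub, map_smul, inner_sub_left, inner_sub_right, inner_smul_left,
      inner_smul_right, hsymm (D y) y, real_inner_self_eq_norm_sq]
    simp
    ring
  rw [e] at h0
  have h2 : B⁻¹ ^ 2 * inner ℝ (D (D y)) (D y) ≤ B⁻¹ ^ 2 * (B * ‖D y‖ ^ 2) :=
    mul_le_mul_of_nonneg_left hle (by positivity)
  have h3 : B⁻¹ ^ 2 * (B * ‖D y‖ ^ 2) = B⁻¹ * ‖D y‖ ^ 2 := by field_simp
  have h4 : B⁻¹ * ‖D y‖ ^ 2 ≤ inner ℝ (D y) y := by linarith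
  calc ‖D y‖ ^ 2 = B * (B⁻¹ * ‖D y‖ ^ 2) := by field_simp
    _ ≤ _ := mul_le_mul_of_nonneg_left h4 hB.le

open ContinuousLinearMap in
/-- All the data and smallness conditions for one step. -/
structure StepHyp (π F Δ M : E →L[ℝ] E) (Z Zt Zp Ztp : K →L[ℝ] E)
    (β σ μ η ζ θ ρ D γ s b E1 E2 E3 : ℝ) : Prop where
  π_idem : ∀ x, π (π x) = π x
  π_symm : ∀ x y, inner ℝ (π x) y = inner ℝ x (π y)
  F_symm : ∀ x y, inner ℝ (F x) y = inner ℝ x (F y)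
  F_comm : ∀ x, π (F x) = F (π x)
  F_norm : ∀ x, ‖F x‖ ≤ β * ‖x‖
  F_pos : ∀ x, σ * ‖π x‖ ^ 2 ≤ inner ℝ (F (π x)) (π x)
  F_neg : ∀ x, π x = 0 → inner ℝ (F x) x ≤ 0
  Δ_symm : ∀ x y, inner ℝ (Δ x) y = inner ℝ x (Δ y)
  Δ_norm : ∀ x, ‖Δ x‖ ≤ D * ‖x‖
  hM : ∀ v, M v = F v - Z (adjoint Z v) + Zt (adjoint Zt v) + Δ v
  hZp : ∀ x, Zp x = Z x + μ • M (Z x)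
  hZtp : ∀ x, Ztp x = Zt x - μ • M (Zt x)
  Z_norm : ∀ x, ‖Z x‖ ≤ b * ‖x‖
  Zt_norm : ∀ x, ‖Zt x‖ ≤ b * ‖x‖
  hb0 : 0 < b
  hb2 : b ^ 2 = 4 * β
  hβ : 0 < β
  hσ : 0 < σ
  hσβ : σ ≤ β
  hμ : 0 < μ
  hμβ : 100 * (μ * β) ≤ 1
  hη : 0 < η
  hη1 : 8 * η ≤ 1
  hη2 : 128 * (β * η ^ 2) ≤ σ
  hζ : 0 ≤ ζ
  hθ : 0 ≤ θ
  hρ : 0 ≤ ρ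
  hρβ : 4 * ρ ≤ β
  hD : 0 ≤ D
  hDβ : 4 * D ≤ β
  hγ : 0 ≤ γ
  hs : 0 < s
  hγs : γ ≤ 3 * s
  hE1 : b * ζ + D + 40 * (μ * β ^ 2 * η) ≤ E1
  hE2 : 4 * E1 + 4 * (β * η) ≤ E2
  hE3 : 4 * (μ * β ^ 2) + γ ^ 2 * η + b * θ + D + 6 * (6 * E1 + η * b * γ) ≤ E3
  cB : b * ζ + D + (η + 10 * (μ * β)) * E2 ≤ σ / 160
  cF : θ * E2 + 200 * (μ * b * β ^ 2) ≤ ζ * σ / 160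
  cC : 8 * E3 ≤ σ * η
  cG : 2 * (ρ * b + 3 * ζ * (6 * E1 + η * b * γ) + 200 * (μ * b * β ^ 2)) + 2 * θ * E3
    ≤ θ * σ / 2
  i2 : ∀ x, π (Z x) = 0 → ‖Z x‖ ≤ γ * ‖x‖
  i3 : ∀ x, π (Z x) = 0 → ‖adjoint Zt (Z x)‖ ≤ ζ * γ * ‖x‖
  i4 : ∀ y, InR π Z y → ‖Z y - π (Z y)‖ ≤ η * ‖π (Z y)‖
  i5 : ∀ y, InR π Z y → ‖adjoint Zt (Z y)‖ ≤ θ * ‖Z y‖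
  i6 : ∀ y, InR π Z y → s * ‖y‖ ≤ ‖π (Z y)‖
  i7 : ∀ x, ‖adjoint Zt (Z x)‖ ≤ ρ * ‖x‖
  i8 : ∀ w, ∃ x, π (Z x) = π w

end Abstract

section Abstract
open ContinuousLinearMap
variable {E K : Type*} [NormedAddCommGroup E] [InnerProductSpace ℝ E] [CompleteSpace E]
  [FiniteDimensional ℝ E]
  [NormedAddCommGroup K] [InnerProductSpace ℝ K] [CompleteSpace K] [FiniteDimensional ℝ K]

open ContinuousLinearMap

variable {π F Δ M : E →L[ℝ] E} {Z Zt Zp Ztp : K →L[ℝ] E}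
    {β σ μ η ζ θ ρ D γ s b E1 E2 E3 : ℝ}

lemma adj_norm (Z : K →L[ℝ] E) (b : ℝ) (hb : 0 ≤ b) (h : ∀ x, ‖Z x‖ ≤ b * ‖x‖) (v : E) :
    ‖adjoint Z v‖ ≤ b * ‖v‖ := by
  apply norm_le_of_inner_le _ (by positivity)
  rw [adjoint_inner_left]
  calc inner ℝ v (Z (adjoint Z v)) ≤ ‖v‖ * ‖Z (adjoint Z v)‖ := real_inner_le_norm _ _
    _ ≤ ‖v‖ * (b * ‖adjoint Z v‖) := by gcongr; exact h _
    _ = _ := by ring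

namespace StepHyp


lemma pi_sub
    (h : StepHyp π F Δ M Z Zt Zp Ztp β σ μ η ζ θ ρ D γ s b E1 E2 E3)
    (x : E) : π (x - π x) = 0 := by rw [map_sub, h.π_idem, sub_self]

lemma pyth
    (h : StepHyp π F Δ M Z Zt Zp Ztp β σ μ η ζ θ ρ D γ s b E1 E2 E3)
    (x : E) : ‖x‖ ^ 2 = ‖π x‖ ^ 2 + ‖x - π x‖ ^ 2 := by
  have e : inner ℝ (π x) (x - π x) = 0 := by
    rw [h.π_symm, h.pi_sub, inner_zero_right]
  have := norm_add_sq_real (π x) (x - π x)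
  rw [e, add_sub_cancel] at this
  linarith

lemma pi_norm
    (h : StepHyp π F Δ M Z Zt Zp Ztp β σ μ η ζ θ ρ D γ s b E1 E2 E3)
    (x : E) : ‖π x‖ ≤ ‖x‖ := by
  have := h.pyth x
  nlinarith [norm_nonneg x, norm_nonneg (π x), sq_nonneg ‖x - π x‖]

lemma pi_norm'
    (h : StepHyp π F Δ M Z Zt Zp Ztp β σ μ η ζ θ ρ D γ s b E1 E2 E3)
    (x : E) : ‖x - π x‖ ≤ ‖x‖ := by
  have := h.pyth x
  nlinarith [norm_nonneg x, norm_nonneg (x - π x), sq_nonneg ‖π x‖]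

lemma Zadj
    (h : StepHyp π F Δ M Z Zt Zp Ztp β σ μ η ζ θ ρ D γ s b E1 E2 E3)
    (v : E) : ‖adjoint Z v‖ ≤ b * ‖v‖ := adj_norm Z b h.hb0.le h.Z_norm v

lemma Ztadj
    (h : StepHyp π F Δ M Z Zt Zp Ztp β σ μ η ζ θ ρ D γ s b E1 E2 E3)
    (v : E) : ‖adjoint Zt v‖ ≤ b * ‖v‖ := adj_norm Zt b h.hb0.le h.Zt_norm v

lemma ZZ
    (h : StepHyp π F Δ M Z Zt Zp Ztp β σ μ η ζ θ ρ D γ s b E1 E2 E3)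
    (v : E) : ‖Z (adjoint Z v)‖ ≤ 4 * β * ‖v‖ := by
  calc _ ≤ b * ‖adjoint Z v‖ := h.Z_norm _
    _ ≤ b * (b * ‖v‖) := by gcongr; exacts [h.hb0.le, h.Zadj v]
    _ = _ := by rw [← h.hb2]; ring

lemma ZtZt
    (h : StepHyp π F Δ M Z Zt Zp Ztp β σ μ η ζ θ ρ D γ s b E1 E2 E3)
    (v : E) : ‖Zt (adjoint Zt v)‖ ≤ 4 * β * ‖v‖ := by
  calc _ ≤ b * ‖adjoint Zt v‖ := h.Zt_norm _
    _ ≤ b * (b * ‖v‖) := by gcongr; exacts [h.hb0.le, h.Ztadj v]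
    _ = _ := by rw [← h.hb2]; ring

lemma M_norm
    (h : StepHyp π F Δ M Z Zt Zp Ztp β σ μ η ζ θ ρ D γ s b E1 E2 E3)
    (v : E) : ‖M v‖ ≤ 10 * β * ‖v‖ := by
  rw [h.hM]
  have h1 := h.F_norm v
  have h2 := h.ZZ v
  have h3 := h.ZtZt v
  have h4 := h.Δ_norm v
  have h5 : ‖F v - Z (adjoint Z v) + Zt (adjoint Zt v) + Δ v‖
    ≤ ‖F v‖ + ‖Z (adjoint Z v)‖ + ‖Zt (adjoint Zt v)‖ + ‖Δ v‖ :=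
    (norm_add_le _ _).trans (add_le_add_left ((norm_add_le _ _).trans
      (add_le_add_left (norm_sub_le _ _) _)) _)
  have h6 : D * ‖v‖ ≤ β * ‖v‖ := by
    gcongr; linarith [h.hDβ, h.hD]
  linarith

lemma M_symm
    (h : StepHyp π F Δ M Z Zt Zp Ztp β σ μ η ζ θ ρ D γ s b E1 E2 E3)
    (x y : E) : inner ℝ (M x) y = inner ℝ x (M y) := by
  rw [h.hM, h.hM]
  simp only [inner_add_left, inner_add_right, inner_sub_left, inner_sub_right, h.F_symm, h.Δ_symm]
  have e1 : inner ℝ (Z (adjoint Z x)) y = inner ℝ x (Z (adjoint Z y)) := by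
    rw [← adjoint_inner_right Z, adjoint_inner_left Z]
  have e2 : inner ℝ (Zt (adjoint Zt x)) y = inner ℝ x (Zt (adjoint Zt y)) := by
    rw [← adjoint_inner_right Zt, adjoint_inner_left Zt]
  rw [e1, e2]

lemma muM
    (h : StepHyp π F Δ M Z Zt Zp Ztp β σ μ η ζ θ ρ D γ s b E1 E2 E3)
    (v : E) : ‖μ • M v‖ ≤ 10 * (μ * β) * ‖v‖ := by
  rw [norm_smul, Real.norm_of_nonneg h.hμ.le]
  calc μ * ‖M v‖ ≤ μ * (10 * β * ‖v‖) := by gcongr; exacts [h.hμ.le, h.M_norm v]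
    _ = _ := by ring

lemma bal
    (h : StepHyp π F Δ M Z Zt Zp Ztp β σ μ η ζ θ ρ D γ s b E1 E2 E3)
    (x : K) : adjoint Ztp (Zp x) =
    adjoint Zt (Z x) - (μ ^ 2) • adjoint Zt (M (M (Z x))) := by
  refine ext_inner_right ℝ fun w => ?_
  rw [adjoint_inner_left, h.hZp, h.hZtp, inner_sub_left, inner_smul_left, adjoint_inner_left,
    adjoint_inner_left]
  simp only [inner_add_left, inner_sub_right, inner_smul_left, inner_smul_right, h.M_symm (Z x),
    h.M_symm (M (Z x))]
  simp
  ring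

lemma bal_err
    (h : StepHyp π F Δ M Z Zt Zp Ztp β σ μ η ζ θ ρ D γ s b E1 E2 E3)
    (x : K) : ‖(μ ^ 2) • adjoint Zt (M (M (Z x)))‖ ≤
    100 * (μ * (μ * b * β ^ 2)) * ‖Z x‖ := by
  rw [norm_smul, Real.norm_of_nonneg (by positivity)]
  have hb := h.hb0
  have hβ := h.hβ
  calc μ ^ 2 * ‖adjoint Zt (M (M (Z x)))‖ ≤ μ ^ 2 * (b * (10 * β * (10 * β * ‖Z x‖))) := by
        gcongr
        refine (h.Ztadj _).trans ?_
        gcongr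
        refine (h.M_norm _).trans ?_
        gcongr
        exact h.M_norm _
    _ = _ := by ring

lemma bal_norm
    (h : StepHyp π F Δ M Z Zt Zp Ztp β σ μ η ζ θ ρ D γ s b E1 E2 E3)
    (r0 : ℝ) (h0 : ∀ x, ‖adjoint Zt (Z x)‖ ≤ r0 * ‖x‖) (x : K) :
    ‖adjoint Ztp (Zp x)‖ ≤ (r0 + 400 * μ ^ 2 * β ^ 3) * ‖x‖ := by
  rw [h.bal]
  have h1 := h.bal_err x
  have h2 := h0 x
  have h3 := h.Z_norm x
  have h4 : 100 * (μ * (μ * b * β ^ 2)) * ‖Z x‖ ≤ 100 * (μ * (μ * b * β ^ 2)) * (b * ‖x‖) := by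
    have := h.hμ; have := h.hb0; have := h.hβ
    gcongr
  have h5 : 100 * (μ * (μ * b * β ^ 2)) * (b * ‖x‖) = 400 * μ ^ 2 * β ^ 3 * ‖x‖ := by
    have : b * b = 4 * β := by rw [← h.hb2]; ring
    calc _ = 100 * μ ^ 2 * β ^ 2 * ‖x‖ * (b * b) := by ring
      _ = _ := by rw [this]; ring
  calc _ ≤ _ := norm_sub_le _ _
    _ ≤ _ := by linarith

lemma R_norm
    (h : StepHyp π F Δ M Z Zt Zp Ztp β σ μ η ζ θ ρ D γ s b E1 E2 E3)
    {y : K} (hy : InR π Z y) : ‖Z y‖ ≤ 2 * ‖π (Z y)‖ := by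
  have h1 := h.i4 y hy
  have h2 : ‖Z y‖ ≤ ‖π (Z y)‖ + ‖Z y - π (Z y)‖ := by
    calc ‖Z y‖ = ‖π (Z y) + (Z y - π (Z y))‖ := by congr 1; abel
      _ ≤ _ := norm_add_le _ _
  have := h.hη1
  nlinarith [norm_nonneg (π (Z y))]

lemma i4'
    (h : StepHyp π F Δ M Z Zt Zp Ztp β σ μ η ζ θ ρ D γ s b E1 E2 E3)
    {y : K} (hy : InR π Z y) : ‖Z y - π (Z y)‖ ≤ η * ‖Z y‖ :=
  (h.i4 y hy).trans (by gcongr; exacts [h.hη.le, h.pi_norm _])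

lemma low
    (h : StepHyp π F Δ M Z Zt Zp Ztp β σ μ η ζ θ ρ D γ s b E1 E2 E3)
    {y : K} (hy : InR π Z y) : ‖π (Z y)‖ ≤ 2 * ‖π (Zp y)‖ := by
  rw [h.hZp, map_add]
  have h1 := h.muM (Z y)
  have h2 := h.R_norm hy
  have h3 := h.pi_norm (μ • M (Z y))
  have h4 : ‖π (Z y)‖ ≤ ‖π (Z y) + π (μ • M (Z y))‖ + ‖π (μ • M (Z y))‖ := by
    calc _ = ‖(π (Z y) + π (μ • M (Z y))) - π (μ • M (Z y))‖ := by rw [add_sub_cancel_right]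
      _ ≤ _ := norm_sub_le _ _
  have h5 : 10 * (μ * β) * ‖Z y‖ ≤ 1 / 10 * ‖Z y‖ := by
    gcongr; linarith [h.hμβ]
  linarith [norm_nonneg (π (Z y))]

lemma E1_nonneg
    (h : StepHyp π F Δ M Z Zt Zp Ztp β σ μ η ζ θ ρ D γ s b E1 E2 E3)
    : 0 ≤ E1 := by
  refine le_trans ?_ h.hE1
  have := h.hb0; have := h.hζ; have := h.hD; have := h.hμ; have := h.hη
  positivity

lemma E2_nonneg
    (h : StepHyp π F Δ M Z Zt Zp Ztp β σ μ η ζ θ ρ D γ s b E1 E2 E3)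
    : 0 ≤ E2 := by
  refine le_trans ?_ h.hE2
  have := h.E1_nonneg; have := h.hβ; have := h.hη
  positivity

lemma phi_nonneg
    (h : StepHyp π F Δ M Z Zt Zp Ztp β σ μ η ζ θ ρ D γ s b E1 E2 E3)
    : 0 ≤ 6 * E1 + η * b * γ := by
  have := h.E1_nonneg; have := h.hb0; have := h.hη; have := h.hγ
  positivity

lemma E3_nonneg
    (h : StepHyp π F Δ M Z Zt Zp Ztp β σ μ η ζ θ ρ D γ s b E1 E2 E3)
    : 0 ≤ E3 := by
  refine le_trans ?_ h.hE3
  have := h.phi_nonneg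
  have := h.hb0; have := h.hθ; have := h.hD; have := h.hμ; have := h.hη
  positivity

/-- the kernel rotates slowly -/
lemma ker_rot
    (h : StepHyp π F Δ M Z Zt Zp Ztp β σ μ η ζ θ ρ D γ s b E1 E2 E3)
    {x1 x2 : K} (h1 : InR π Z x1) (h2 : π (Z x2) = 0) (h0 : π (Zp (x1 + x2)) = 0) :
    ‖x1‖ ≤ μ * (6 * E1 + η * b * γ) * ‖x2‖ ∧ ‖Z x1‖ ≤ μ * γ * E2 * ‖x2‖ := by
  have hμ := h.hμ
  have hb := h.hb0
  have hβ := h.hβ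
  have hη := h.hη
  have hγ := h.hγ
  have hE1 := h.E1_nonneg
  obtain ⟨p, q, hpq, hp, hq⟩ := exists_decomp π Z (adjoint Z (Z x2))
  have hx2 := norm_nonneg x2
  -- bound on p
  have hpn : ‖p‖ ≤ η * b * γ * ‖x2‖ := by
    apply norm_le_of_inner_le _ (by positivity)
    have e1 : inner ℝ p p = inner ℝ (adjoint Z (Z x2)) p := by
      rw [hpq, inner_add_left, hp q hq, add_zero]
    have e2 : inner ℝ (Z x2) (Z p) = inner ℝ (Z x2) (Z p - π (Z p)) := by
      rw [inner_sub_right, ← h.π_symm, h2, inner_zero_left, sub_zero]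
    rw [e1, adjoint_inner_left, e2]
    calc _ ≤ ‖Z x2‖ * ‖Z p - π (Z p)‖ := real_inner_le_norm _ _
      _ ≤ (γ * ‖x2‖) * (η * (b * ‖p‖)) := by
          gcongr
          · exact h.i2 _ h2
          · exact (h.i4' hp).trans (by gcongr; exact h.Z_norm _)
      _ = _ := by ring
  have hZp : Z (adjoint Z (Z x2)) = Z p + Z q := by rw [hpq, map_add]
  -- main identity
  have hid : π (Zp (x1 - μ • p)) =
      - (μ • π (Zt (adjoint Zt (Z x2)))) - μ • π (Δ (Z x2)) - μ • μ • π (M (Z p)) := by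
    have hFx : π (F (Z x2)) = 0 := by rw [h.F_comm, h2, map_zero]
    have e : π (Zp x2) = - (μ • π (Z p)) + μ • π (Zt (adjoint Zt (Z x2))) + μ • π (Δ (Z x2)) := by
      rw [h.hZp, h.hM, hZp]
      simp only [map_add, map_sub, map_smul, h2, hFx, hq]
      module
    rw [map_add, map_add, e] at h0
    have h0' : π (Zp x1) = μ • π (Z p) - μ • π (Zt (adjoint Zt (Z x2))) - μ • π (Δ (Z x2)) := by
      rw [← sub_eq_zero, ← h0]; module
    rw [map_sub, map_sub, h0', map_smul, h.hZp p]
    simp only [map_add, map_smul]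
    module
  have hR : InR π Z (x1 - μ • p) := h1.sub (hp.smul μ)
  have hbd : ‖π (Zp (x1 - μ • p))‖ ≤ μ * γ * E1 * ‖x2‖ := by
    rw [hid]
    have a1 : ‖μ • π (Zt (adjoint Zt (Z x2)))‖ ≤ μ * (b * (ζ * γ * ‖x2‖)) := by
      rw [norm_smul, Real.norm_of_nonneg hμ.le]
      gcongr
      exact (h.pi_norm _).trans ((h.Zt_norm _).trans (by gcongr; exact h.i3 _ h2))
    have a2 : ‖μ • π (Δ (Z x2))‖ ≤ μ * (D * (γ * ‖x2‖)) := by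
      rw [norm_smul, Real.norm_of_nonneg hμ.le]
      gcongr
      exact (h.pi_norm _).trans ((h.Δ_norm _).trans
        (by gcongr; exacts [h.hD, h.i2 _ h2]))
    have a3 : ‖μ • μ • π (M (Z p))‖ ≤ μ * (μ * (10 * β * (b * (η * b * γ * ‖x2‖)))) := by
      rw [norm_smul, norm_smul, Real.norm_of_nonneg hμ.le]
      gcongr
      refine (h.pi_norm _).trans ((h.M_norm _).trans ?_)
      gcongr
      exact (h.Z_norm _).trans (by gcongr)
    have a4 : μ * (μ * (10 * β * (b * (η * b * γ * ‖x2‖))))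
        = μ * γ * ‖x2‖ * (40 * (μ * β ^ 2 * η)) := by
      calc _ = μ * γ * ‖x2‖ * (10 * (μ * β * η)) * (b ^ 2) := by ring
        _ = _ := by rw [h.hb2]; ring
    calc _ ≤ ‖μ • π (Zt (adjoint Zt (Z x2)))‖ + ‖μ • π (Δ (Z x2))‖ + ‖μ • μ • π (M (Z p))‖ := by
          refine (norm_sub_le _ _).trans ?_
          gcongr
          refine (norm_sub_le _ _).trans ?_
          rw [norm_neg]
      _ ≤ μ * γ * ‖x2‖ * (b * ζ + D + 40 * (μ * β ^ 2 * η)) := by rw [a4] at a3; linarith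
      _ ≤ μ * γ * ‖x2‖ * E1 := by gcongr; exact h.hE1
      _ = _ := by ring
  have hlow := h.low hR
  have hs6 := h.i6 _ hR
  have hRn := h.R_norm hR
  have hnn : ‖x1 - μ • p‖ ≤ 6 * (μ * E1 * ‖x2‖) := by
    have : s * ‖x1 - μ • p‖ ≤ s * (6 * (μ * E1 * ‖x2‖)) := by
      calc _ ≤ 2 * (μ * γ * E1 * ‖x2‖) := by linarith
        _ = γ * (2 * (μ * E1 * ‖x2‖)) := by ring
        _ ≤ (3 * s) * (2 * (μ * E1 * ‖x2‖)) := by gcongr; exact h.hγs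
        _ = _ := by ring
    exact le_of_mul_le_mul_left this h.hs
  have hμp : ‖μ • p‖ ≤ μ * (η * b * γ * ‖x2‖) := by
    rw [norm_smul, Real.norm_of_nonneg hμ.le]; gcongr
  constructor
  · calc ‖x1‖ = ‖(x1 - μ • p) + μ • p‖ := by rw [sub_add_cancel]
      _ ≤ _ := norm_add_le _ _
      _ ≤ _ := by linarith
  · have hZμp : ‖Z (μ • p)‖ ≤ b * (μ * (η * b * γ * ‖x2‖)) :=
      (h.Z_norm _).trans (by gcongr)
    have e : b * (μ * (η * b * γ * ‖x2‖)) = μ * γ * ‖x2‖ * (4 * (β * η)) := by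
      calc _ = μ * γ * ‖x2‖ * η * (b ^ 2) := by ring
        _ = _ := by rw [h.hb2]; ring
    calc ‖Z x1‖ = ‖Z (x1 - μ • p) + Z (μ • p)‖ := by rw [← map_add, sub_add_cancel]
      _ ≤ _ := norm_add_le _ _
      _ ≤ μ * γ * ‖x2‖ * (4 * E1 + 4 * (β * η)) := by rw [e] at hZμp; linarith
      _ ≤ μ * γ * ‖x2‖ * E2 := by gcongr; exact h.hE2
      _ = _ := by ring

end StepHyp

end Abstract

section Abstract
open ContinuousLinearMap
variable {E K : Type*} [NormedAddCommGroup E] [InnerProductSpace ℝ E] [CompleteSpace E]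
  [FiniteDimensional ℝ E]
  [NormedAddCommGroup K] [InnerProductSpace ℝ K] [CompleteSpace K] [FiniteDimensional ℝ K]
variable {π F Δ M : E →L[ℝ] E} {Z Zt Zp Ztp : K →L[ℝ] E}
    {β σ μ η ζ θ ρ D γ s b E1 E2 E3 : ℝ}

lemma contr (C : E →L[ℝ] E) (B μ : ℝ) (hB : 0 < B) (hμ : 0 < μ) (hμB : μ * B ≤ 1)
    (hsymm : ∀ a b, inner ℝ (C a) b = inner ℝ a (C b))
    (h0 : ∀ w, 0 ≤ inner ℝ (C w) w) (h1 : ∀ w, inner ℝ (C w) w ≤ B * ‖w‖ ^ 2) (q : E) :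
    ‖q - μ • C q‖ ≤ ‖q‖ := by
  have hb := psd_bound C B hB q hsymm (h0 _) (h1 _)
  have e := norm_sub_sq_real q (μ • C q)
  rw [inner_smul_right, real_inner_comm, norm_smul, Real.norm_of_nonneg hμ.le] at e
  have h2 : μ ^ 2 * ‖C q‖ ^ 2 ≤ μ * inner ℝ (C q) q := by
    calc μ ^ 2 * ‖C q‖ ^ 2 ≤ μ ^ 2 * (B * inner ℝ (C q) q) := by gcongr
      _ = μ * (μ * B) * inner ℝ (C q) q := by ring
      _ ≤ μ * 1 * inner ℝ (C q) q := by gcongr; exact h0 q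
      _ = _ := by ring
  have h3 : 0 ≤ μ * inner ℝ (C q) q := mul_nonneg hμ.le (h0 q)
  have h4 : ‖q - μ • C q‖ ^ 2 ≤ ‖q‖ ^ 2 := by
    rw [e, mul_pow]; linarith
  exact (sq_le_sq₀ (norm_nonneg _) (norm_nonneg _)).1 h4

namespace StepHyp


lemma contr_F
    (h : StepHyp π F Δ M Z Zt Zp Ztp β σ μ η ζ θ ρ D γ s b E1 E2 E3)
    (q : E) (hq : π q = 0) : ‖q + μ • F q‖ ≤ ‖q‖ := by
  have hc := contr (-(F.comp (ContinuousLinearMap.id ℝ E - π))) β μ h.hβ h.hμ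
    (by linarith [h.hμβ, mul_pos h.hμ h.hβ]) ?_ ?_ ?_ q
  · simpa [hq] using hc
  · intro a c
    have e : inner ℝ (F (π a)) c = inner ℝ a (F (π c)) := by
      rw [h.F_symm, h.π_symm, h.F_comm]
    simp [inner_sub_left, inner_sub_right, h.F_symm a c, e]
  · intro w
    have e1 := h.F_neg (w - π w) (h.pi_sub w)
    have e2 : inner ℝ (F (w - π w)) (w - π w) = inner ℝ (F (w - π w)) w := by
      rw [inner_sub_right, ← h.π_symm, h.F_comm, h.pi_sub]; simp
    rw [e2] at e1
    have e3 : 0 ≤ inner ℝ (-(F (w - π w))) w := by rw [inner_neg_left]; linarith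
    simpa using e3
  · intro w
    have e1 : inner ℝ (-(F (w - π w))) w ≤ ‖F (w - π w)‖ * ‖w‖ := by
      have := real_inner_le_norm (-(F (w - π w))) w
      rwa [norm_neg] at this
    have e2 : ‖F (w - π w)‖ * ‖w‖ ≤ (β * ‖w‖) * ‖w‖ := by
      gcongr
      exact (h.F_norm _).trans (by gcongr; exacts [h.hβ.le, h.pi_norm' w])
    have e3 : inner ℝ (-(F (w - π w))) w ≤ β * ‖w‖ ^ 2 := by nlinarith
    simpa using e3

lemma contr_FZ
    (h : StepHyp π F Δ M Z Zt Zp Ztp β σ μ η ζ θ ρ D γ s b E1 E2 E3)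
    (q : E) (hq : π q = 0) :
    ‖(q + μ • (F q - Z (adjoint Z q))) - π (q + μ • (F q - Z (adjoint Z q)))‖ ≤ ‖q‖ := by
  set P : E →L[ℝ] E := ContinuousLinearMap.id ℝ E - π with hP
  have hPa : ∀ x, P x = x - π x := fun x => by simp [hP]
  have hPs : ∀ x y, inner ℝ (P x) y = inner ℝ x (P y) := by
    intro x y; rw [hPa, hPa, inner_sub_left, inner_sub_right, h.π_symm]
  have hFZ : ∀ x y, inner ℝ (F x - Z (adjoint Z x)) y = inner ℝ x (F y - Z (adjoint Z y)) := by
    intro x y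
    rw [inner_sub_left, inner_sub_right, h.F_symm, ← adjoint_inner_right Z, adjoint_inner_left Z]
  set C : E →L[ℝ] E := -(P.comp ((F - Z.comp (adjoint Z)).comp P)) with hC
  have hCa : ∀ x, C x = -(P (F (P x) - Z (adjoint Z (P x)))) := fun x => by simp [hC]
  have hCi : ∀ w, inner ℝ (C w) w = - inner ℝ (F (P w)) (P w) + ‖adjoint Z (P w)‖ ^ 2 := by
    intro w
    rw [hCa, inner_neg_left, hPs, inner_sub_left, ← adjoint_inner_right Z,
      real_inner_self_eq_norm_sq]
    ring
  have hPn : ∀ w, ‖P w‖ ≤ ‖w‖ := fun w => by rw [hPa]; exact h.pi_norm' w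
  have hc := contr C (5 * β) μ (by linarith [h.hβ]) h.hμ
    (by linarith [h.hμβ, mul_pos h.hμ h.hβ]) ?_ ?_ ?_ q
  · have e : q - μ • C q =
      (q + μ • (F q - Z (adjoint Z q))) - π (q + μ • (F q - Z (adjoint Z q))) := by
      have hPq : P q = q := by rw [hPa, hq, sub_zero]
      rw [hCa, hPq, hPa, map_add, hq, map_smul]
      module
    rwa [e] at hc
  · intro a c
    rw [hCa, hCa, inner_neg_left, inner_neg_right, hPs, hFZ, hPs]
  · intro w
    rw [hCi]
    have := h.F_neg (P w) (by rw [hPa]; exact h.pi_sub w)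
    nlinarith [sq_nonneg ‖adjoint Z (P w)‖]
  · intro w
    rw [hCi]
    have e1 : - inner ℝ (F (P w)) (P w) ≤ (β * ‖w‖) * ‖w‖ := by
      have := real_inner_le_norm (-(F (P w))) (P w)
      rw [norm_neg, inner_neg_left] at this
      refine this.trans ?_
      have hβ := h.hβ
      gcongr
      · exact (h.F_norm _).trans (by gcongr; exact hPn w)
      · exact hPn w
    have e2 : ‖adjoint Z (P w)‖ ^ 2 ≤ (b * ‖w‖) ^ 2 := by
      gcongr
      exact (h.Zadj _).trans (by gcongr; exacts [h.hb0.le, hPn w])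
    rw [mul_pow, h.hb2] at e2
    nlinarith

lemma noise
    (h : StepHyp π F Δ M Z Zt Zp Ztp β σ μ η ζ θ ρ D γ s b E1 E2 E3)
    {x : K} (h0 : π (Zp x) = 0) :
    ‖Zp x‖ ≤ (1 + μ * σ / 160) * γ * ‖x‖ ∧
    ‖adjoint Ztp (Zp x)‖ ≤ ζ * ((1 + μ * σ / 160) * γ) * ‖x‖ := by
  have hμ := h.hμ
  have hb := h.hb0
  have hβ := h.hβ
  have hη := h.hη
  have hγ := h.hγ
  have hζ := h.hζ
  have hθ := h.hθ
  have hσ := h.hσ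
  have hE2 := h.E2_nonneg
  obtain ⟨x1, x2, rfl, h1, h2⟩ := exists_decomp π Z x
  obtain ⟨hx1, hZx1⟩ := h.ker_rot h1 h2 h0
  have hx2 : ‖x2‖ ≤ ‖x1 + x2‖ := by
    have := norm_add_sq_real x1 x2
    rw [real_inner_comm, h1 x2 h2] at this
    nlinarith [norm_nonneg x2, norm_nonneg (x1 + x2), sq_nonneg ‖x1‖]
  have hn2 := norm_nonneg x2
  constructor
  · have e : Zp (x1 + x2) =
        ((Z x2 + μ • (F (Z x2) - Z (adjoint Z (Z x2)))) -
          π (Z x2 + μ • (F (Z x2) - Z (adjoint Z (Z x2)))))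
        + (μ • Zt (adjoint Zt (Z x2)) - π (μ • Zt (adjoint Zt (Z x2))))
        + (μ • Δ (Z x2) - π (μ • Δ (Z x2)))
        + (Z x1 - π (Z x1)) + (μ • M (Z x1) - π (μ • M (Z x1))) := by
      rw [← sub_zero (Zp (x1 + x2)), ← h0]
      rw [map_add Zp, h.hZp x1, h.hZp x2, h.hM (Z x2)]
      simp only [map_add, map_sub, map_smul]
      module
    have b1 := h.contr_FZ (Z x2) h2
    have b1' := h.i2 x2 h2
    have b2 : ‖μ • Zt (adjoint Zt (Z x2)) - π (μ • Zt (adjoint Zt (Z x2)))‖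
        ≤ μ * (b * (ζ * γ * ‖x2‖)) := by
      refine (h.pi_norm' _).trans ?_
      rw [norm_smul, Real.norm_of_nonneg hμ.le]
      gcongr
      exact (h.Zt_norm _).trans (by gcongr; exact h.i3 _ h2)
    have b3 : ‖μ • Δ (Z x2) - π (μ • Δ (Z x2))‖ ≤ μ * (D * (γ * ‖x2‖)) := by
      refine (h.pi_norm' _).trans ?_
      rw [norm_smul, Real.norm_of_nonneg hμ.le]
      gcongr
      exact (h.Δ_norm _).trans (by gcongr; exact h.hD)
    have b4 : ‖Z x1 - π (Z x1)‖ ≤ η * (μ * γ * E2 * ‖x2‖) :=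
      (h.i4' h1).trans (by gcongr)
    have b5 : ‖μ • M (Z x1) - π (μ • M (Z x1))‖ ≤ 10 * (μ * β) * (μ * γ * E2 * ‖x2‖) :=
      (h.pi_norm' _).trans ((h.muM _).trans (by gcongr))
    have b6 : ‖Zp (x1 + x2)‖ ≤ γ * ‖x2‖ + μ * (b * (ζ * γ * ‖x2‖)) + μ * (D * (γ * ‖x2‖))
        + η * (μ * γ * E2 * ‖x2‖) + 10 * (μ * β) * (μ * γ * E2 * ‖x2‖) := by
      rw [e]
      refine (norm_add_le _ _).trans (add_le_add ?_ b5)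
      refine (norm_add_le _ _).trans (add_le_add ?_ b4)
      refine (norm_add_le _ _).trans (add_le_add ?_ b3)
      exact (norm_add_le _ _).trans (add_le_add (b1.trans b1') b2)
    calc _ ≤ _ := b6
      _ = (1 + μ * (b * ζ + D + (η + 10 * (μ * β)) * E2)) * γ * ‖x2‖ := by ring
      _ ≤ (1 + μ * (σ / 160)) * γ * ‖x1 + x2‖ := by gcongr; exact h.cB
      _ = _ := by ring
  · rw [h.bal]
    have b1 := h.bal_err (x1 + x2)
    have b2 := h.i3 x2 h2
    have b3 : ‖adjoint Zt (Z x1)‖ ≤ θ * (μ * γ * E2 * ‖x2‖) :=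
      (h.i5 x1 h1).trans (by gcongr)
    have hμE2 : μ * E2 ≤ 1 := by
      have a1 := h.cB
      have a2 : η * E2 ≥ 0 := by positivity
      have a3 := h.hE2
      have a4 := h.hE1
      have a5 := h.cC
      have a6 := h.hE3
      have a7 := h.hη1
      have a8 : b * θ ≥ 0 := by positivity
      have a9 : γ ^ 2 * η ≥ 0 := by positivity
      have a10 : η * b * γ ≥ 0 := by positivity
      have a11 : μ * β ^ 2 ≥ 0 := by positivity
      have a12 := h.hD
      have a13 := h.E1_nonneg
      -- E2 is not bounded above by hypothesis, use cB
      have a14 : 10 * (μ * β) * E2 ≤ σ / 160 := by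
        have : b * ζ ≥ 0 := by positivity
        nlinarith
      have a15 : σ ≤ β := h.hσβ
      have : β * (10 * (μ * E2)) ≤ β * (1 / 160) := by nlinarith
      have := le_of_mul_le_mul_left this hβ
      linarith
    have b4 : ‖Z (x1 + x2)‖ ≤ 2 * (γ * ‖x2‖) := by
      rw [map_add]
      refine (norm_add_le _ _).trans ?_
      have : μ * γ * E2 * ‖x2‖ ≤ 1 * (γ * ‖x2‖) := by
        calc _ = μ * E2 * (γ * ‖x2‖) := by ring
          _ ≤ _ := by gcongr
      linarith [h.i2 x2 h2]
    have b5 : 100 * (μ * (μ * b * β ^ 2)) * ‖Z (x1 + x2)‖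
        ≤ 100 * (μ * (μ * b * β ^ 2)) * (2 * (γ * ‖x2‖)) := by gcongr
    have b6 : ‖adjoint Zt (Z (x1 + x2))‖ ≤ θ * (μ * γ * E2 * ‖x2‖) + ζ * γ * ‖x2‖ := by
      rw [map_add, map_add]
      exact (norm_add_le _ _).trans (add_le_add b3 b2)
    calc _ ≤ _ := norm_sub_le _ _
      _ ≤ (ζ + μ * (θ * E2 + 200 * (μ * b * β ^ 2))) * γ * ‖x2‖ := by linarith
      _ ≤ (ζ + μ * (ζ * σ / 160)) * γ * ‖x1 + x2‖ := by gcongr; exact h.cF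
      _ = _ := by ring

/-- operator norm bound is preserved -/
lemma Zp_norm
    (h : StepHyp π F Δ M Z Zt Zp Ztp β σ μ η ζ θ ρ D γ s b E1 E2 E3)
    (x : K) : ‖Zp x‖ ≤ b * ‖x‖ := by
  have hμ := h.hμ
  have hb := h.hb0
  have hβ := h.hβ
  have hb2 := h.hb2
  rcases eq_or_ne x 0 with rfl | hx
  · simp
  have hx0 : 0 < ‖x‖ := norm_pos_iff.2 hx
  set w := Z x with hw
  have hwb : ‖w‖ ≤ b * ‖x‖ := h.Z_norm x
  have e : Zp x = (w - μ • Z (adjoint Z w)) + μ • F w + μ • Δ w + μ • Zt (adjoint Zt w) := by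
    rw [h.hZp, h.hM]; module
  have a1 : ‖w - μ • Z (adjoint Z w)‖ ^ 2 ≤ ‖w‖ ^ 2 - μ * ‖adjoint Z w‖ ^ 2 := by
    have e1 := norm_sub_sq_real w (μ • Z (adjoint Z w))
    rw [inner_smul_right, norm_smul, Real.norm_of_nonneg hμ.le, ← adjoint_inner_left Z,
      real_inner_self_eq_norm_sq] at e1
    have e2 : ‖Z (adjoint Z w)‖ ^ 2 ≤ 4 * β * ‖adjoint Z w‖ ^ 2 := by
      rw [← hb2, ← mul_pow]; gcongr; exact h.Z_norm _
    have e3 : μ ^ 2 * ‖Z (adjoint Z w)‖ ^ 2 ≤ μ * ‖adjoint Z w‖ ^ 2 := by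
      calc _ ≤ μ ^ 2 * (4 * β * ‖adjoint Z w‖ ^ 2) := by gcongr
        _ = μ * (4 * (μ * β)) * ‖adjoint Z w‖ ^ 2 := by ring
        _ ≤ μ * 1 * ‖adjoint Z w‖ ^ 2 := by
          gcongr
          linarith [h.hμβ, mul_pos hμ hβ]
        _ = _ := by ring
    rw [e1, mul_pow]; linarith
  have a2 : ‖w‖ ^ 2 ≤ ‖adjoint Z w‖ * ‖x‖ := by
    calc ‖w‖ ^ 2 = inner ℝ (adjoint Z w) x := by
          rw [adjoint_inner_left, ← hw, real_inner_self_eq_norm_sq]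
      _ ≤ _ := real_inner_le_norm _ _
  -- normalized quantities
  set ω := ‖w‖ / ‖x‖ with hω
  have hω0 : 0 ≤ ω := by positivity
  have hwω : ‖w‖ = ω * ‖x‖ := by rw [hω]; field_simp
  have hωb : ω ≤ b := by rw [hω, div_le_iff₀ hx0]; exact hwb
  have a3 : ω ^ 2 * ‖x‖ ≤ ‖adjoint Z w‖ := by
    rw [hwω] at a2
    have : ‖x‖ * (ω ^ 2 * ‖x‖) ≤ ‖x‖ * ‖adjoint Z w‖ := by nlinarith
    exact le_of_mul_le_mul_left this hx0
  have hω2 : ω ^ 2 ≤ 4 * β := by rw [← hb2]; gcongr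
  have hμω : μ * ω ^ 2 ≤ 1 / 25 := by
    have := h.hμβ
    nlinarith
  have a4 : ‖w - μ • Z (adjoint Z w)‖ ≤ ω * (1 - μ * ω ^ 2 / 2) * ‖x‖ := by
    apply abs_le_of_sq_le_sq' _ _ |>.2
    · have : (ω ^ 2 * ‖x‖) ^ 2 ≤ ‖adjoint Z w‖ ^ 2 := by gcongr
      have h3 : ‖w‖ ^ 2 - μ * ‖adjoint Z w‖ ^ 2 ≤ ‖w‖ ^ 2 - μ * (ω ^ 2 * ‖x‖) ^ 2 := by
        gcongr
      refine a1.trans (h3.trans ?_)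
      rw [hwω]
      have : (ω * (1 - μ * ω ^ 2 / 2) * ‖x‖) ^ 2 = (ω * ‖x‖) ^ 2 - μ * (ω ^ 2 * ‖x‖) ^ 2
          + (ω * ‖x‖ * (μ * ω ^ 2 / 2)) ^ 2 := by ring
      rw [this]
      linarith [sq_nonneg (ω * ‖x‖ * (μ * ω ^ 2 / 2))]
    · have : 0 ≤ 1 - μ * ω ^ 2 / 2 := by linarith
      positivity
  have a5 : ‖μ • F w‖ ≤ μ * (β * (ω * ‖x‖)) := by
    rw [norm_smul, Real.norm_of_nonneg hμ.le, ← hwω]; gcongr; exact h.F_norm _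
  have a6 : ‖μ • Δ w‖ ≤ μ * (β / 4 * (ω * ‖x‖)) := by
    rw [norm_smul, Real.norm_of_nonneg hμ.le, ← hwω]
    gcongr
    refine (h.Δ_norm _).trans ?_
    gcongr
    linarith [h.hDβ]
  have a7 : ‖μ • Zt (adjoint Zt w)‖ ≤ μ * (b * (β / 4 * ‖x‖)) := by
    rw [norm_smul, Real.norm_of_nonneg hμ.le]
    gcongr
    refine (h.Zt_norm _).trans ?_
    gcongr
    refine (h.i7 x).trans ?_
    gcongr
    linarith [h.hρβ]
  have key : ω * (1 - μ * ω ^ 2 / 2) + μ * (β * ω) + μ * (β / 4 * ω) + μ * (b * (β / 4)) ≤ b := by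
    have hm : 0 < μ * β := mul_pos hμ hβ
    have hm' := h.hμβ
    rcases le_or_gt (3 * β) (ω ^ 2) with hc | hc
    · have : μ * (3 * β) ≤ μ * ω ^ 2 := by gcongr
      nlinarith [mul_nonneg (sub_nonneg.2 hωb) hm.le, mul_nonneg hω0 (sub_nonneg.2 this)]
    · have hω9 : ω ≤ 9 / 10 * b := by
        apply abs_le_of_sq_le_sq' _ (by positivity) |>.2
        nlinarith
      have : 0 ≤ ω * (μ * ω ^ 2 / 2) := by positivity
      have h5 : μ * β * ω ≤ 1 / 100 * b := by
        calc _ ≤ (1 / 100) * b := by gcongr; linarith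
          _ = _ := rfl
      have h6 : μ * β * b ≤ 1 / 100 * b := by gcongr; linarith
      nlinarith
  rw [e]
  calc _ ≤ ‖w - μ • Z (adjoint Z w)‖ + ‖μ • F w‖ + ‖μ • Δ w‖ + ‖μ • Zt (adjoint Zt w)‖ := by
        refine (norm_add_le _ _).trans (add_le_add_left ?_ _)
        refine (norm_add_le _ _).trans (add_le_add_left ?_ _)
        exact norm_add_le _ _
    _ ≤ (ω * (1 - μ * ω ^ 2 / 2) + μ * (β * ω) + μ * (β / 4 * ω) + μ * (b * (β / 4))) * ‖x‖ := by
        linarith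
    _ ≤ _ := by gcongr

end StepHyp

end Abstract

section Abstract
open ContinuousLinearMap
variable {E K : Type*} [NormedAddCommGroup E] [InnerProductSpace ℝ E] [CompleteSpace E]
  [FiniteDimensional ℝ E]
  [NormedAddCommGroup K] [InnerProductSpace ℝ K] [CompleteSpace K] [FiniteDimensional ℝ K]
variable {π F Δ M : E →L[ℝ] E} {Z Zt Zp Ztp : K →L[ℝ] E}
    {β σ μ η ζ θ ρ D γ s b E1 E2 E3 : ℝ}

namespace StepHyp


lemma surj
    (h : StepHyp π F Δ M Z Zt Zp Ztp β σ μ η ζ θ ρ D γ s b E1 E2 E3)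
    (w : E) : ∃ y, InR π Z y ∧ π (Zp y) = π w := by
  set G : K →ₗ[ℝ] E := ((π.comp Z : K →L[ℝ] E) : K →ₗ[ℝ] E) with hG
  set Gp : K →ₗ[ℝ] E := ((π.comp Zp : K →L[ℝ] E) : K →ₗ[ℝ] E) with hGp
  set R := (LinearMap.ker G)ᗮ with hR
  have hRm : ∀ y ∈ R, InR π Z y := by
    intro y hy x hx
    exact (Submodule.mem_orthogonal _ _).1 hy x (by simpa [hG] using hx)
  have hinj : Function.Injective (Gp.domRestrict R) := by
    rw [← LinearMap.ker_eq_bot, LinearMap.ker_eq_bot']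
    rintro ⟨y, hy⟩ h0
    have h0' : π (Zp y) = 0 := by simpa [hGp] using h0
    have h1 := h.low (hRm y hy)
    have h2 := h.i6 y (hRm y hy)
    rw [h0', norm_zero, mul_zero] at h1
    have : s * ‖y‖ ≤ s * 0 := by linarith
    have h3 := le_of_mul_le_mul_left this h.hs
    ext
    exact norm_le_zero_iff.1 h3
  have hrange : LinearMap.range G = LinearMap.range (π : E →ₗ[ℝ] E) := by
    apply le_antisymm
    · rintro _ ⟨x, rfl⟩
      exact ⟨Z x, rfl⟩
    · rintro _ ⟨x, rfl⟩
      obtain ⟨y, hy⟩ := h.i8 x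
      exact ⟨y, hy⟩
  have hle : LinearMap.range (Gp.domRestrict R) ≤ LinearMap.range (π : E →ₗ[ℝ] E) := by
    rintro _ ⟨x, rfl⟩
    exact ⟨Zp x, rfl⟩
  have hfr : Module.finrank ℝ (LinearMap.range (Gp.domRestrict R)) =
      Module.finrank ℝ (LinearMap.range (π : E →ₗ[ℝ] E)) := by
    rw [LinearMap.finrank_range_of_inj hinj, ← hrange]
    have h1 := (LinearMap.ker G).finrank_add_finrank_orthogonal
    have h2 := LinearMap.finrank_range_add_finrank_ker G
    rw [← hR] at h1
    omega
  have heq := Submodule.eq_of_le_of_finrank_eq hle hfr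
  have hw : π w ∈ LinearMap.range (Gp.domRestrict R) := by
    rw [heq]; exact ⟨w, rfl⟩
  obtain ⟨⟨y, hy⟩, hyw⟩ := hw
  exact ⟨y, hRm y hy, by simpa [hGp] using hyw⟩

lemma rot_perp
    (h : StepHyp π F Δ M Z Zt Zp Ztp β σ μ η ζ θ ρ D γ s b E1 E2 E3)
    {y1 y2 : K} (h1 : InR π Z y1) (h2 : π (Z y2) = 0) (hy : InR π Zp (y1 + y2)) :
    ‖y2‖ ≤ μ * (6 * E1 + η * b * γ) * ‖y1‖ := by
  obtain ⟨x1, hx1, hx⟩ := h.surj (-(Zp y2))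
  have h0 : π (Zp (x1 + y2)) = 0 := by rw [map_add, map_add, hx, map_neg, neg_add_cancel]
  obtain ⟨hr, -⟩ := h.ker_rot hx1 h2 h0
  have hi := hy _ h0
  rw [inner_add_left, inner_add_right, inner_add_right] at hi
  have e1 : inner ℝ y2 x1 = 0 := hx1 y2 h2
  have e2 : inner ℝ y2 y1 = 0 := h1 y2 h2
  have e3 : ‖y2‖ ^ 2 ≤ ‖x1‖ * ‖y1‖ := by
    have e4 := real_inner_le_norm (-x1) y1
    rw [inner_neg_left, norm_neg] at e4
    have e5 : inner ℝ y2 y2 = ‖y2‖ ^ 2 := real_inner_self_eq_norm_sq y2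
    have e6 : inner ℝ x1 y2 = 0 := by rw [real_inner_comm]; exact e1
    have e7 : inner ℝ y1 x1 = inner ℝ x1 y1 := real_inner_comm _ _
    linarith
  rcases eq_or_ne y2 0 with rfl | hne
  · rw [norm_zero]
    have := h.phi_nonneg; have := h.hμ
    positivity
  · have hpos : 0 < ‖y2‖ := norm_pos_iff.2 hne
    have : ‖y2‖ * ‖y2‖ ≤ ‖y2‖ * (μ * (6 * E1 + η * b * γ) * ‖y1‖) := by
      calc ‖y2‖ * ‖y2‖ = ‖y2‖ ^ 2 := by ring
        _ ≤ ‖x1‖ * ‖y1‖ := e3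
        _ ≤ (μ * (6 * E1 + η * b * γ) * ‖y2‖) * ‖y1‖ := by gcongr
        _ = _ := by ring
    exact le_of_mul_le_mul_left this hpos

lemma range_decomp
    (h : StepHyp π F Δ M Z Zt Zp Ztp β σ μ η ζ θ ρ D γ s b E1 E2 E3)
    {y : K} (hy : InR π Zp y) : ∃ y1 y2 g : K, y = y1 + y2 ∧ InR π Z y1 ∧
    π (Z y2) = 0 ∧ InR π Z g ∧ (∀ z, InR π Z z → inner ℝ z g = inner ℝ (Z z) (Z y1)) ∧
    ‖y2‖ ≤ μ * (6 * E1 + η * b * γ) * ‖y1‖ ∧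
    γ * ‖y2‖ ≤ 3 * (μ * (6 * E1 + η * b * γ)) * ‖Z y1‖ ∧ ‖g‖ ≤ b * ‖Z y1‖ ∧
    ‖Z y1‖ ≤ 2 * ‖Z (y1 - μ • g)‖ ∧
    ‖Zp y - (Z (y1 - μ • g) + μ • F (Z (y1 - μ • g)))‖ ≤ μ * E3 * ‖Z y1‖ := by
  have hμ := h.hμ
  have hb := h.hb0
  have hβ := h.hβ
  have hη := h.hη
  have hγ := h.hγ
  have hθ := h.hθ
  have hφ := h.phi_nonneg
  have hs := h.hs
  obtain ⟨y1, y2, rfl, h1, h2⟩ := exists_decomp π Z y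
  obtain ⟨g, g', hgg, hg, hg'⟩ := exists_decomp π Z (adjoint Z (Z y1))
  have hy2 := h.rot_perp h1 h2 hy
  set u := Z y1 with hu
  have hun := norm_nonneg u
  have hi1 : ∀ z, InR π Z z → inner ℝ z g = inner ℝ (Z z) u := by
    intro z hz
    have : inner ℝ z (adjoint Z u) = inner ℝ (Z z) u := adjoint_inner_right Z z u
    rw [← this, hgg, inner_add_right, real_inner_comm g', hz g' hg', add_zero]
  have hgn : ‖g‖ ≤ b * ‖u‖ := by
    apply norm_le_of_inner_le _ (by positivity)
    rw [hi1 g hg]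
    calc _ ≤ ‖Z g‖ * ‖u‖ := real_inner_le_norm _ _
      _ ≤ (b * ‖g‖) * ‖u‖ := by gcongr; exact h.Z_norm g
      _ = _ := by ring
  have hg'n : ‖g'‖ ≤ γ * η * ‖u‖ := by
    apply norm_le_of_inner_le _ (by positivity)
    have e1 : inner ℝ g' g' = inner ℝ g' (adjoint Z u) := by
      rw [hgg, inner_add_right, hg g' hg', zero_add]
    have e2 : inner ℝ (Z g') u = inner ℝ (Z g') (u - π u) := by
      rw [inner_sub_right, ← h.π_symm, hg', inner_zero_left, sub_zero]
    rw [e1, adjoint_inner_right, e2]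
    calc _ ≤ ‖Z g'‖ * ‖u - π u‖ := real_inner_le_norm _ _
      _ ≤ (γ * ‖g'‖) * (η * ‖u‖) := by
        gcongr
        · exact h.i2 _ hg'
        · exact h.i4' h1
      _ = _ := by ring
  have hZg : ‖Z g‖ ≤ 4 * β * ‖u‖ := by
    calc _ ≤ b * ‖g‖ := h.Z_norm g
      _ ≤ b * (b * ‖u‖) := by gcongr
      _ = _ := by rw [← h.hb2]; ring
  have hsy : s * ‖y1‖ ≤ ‖u‖ := (h.i6 y1 h1).trans (h.pi_norm _)
  have hγy2 : γ * ‖y2‖ ≤ 3 * (μ * (6 * E1 + η * b * γ)) * ‖u‖ := by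
    calc γ * ‖y2‖ ≤ (3 * s) * (μ * (6 * E1 + η * b * γ) * ‖y1‖) := by
          gcongr
          exact h.hγs
      _ = 3 * (μ * (6 * E1 + η * b * γ)) * (s * ‖y1‖) := by ring
      _ ≤ _ := by gcongr
  refine ⟨y1, y2, g, rfl, h1, h2, hg, hi1, hy2, hγy2, hgn, ?_, ?_⟩
  · have e1 : u = Z (y1 - μ • g) + μ • Z g := by rw [map_sub, map_smul, sub_add_cancel]
    have e2 : ‖μ • Z g‖ ≤ μ * (4 * β * ‖u‖) := by
      rw [norm_smul, Real.norm_of_nonneg hμ.le]; gcongr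
    have e3 : ‖u‖ ≤ ‖Z (y1 - μ • g)‖ + ‖μ • Z g‖ := by
      conv_lhs => rw [e1]
      exact norm_add_le _ _
    have e4 : μ * (4 * β * ‖u‖) = 4 * (μ * β) * ‖u‖ := by ring
    have e5 : 4 * (μ * β) * ‖u‖ ≤ 1 / 2 * ‖u‖ := by
      gcongr; linarith [h.hμβ]
    linarith
  · have e : Zp (y1 + y2) - (Z (y1 - μ • g) + μ • F (Z (y1 - μ • g))) =
        μ • μ • F (Z g) - μ • Z g' + μ • Zt (adjoint Zt u) + μ • Δ u + (Z y2 + μ • M (Z y2)) := by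
      rw [map_add Zp, h.hZp y1, h.hZp y2, ← hu, h.hM u, hgg]
      simp only [map_add, map_sub, map_smul]
      rw [← hu]
      module
    have b1 : ‖μ • μ • F (Z g)‖ ≤ μ * (μ * (β * (4 * β * ‖u‖))) := by
      rw [norm_smul, norm_smul, Real.norm_of_nonneg hμ.le]
      gcongr
      exact (h.F_norm _).trans (by gcongr)
    have b2 : ‖μ • Z g'‖ ≤ μ * (γ * (γ * η * ‖u‖)) := by
      rw [norm_smul, Real.norm_of_nonneg hμ.le]
      gcongr
      exact (h.i2 _ hg').trans (by gcongr)
    have b3 : ‖μ • Zt (adjoint Zt u)‖ ≤ μ * (b * (θ * ‖u‖)) := by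
      rw [norm_smul, Real.norm_of_nonneg hμ.le]
      gcongr
      exact (h.Zt_norm _).trans (by gcongr; exact h.i5 _ h1)
    have b4 : ‖μ • Δ u‖ ≤ μ * (D * ‖u‖) := by
      rw [norm_smul, Real.norm_of_nonneg hμ.le]
      gcongr
      exact h.Δ_norm _
    have b5 : ‖Z y2 + μ • M (Z y2)‖ ≤ 2 * (3 * (μ * (6 * E1 + η * b * γ)) * ‖u‖) := by
      have c1 := h.muM (Z y2)
      have c2 : 10 * (μ * β) * ‖Z y2‖ ≤ 1 * ‖Z y2‖ := by
        gcongr; linarith [h.hμβ]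
      have c3 := h.i2 y2 h2
      have c4 := norm_add_le (Z y2) (μ • M (Z y2))
      linarith
    rw [e]
    have b6 : ‖μ • μ • F (Z g) - μ • Z g' + μ • Zt (adjoint Zt u) + μ • Δ u
        + (Z y2 + μ • M (Z y2))‖ ≤ μ * (μ * (β * (4 * β * ‖u‖))) + μ * (γ * (γ * η * ‖u‖))
        + μ * (b * (θ * ‖u‖)) + μ * (D * ‖u‖)
        + 2 * (3 * (μ * (6 * E1 + η * b * γ)) * ‖u‖) := by
      refine (norm_add_le _ _).trans (add_le_add ?_ b5)
      refine (norm_add_le _ _).trans (add_le_add ?_ b4)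
      refine (norm_add_le _ _).trans (add_le_add ?_ b3)
      exact (norm_sub_le _ _).trans (add_le_add b1 b2)
    refine b6.trans ?_
    calc _ = μ * (4 * (μ * β ^ 2) + γ ^ 2 * η + b * θ + D + 6 * (6 * E1 + η * b * γ)) * ‖u‖ := by
          ring
      _ ≤ _ := by gcongr; exact h.hE3

lemma phi_le
    (h : StepHyp π F Δ M Z Zt Zp Ztp β σ μ η ζ θ ρ D γ s b E1 E2 E3)
    : 6 * (6 * E1 + η * b * γ) ≤ E3 := by
  refine le_trans ?_ h.hE3
  have := h.hb0; have := h.hθ; have := h.hD; have := h.hμ; have := h.hη; have := h.hβ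
  have : 0 ≤ 4 * (μ * β ^ 2) + γ ^ 2 * η + b * θ + D := by positivity
  linarith

lemma expand_pi
    (h : StepHyp π F Δ M Z Zt Zp Ztp β σ μ η ζ θ ρ D γ s b E1 E2 E3)
    (u : E) : (1 + μ * σ) * ‖π u‖ ≤ ‖π (u + μ • F u)‖ := by
  rw [map_add, map_smul, h.F_comm]
  set p := π u with hp
  have h1 : (1 + μ * σ) * ‖p‖ ^ 2 ≤ inner ℝ (p + μ • F p) p := by
    rw [inner_add_left, real_inner_self_eq_norm_sq, inner_smul_left]
    have := h.F_pos u
    have h2 := mul_le_mul_of_nonneg_left this h.hμ.le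
    simp only [conj_trivial]
    linarith
  have h2 := real_inner_le_norm (p + μ • F p) p
  rcases eq_or_ne p 0 with h0 | h0
  · rw [h0]; simp
  · have hpos : 0 < ‖p‖ := norm_pos_iff.2 h0
    have : ((1 + μ * σ) * ‖p‖) * ‖p‖ ≤ ‖p + μ • F p‖ * ‖p‖ := by nlinarith
    exact le_of_mul_le_mul_right this hpos

lemma expand_u
    (h : StepHyp π F Δ M Z Zt Zp Ztp β σ μ η ζ θ ρ D γ s b E1 E2 E3)
    {z : K} (hz : InR π Z z) :
    (1 + μ * σ / 2) * ‖Z z‖ ≤ ‖Z z + μ • F (Z z)‖ := by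
  set u := Z z with hu
  have hβ := h.hβ
  have hq := h.i4' hz
  rw [← hu] at hq
  have hpy := h.pyth u
  have h4 : ‖u - π u‖ ^ 2 ≤ η ^ 2 * ‖u‖ ^ 2 := by rw [← mul_pow]; gcongr
  have hF : σ / 2 * ‖u‖ ^ 2 ≤ inner ℝ (F u) u := by
    have e : inner ℝ (F u) u = inner ℝ (F (π u)) (π u) + inner ℝ (F (u - π u)) (u - π u) := by
      have c1 : inner ℝ (F (π u)) (u - π u) = 0 := by
        rw [← h.F_comm, h.π_symm, h.pi_sub, inner_zero_right]
      have c2 : inner ℝ (F (u - π u)) (π u) = 0 := by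
        rw [← h.π_symm, h.F_comm, h.pi_sub, map_zero, inner_zero_left]
      have c3 : u = π u + (u - π u) := by abel
      conv_lhs => rw [c3]
      rw [map_add, inner_add_left, inner_add_right, inner_add_right, c1, c2]
      ring
    have d1 := h.F_pos u
    have d2 : -(β * ‖u - π u‖ ^ 2) ≤ inner ℝ (F (u - π u)) (u - π u) := by
      have := real_inner_le_norm (-(F (u - π u))) (u - π u)
      rw [inner_neg_left, norm_neg] at this
      have d3 : ‖F (u - π u)‖ * ‖u - π u‖ ≤ (β * ‖u - π u‖) * ‖u - π u‖ := by
        gcongr; exact h.F_norm _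
      nlinarith
    have d4 : (σ + β) * ‖u - π u‖ ^ 2 ≤ (2 * β) * (η ^ 2 * ‖u‖ ^ 2) := by
      gcongr; linarith [h.hσβ]
    have d5 : (2 * β) * (η ^ 2 * ‖u‖ ^ 2) ≤ σ / 2 * ‖u‖ ^ 2 := by
      have := h.hη2
      have d6 : 2 * (β * η ^ 2) ≤ σ / 2 := by
        have : 0 ≤ β * η ^ 2 := by positivity
        linarith
      calc _ = 2 * (β * η ^ 2) * ‖u‖ ^ 2 := by ring
        _ ≤ _ := by gcongr
    have d7 : σ * ‖π u‖ ^ 2 = σ * ‖u‖ ^ 2 - σ * ‖u - π u‖ ^ 2 := by rw [hpy]; ring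
    rw [e]; linarith
  have h1 : (1 + μ * σ / 2) * ‖u‖ ^ 2 ≤ inner ℝ (u + μ • F u) u := by
    rw [inner_add_left, real_inner_self_eq_norm_sq, inner_smul_left]
    have h2 := mul_le_mul_of_nonneg_left hF h.hμ.le
    simp only [conj_trivial]
    linarith
  have h2 := real_inner_le_norm (u + μ • F u) u
  rcases eq_or_ne u 0 with h0 | h0
  · rw [h0]; simp
  · have hpos : 0 < ‖u‖ := norm_pos_iff.2 h0
    have : ((1 + μ * σ / 2) * ‖u‖) * ‖u‖ ≤ ‖u + μ • F u‖ * ‖u‖ := by nlinarith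
    exact le_of_mul_le_mul_right this hpos

/-- the angle stays small -/
lemma angle
    (h : StepHyp π F Δ M Z Zt Zp Ztp β σ μ η ζ θ ρ D γ s b E1 E2 E3)
    {y : K} (hy : InR π Zp y) : ‖Zp y - π (Zp y)‖ ≤ η * ‖π (Zp y)‖ := by
  obtain ⟨y1, y2, g, -, h1, h2, hg, -, -, -, -, hu, he⟩ := h.range_decomp hy
  set z := y1 - μ • g with hz
  have hzR : InR π Z z := h1.sub (hg.smul μ)
  set v := Zp y with hv
  set e := v - (Z z + μ • F (Z z)) with hee
  have hvd : v = (Z z + μ • F (Z z)) + e := by rw [hee]; abel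
  have a1 := h.i4 z hzR
  have a2 := h.expand_pi (Z z)
  have a3 : ‖(Z z + μ • F (Z z)) - π (Z z + μ • F (Z z))‖ ≤ ‖Z z - π (Z z)‖ := by
    have := h.contr_F (Z z - π (Z z)) (h.pi_sub _)
    have e : Z z - π (Z z) + μ • F (Z z - π (Z z)) =
      (Z z + μ • F (Z z)) - π (Z z + μ • F (Z z)) := by
      have key : ∀ w : E, w - π w + μ • F (w - π w) = (w + μ • F w) - π (w + μ • F w) := by
        intro w
        rw [map_sub F, map_add π, map_smul π, h.F_comm]; module
      exact key _
    rwa [e] at this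
  have a4 := h.R_norm hzR
  have b1 : ‖v - π v‖ ≤ η * ‖π (Z z)‖ + ‖e‖ := by
    have e1 : v - π v = ((Z z + μ • F (Z z)) - π (Z z + μ • F (Z z))) + (e - π e) := by
      conv_lhs => rw [hvd]
      rw [map_add π _ e]; abel
    rw [e1]
    refine (norm_add_le _ _).trans (add_le_add (a3.trans a1) (h.pi_norm' e))
  have b2 : (1 + μ * σ) * ‖π (Z z)‖ ≤ ‖π v‖ + ‖e‖ := by
    have e1 : π (Z z + μ • F (Z z)) = π v - π e := by
      conv_rhs => rw [hvd]
      rw [map_add π _ e]; abel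
    rw [e1] at a2
    exact a2.trans ((norm_sub_le _ _).trans (add_le_add_right (h.pi_norm e) _))
  have hη := h.hη
  have hμ := h.hμ
  have hE3 := h.E3_nonneg
  have b3 : ‖e‖ ≤ μ * (4 * E3) * ‖π (Z z)‖ := by
    calc ‖e‖ ≤ μ * E3 * ‖Z y1‖ := he
      _ ≤ μ * E3 * (4 * ‖π (Z z)‖) := by gcongr; linarith
      _ = _ := by ring
  have b4 : (1 + η) * ‖e‖ ≤ η * (μ * σ) * ‖π (Z z)‖ := by
    calc (1 + η) * ‖e‖ ≤ 2 * (μ * (4 * E3) * ‖π (Z z)‖) := by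
          gcongr; linarith [h.hη1]
      _ = μ * (8 * E3) * ‖π (Z z)‖ := by ring
      _ ≤ μ * (σ * η) * ‖π (Z z)‖ :=
        mul_le_mul_of_nonneg_right (mul_le_mul_of_nonneg_left h.cC hμ.le) (norm_nonneg _)
      _ = _ := by ring
  have b5 := mul_le_mul_of_nonneg_left b2 hη.le
  nlinarith

/-- the balancedness on the signal part stays small -/
lemma bal_sig
    (h : StepHyp π F Δ M Z Zt Zp Ztp β σ μ η ζ θ ρ D γ s b E1 E2 E3)
    {y : K} (hy : InR π Zp y) : ‖adjoint Ztp (Zp y)‖ ≤ θ * ‖Zp y‖ := by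
  obtain ⟨y1, y2, g, hyd, h1, h2, hg, -, -, hγy2, hgn, hu, he⟩ := h.range_decomp hy
  have hμ := h.hμ
  have hb := h.hb0
  have hβ := h.hβ
  have hη := h.hη
  have hγ := h.hγ
  have hζ := h.hζ
  have hθ := h.hθ
  have hρ := h.hρ
  have hE3 := h.E3_nonneg
  have hφ := h.phi_nonneg
  set φ := 6 * E1 + η * b * γ with hφd
  set z := y1 - μ • g with hz
  have hzR : InR π Z z := h1.sub (hg.smul μ)
  have a1 : (1 + μ * σ / 2) * ‖Z z‖ ≤ ‖Zp y‖ + μ * E3 * ‖Z y1‖ := by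
    refine (h.expand_u hzR).trans ?_
    have e : Z z + μ • F (Z z) = Zp y - (Zp y - (Z z + μ • F (Z z))) := by abel
    rw [e]
    refine (norm_sub_le _ _).trans (add_le_add_right ?_ _)
    exact he
  have hun := norm_nonneg (Z y1)
  have hyz : y = z + μ • g + y2 := by rw [hyd, hz, sub_add_cancel]
  have a2 : ‖adjoint Zt (Z y)‖ ≤ θ * ‖Z z‖ + μ * (ρ * (b * ‖Z y1‖))
      + ζ * (3 * (μ * φ) * ‖Z y1‖) := by
    rw [hyz, map_add, map_add, map_add, map_add]
    refine (norm_add_le _ _).trans (add_le_add ((norm_add_le _ _).trans (add_le_add ?_ ?_)) ?_)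
    · exact h.i5 z hzR
    · rw [map_smul, map_smul, norm_smul, Real.norm_of_nonneg hμ.le]
      gcongr
      exact (h.i7 g).trans (by gcongr)
    · refine (h.i3 y2 h2).trans ?_
      rw [mul_assoc]
      gcongr
  have a3 : ‖Z y‖ ≤ 2 * ‖Z y1‖ := by
    rw [hyd, map_add]
    have c1 := h.i2 y2 h2
    have c2 : 3 * (μ * φ) * ‖Z y1‖ ≤ 1 * ‖Z y1‖ := by
      gcongr
      have c3 := h.phi_le
      have c4 := h.cC
      have c5 := h.hη1
      have c6 := h.hμβ
      have c7 : σ * η ≤ β * 1 := by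
        have := h.hσβ; have := h.hσ
        gcongr; linarith
      have c8 : φ ≤ β := by linarith
      have : μ * φ ≤ μ * β := by gcongr
      linarith
    have := norm_add_le (Z y1) (Z y2)
    linarith
  have a4 := h.bal_err y
  have a5 : 100 * (μ * (μ * b * β ^ 2)) * ‖Z y‖ ≤ 100 * (μ * (μ * b * β ^ 2)) * (2 * ‖Z y1‖) := by
    gcongr
  have a6 : ‖adjoint Ztp (Zp y)‖ ≤ θ * ‖Z z‖
      + μ * (ρ * b + 3 * ζ * φ + 200 * (μ * b * β ^ 2)) * ‖Z y1‖ := by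
    rw [h.bal]
    refine (norm_sub_le _ _).trans ?_
    linarith
  have a7 : μ * (ρ * b + 3 * ζ * φ + 200 * (μ * b * β ^ 2) + θ * E3) * ‖Z y1‖
      ≤ θ * (μ * σ / 2) * ‖Z z‖ := by
    calc _ ≤ μ * (ρ * b + 3 * ζ * φ + 200 * (μ * b * β ^ 2) + θ * E3) * (2 * ‖Z z‖) := by gcongr
      _ = μ * (2 * (ρ * b + 3 * ζ * φ + 200 * (μ * b * β ^ 2)) + 2 * θ * E3) * ‖Z z‖ := by ring
      _ ≤ μ * (θ * σ / 2) * ‖Z z‖ := by gcongr; exact h.cG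
      _ = _ := by ring
  have a8 := mul_le_mul_of_nonneg_left a1 hθ
  nlinarith

set_option maxHeartbeats 1000000 in
/-- signal growth -/
lemma growth
    (h : StepHyp π F Δ M Z Zt Zp Ztp β σ μ η ζ θ ρ D γ s b E1 E2 E3)
    (hsσ : s ^ 2 ≤ σ / 8) {y : K} (hy : InR π Zp y) :
    (1 + μ * σ / 8) * s * ‖y‖ ≤ ‖π (Zp y)‖ := by
  obtain ⟨y1, y2, hh, hyd, h1, h2, hg, hhi, hy2, -, -, hu, he⟩ := h.range_decomp hy
  have hμ := h.hμ
  have hb := h.hb0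
  have hβ := h.hβ
  have hη := h.hη
  have hσ := h.hσ
  have hs := h.hs
  have hE3 := h.E3_nonneg
  have hφ := h.phi_nonneg
  have hμβ := h.hμβ
  have hμσ : 100 * (μ * σ) ≤ 1 := by
    have : μ * σ ≤ μ * β := by gcongr; exact h.hσβ
    linarith
  set φ := 6 * E1 + η * b * γ with hφd
  set u := Z y1 with hud
  -- the auxiliary operator
  set T : K →L[ℝ] K := (adjoint Z).comp (π.comp Z) with hT
  have hTa : ∀ x, T x = adjoint Z (π (Z x)) := fun x => rfl
  have hTi : ∀ x w, inner ℝ (T x) w = inner ℝ (π (Z x)) (π (Z w)) := by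
    intro x w
    rw [hTa, adjoint_inner_left, ← h.π_symm, h.π_idem]
  have hTi' : ∀ x w, inner ℝ x (T w) = inner ℝ (π (Z x)) (π (Z w)) := by
    intro x w
    rw [real_inner_comm, hTi, real_inner_comm]
  have hTR : ∀ x, InR π Z (T x) := by
    intro x w hw
    rw [hTi', hw, inner_zero_left]
  have hTn : ∀ x, ‖T x‖ ≤ b * ‖π (Z x)‖ := fun x => by rw [hTa]; exact h.Zadj _
  set Dd : K →L[ℝ] K := T - (s ^ 2) • ContinuousLinearMap.id ℝ K with hDd
  have hDa : ∀ x, Dd x = T x - (s ^ 2) • x := fun x => by simp [hDd]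
  have hDi : ∀ x, inner ℝ (Dd x) x = ‖π (Z x)‖ ^ 2 - s ^ 2 * ‖x‖ ^ 2 := by
    intro x
    rw [hDa, inner_sub_left, hTi, inner_smul_left, real_inner_self_eq_norm_sq,
      real_inner_self_eq_norm_sq]
    simp
  have hDnn : ∀ x, InR π Z x → 0 ≤ inner ℝ (Dd x) x := by
    intro x hx
    rw [hDi, sub_nonneg, ← mul_pow]
    gcongr
    exact h.i6 x hx
  have hDb := psd_bound Dd (4 * β) (by positivity) y1 (by
      intro a c
      rw [hDa, hDa, inner_sub_left, inner_sub_right, hTi, hTi', inner_smul_left, inner_smul_right]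
      simp)
    (by
      apply hDnn
      refine h1.sub (InR.smul _ ?_)
      rw [hDa]
      exact (hTR y1).sub (h1.smul _))
    (by
      rw [hDi, ← h.hb2, ← mul_pow]
      have : ‖π (Z (Dd y1))‖ ^ 2 ≤ (b * ‖Dd y1‖) ^ 2 := by
        gcongr
        exact (h.pi_norm _).trans (h.Z_norm _)
      have : 0 ≤ s ^ 2 * ‖Dd y1‖ ^ 2 := by positivity
      linarith)
  set A := ‖π (Z (y1 - μ • T y1))‖ with hA
  have hA0 : 0 ≤ A := norm_nonneg _
  have hTT : ‖T y1‖ ^ 2 = ‖Dd y1‖ ^ 2 + 2 * s ^ 2 * inner ℝ (Dd y1) y1 + s ^ 4 * ‖y1‖ ^ 2 := by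
    have e1 : T y1 = Dd y1 + (s ^ 2) • y1 := by rw [hDa, sub_add_cancel]
    rw [e1, norm_add_sq_real, inner_smul_right, norm_smul, Real.norm_of_nonneg (by positivity)]
    ring
  have hA2 : ‖π u‖ ^ 2 - 2 * μ * ‖T y1‖ ^ 2 ≤ A ^ 2 := by
    rw [hA, map_sub, map_sub, map_smul, map_smul, norm_sub_sq_real, inner_smul_right, ← hTi,
      real_inner_self_eq_norm_sq]
    nlinarith [sq_nonneg ‖μ • π (Z (T y1))‖]
  have hd1 := hDi y1
  have hd0 := hDnn y1 h1
  have hlowA : (s * (1 - μ * σ / 4) * ‖y1‖) ^ 2 ≤ A ^ 2 := by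
    refine le_trans ?_ hA2
    set d := inner ℝ (Dd y1) y1 with hd
    have c1 : ‖π u‖ ^ 2 = d + s ^ 2 * ‖y1‖ ^ 2 := by rw [hud]; linarith
    rw [c1, hTT]
    have c2 : 2 * μ * ‖Dd y1‖ ^ 2 ≤ 8 * (μ * β) * d := by
      calc _ ≤ 2 * μ * (4 * β * d) := by gcongr
        _ = _ := by ring
    have c3 : μ * s ^ 2 ≤ μ * σ / 8 := by
      calc μ * s ^ 2 ≤ μ * (σ / 8) := by gcongr
        _ = _ := by ring
    have c4 : 4 * (μ * s ^ 2) * d ≤ 1 / 2 * d := by gcongr; linarith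
    have c5 : 8 * (μ * β) * d ≤ 1 / 2 * d := by gcongr; linarith
    have c6 : 2 * μ * (s ^ 4 * ‖y1‖ ^ 2) ≤ μ * σ / 4 * (s ^ 2 * ‖y1‖ ^ 2) := by
      calc _ = 2 * (μ * s ^ 2) * (s ^ 2 * ‖y1‖ ^ 2) := by ring
        _ ≤ 2 * (μ * σ / 8) * (s ^ 2 * ‖y1‖ ^ 2) := by gcongr
        _ = _ := by ring
    have c7 : (s * (1 - μ * σ / 4) * ‖y1‖) ^ 2 ≤ (1 - μ * σ / 4) * (s ^ 2 * ‖y1‖ ^ 2) := by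
      have hx0 : 0 ≤ μ * σ / 4 := by positivity
      have : (1 - μ * σ / 4) ^ 2 ≤ 1 - μ * σ / 4 := by nlinarith
      calc _ = (1 - μ * σ / 4) ^ 2 * (s ^ 2 * ‖y1‖ ^ 2) := by ring
        _ ≤ _ := by gcongr
    nlinarith
  have hlow : s * (1 - μ * σ / 4) * ‖y1‖ ≤ A := abs_le_of_sq_le_sq' hlowA hA0 |>.2
  have hπuA : ‖π u‖ ≤ 2 * A := by
    have e1 : π u = π (Z (y1 - μ • T y1)) + μ • π (Z (T y1)) := by
      rw [map_sub, map_sub, map_smul, map_smul, sub_add_cancel]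
    have e2 : ‖μ • π (Z (T y1))‖ ≤ μ * (b * (b * ‖π u‖)) := by
      rw [norm_smul, Real.norm_of_nonneg hμ.le]
      gcongr
      refine (h.pi_norm _).trans ((h.Z_norm _).trans ?_)
      gcongr
      exact hTn y1
    have e3 : μ * (b * (b * ‖π u‖)) = 4 * (μ * β) * ‖π u‖ := by
      calc _ = μ * b ^ 2 * ‖π u‖ := by ring
        _ = _ := by rw [h.hb2]; ring
    have e4 : 4 * (μ * β) * ‖π u‖ ≤ 1 / 2 * ‖π u‖ := by gcongr; linarith
    have e5 : ‖π u‖ ≤ A + ‖μ • π (Z (T y1))‖ := by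
      conv_lhs => rw [e1]
      exact norm_add_le _ _
    linarith
  have huA : ‖u‖ ≤ 4 * A := by linarith [h.R_norm h1]
  -- compare hh with T y1
  have hcmp : ‖hh - T y1‖ ≤ η ^ 2 * b * ‖u‖ := by
    apply norm_le_of_inner_le _ (by positivity)
    set w := hh - T y1 with hw
    have hwR : InR π Z w := hg.sub (hTR y1)
    have e1 : inner ℝ w w = inner ℝ (Z w - π (Z w)) (u - π u) := by
      have f1 : inner ℝ w hh = inner ℝ (Z w) u := hhi w hwR
      have f2 : inner ℝ w (T y1) = inner ℝ (π (Z w)) (π u) := hTi' w y1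
      have f3 : inner ℝ w w = inner ℝ w hh - inner ℝ w (T y1) := by
        conv_lhs => rw [hw]
        rw [← hw, inner_sub_left, real_inner_comm, real_inner_comm w (T y1)]
      rw [f3, f1, f2, inner_sub_left, inner_sub_right, inner_sub_right]
      have f4 : inner ℝ (Z w) (π u) = inner ℝ (π (Z w)) (π u) := by
        rw [h.π_symm, h.π_idem]
      have f5 : inner ℝ (π (Z w)) u = inner ℝ (π (Z w)) (π u) := by
        rw [← h.π_symm, h.π_idem]
      rw [f4, f5]; ring
    rw [e1]
    calc _ ≤ ‖Z w - π (Z w)‖ * ‖u - π u‖ := real_inner_le_norm _ _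
      _ ≤ (η * (b * ‖w‖)) * (η * ‖u‖) := by
        gcongr
        · exact (h.i4' hwR).trans (by gcongr; exact h.Z_norm _)
        · exact h.i4' h1
      _ = _ := by ring
  have hπu' : A - 16 * μ * (β * η ^ 2) * A ≤ ‖π (Z (y1 - μ • hh))‖ := by
    have e1 : π (Z (y1 - μ • T y1)) = π (Z (y1 - μ • hh)) + μ • π (Z (hh - T y1)) := by
      simp only [map_sub, map_smul, smul_sub]; abel
    have e2 : ‖μ • π (Z (hh - T y1))‖ ≤ μ * (b * (η ^ 2 * b * (4 * A))) := by
      rw [norm_smul, Real.norm_of_nonneg hμ.le]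
      gcongr
      refine (h.pi_norm _).trans ((h.Z_norm _).trans ?_)
      gcongr
      exact hcmp.trans (by gcongr)
    have e3 : μ * (b * (η ^ 2 * b * (4 * A))) = 16 * μ * (β * η ^ 2) * A := by
      calc _ = μ * b ^ 2 * η ^ 2 * (4 * A) := by ring
        _ = _ := by rw [h.hb2]; ring
    have e4 : A ≤ ‖π (Z (y1 - μ • hh))‖ + ‖μ • π (Z (hh - T y1))‖ := by
      rw [hA, e1]; exact norm_add_le _ _
    linarith
  have hfin : (1 + μ * σ) * ‖π (Z (y1 - μ • hh))‖ ≤ ‖π (Zp y)‖ + μ * E3 * (4 * A) := by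
    refine (h.expand_pi _).trans ?_
    set u' := Z (y1 - μ • hh) with hu'
    have e : π (u' + μ • F u') = π (Zp y) - π (Zp y - (u' + μ • F u')) := by
      rw [map_sub π (Zp y)]; abel
    rw [e]
    refine (norm_sub_le _ _).trans (add_le_add_right ?_ _)
    exact (h.pi_norm _).trans (he.trans (by gcongr))
  have hE3σ : 64 * E3 ≤ σ := by
    have c1 := h.cC
    have c2 := h.hη1
    have : σ * (8 * η) ≤ σ * 1 := by gcongr
    linarith
  have hη2 := h.hη2
  have hgr : (1 + μ * σ / 2) * A ≤ ‖π (Zp y)‖ := by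
    have f1 : 16 * μ * (β * η ^ 2) * A ≤ μ * σ / 8 * A := by
      have : μ * (128 * (β * η ^ 2)) ≤ μ * σ := by gcongr
      gcongr
      linarith
    have f2 : μ * E3 * (4 * A) ≤ μ * σ / 16 * A := by
      have : μ * (64 * E3) ≤ μ * σ := by gcongr
      calc _ = (μ * (64 * E3)) / 16 * A := by ring
        _ ≤ _ := by gcongr
    have f3 : (1 + μ * σ) * (A - μ * σ / 8 * A) ≤ (1 + μ * σ) * ‖π (Z (y1 - μ • hh))‖ := by
      gcongr; linarith
    have hx : 0 ≤ μ * σ := by positivity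
    have f4 : 0 ≤ μ * σ * A := by positivity
    have f5 : (μ * σ) * (μ * σ * A) ≤ 1 / 100 * (μ * σ * A) := by gcongr; linarith
    nlinarith
  have hyn : ‖y‖ ≤ (1 + μ * σ / 40) * ‖y1‖ := by
    rw [hyd]
    have c1 := h.phi_le
    have c2 : μ * φ ≤ μ * σ / 40 := by
      have : μ * φ ≤ μ * (σ / 40) := by gcongr; linarith
      linarith
    have c3 : μ * φ * ‖y1‖ ≤ μ * σ / 40 * ‖y1‖ := by gcongr
    have := norm_add_le y1 y2
    linarith
  have hx : 0 ≤ μ * σ := by positivity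
  calc (1 + μ * σ / 8) * s * ‖y‖ ≤ (1 + μ * σ / 8) * s * ((1 + μ * σ / 40) * ‖y1‖) := by gcongr
    _ = ((1 + μ * σ / 8) * (1 + μ * σ / 40)) * (s * ‖y1‖) := by ring
    _ ≤ ((1 + μ * σ / 2) * (1 - μ * σ / 4)) * (s * ‖y1‖) :=
        mul_le_mul_of_nonneg_right (by nlinarith) (by positivity)
    _ = (1 + μ * σ / 2) * (s * (1 - μ * σ / 4) * ‖y1‖) := by ring
    _ ≤ (1 + μ * σ / 2) * A := by gcongr
    _ ≤ _ := hgr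

end StepHyp

end Abstract

section Abstract
open ContinuousLinearMap
variable {E K : Type*} [NormedAddCommGroup E] [InnerProductSpace ℝ E] [CompleteSpace E]
  [FiniteDimensional ℝ E]
  [NormedAddCommGroup K] [InnerProductSpace ℝ K] [CompleteSpace K] [FiniteDimensional ℝ K]

/-- the invariant of the second phase -/
structure Inv (π : E →L[ℝ] E) (Z Zt : K →L[ℝ] E) (b ζ η θ γ s r0 : ℝ) : Prop where
  Z_norm : ∀ x, ‖Z x‖ ≤ b * ‖x‖
  i2 : ∀ x, π (Z x) = 0 → ‖Z x‖ ≤ γ * ‖x‖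
  i3 : ∀ x, π (Z x) = 0 → ‖adjoint Zt (Z x)‖ ≤ ζ * γ * ‖x‖
  i4 : ∀ y, InR π Z y → ‖Z y - π (Z y)‖ ≤ η * ‖π (Z y)‖
  i5 : ∀ y, InR π Z y → ‖adjoint Zt (Z y)‖ ≤ θ * ‖Z y‖
  i6 : ∀ y, InR π Z y → s * ‖y‖ ≤ ‖π (Z y)‖
  i7 : ∀ x, ‖adjoint Zt (Z x)‖ ≤ r0 * ‖x‖
  i8 : ∀ w, ∃ x, π (Z x) = π w

/-- the fixed data of the second phase -/
structure Glob (π F : E →L[ℝ] E) (Δ : ℕ → E →L[ℝ] E) (Z Zt : ℕ → K →L[ℝ] E)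
    (β σ μ κ k : ℝ) : Prop where
  π_idem : ∀ x, π (π x) = π x
  π_symm : ∀ x y, inner ℝ (π x) y = inner ℝ x (π y)
  F_symm : ∀ x y, inner ℝ (F x) y = inner ℝ x (F y)
  F_comm : ∀ x, π (F x) = F (π x)
  F_norm : ∀ x, ‖F x‖ ≤ β * ‖x‖
  F_pos : ∀ x, σ * ‖π x‖ ^ 2 ≤ inner ℝ (F (π x)) (π x)
  F_neg : ∀ x, π x = 0 → inner ℝ (F x) x ≤ 0
  Δ_symm : ∀ t x y, inner ℝ (Δ t x) y = inner ℝ x (Δ t y)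
  hZp : ∀ t x, Z (t + 1) x = Z t x + μ • (F (Z t x) - Z t (adjoint (Z t) (Z t x))
    + Zt t (adjoint (Zt t) (Z t x)) + Δ t (Z t x))
  hZtp : ∀ t x, Zt (t + 1) x = Zt t x - μ • (F (Zt t x) - Z t (adjoint (Z t) (Zt t x))
    + Zt t (adjoint (Zt t) (Zt t x)) + Δ t (Zt t x))
  hZt : ∀ t x, ‖Zt t x‖ = ‖Z t x‖
  hβ : β = κ * σ
  hσ : 0 < σ
  hκ : 1 ≤ κ
  hμ : 0 < μ
  hμβ : μ * β * κ ^ 4 ≤ 1 / 10 ^ 13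
  hk : 1 ≤ k
  hΔ : ∀ t γ, 0 ≤ γ → k * γ ^ 2 ≤ β → (∀ x, ‖Z t x‖ ≤ 2 * √β * ‖x‖) →
    (∀ x, π (Z t x) = 0 → ‖Z t x‖ ≤ γ * ‖x‖) → (∀ w, ∃ x, π (Z t x) = π w) →
    ∀ v, ‖Δ t v‖ ≤ 11 / 10 ^ 9 * (σ / κ ^ 2) * ‖v‖

variable {π F : E →L[ℝ] E} {Δ : ℕ → E →L[ℝ] E} {Z Zt : ℕ → K →L[ℝ] E} {β σ μ κ k : ℝ}
  {η γ s r0 : ℝ} {t : ℕ}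

set_option maxHeartbeats 2000000 in
lemma stepHyp_of (g : Glob π F Δ Z Zt β σ μ κ k)
    (hη1 : 1 / 2000 / κ ^ 2 ≤ η) (hη2 : η ≤ 1 / 1000 / κ ^ 2) (hγ : 0 ≤ γ) (hs : 0 < s)
    (hγs : γ ≤ 3 * s) (hkγ : k * κ * γ ^ 2 ≤ σ / 10 ^ 6)
    (hr : r0 ≤ 1 / 10 ^ 9 * (β / κ ^ 4))
    (hI : Inv π (Z t) (Zt t) (2 * √β) (1 / 4000000 * (√β / κ ^ 3)) η
      (1 / 4000000 * (√β / κ ^ 3)) γ s r0) :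
    StepHyp π F (Δ t) (F - (Z t).comp (adjoint (Z t)) + (Zt t).comp (adjoint (Zt t)) + Δ t)
      (Z t) (Zt t) (Z (t + 1)) (Zt (t + 1))
      β σ μ η (1 / 4000000 * (√β / κ ^ 3)) (1 / 4000000 * (√β / κ ^ 3)) (1 / 10 ^ 9 * (β / κ ^ 4))
      (11 / 10 ^ 9 * (σ / κ ^ 2)) γ s (2 * √β) (52 / 10 ^ 8 * (σ / κ ^ 2)) (401 / 10 ^ 5 * (σ / κ))
      (32 / 10 ^ 6 * (σ / κ ^ 2)) := by
  have hσ := g.hσ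
  have hκ := g.hκ
  have hκ0 : 0 < κ := by linarith
  have hμ := g.hμ
  have hβe := g.hβ
  have hβ : 0 < β := by rw [hβe]; positivity
  have hσβ : σ ≤ β := by rw [hβe]; nlinarith
  set a := √β with ha
  have ha0 : 0 < a := Real.sqrt_pos.2 hβ
  have ha2 : a ^ 2 = β := Real.sq_sqrt hβ.le
  set q := σ / κ ^ 2 with hq
  set u := a / κ ^ 3 with hu
  set p := σ / κ with hp
  have hu0 : 0 < u := by positivity
  have hq0 : 0 < q := by positivity
  have hp0 : 0 < p := by positivity
  have hpσ : p ≤ σ := by rw [hp, div_le_iff₀ hκ0]; nlinarith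
  have hqp : q ≤ p := by
    rw [hq, hp]; gcongr; nlinarith
  have hau : a * u = q := by
    rw [hu, hq]
    have : a * (a / κ ^ 3) = a ^ 2 / κ ^ 3 := by ring
    rw [this, ha2, hβe]; field_simp
  -- μ β² ≤ 10^(-13) σ / κ³
  have hμβ2 : μ * β ^ 2 * κ ^ 3 ≤ 1 / 10 ^ 13 * σ := by
    have h1 : μ * β ^ 2 * κ ^ 3 = (μ * β * κ ^ 4) * σ := by rw [hβe]; ring
    rw [h1]
    exact mul_le_mul_of_nonneg_right g.hμβ hσ.le
  have hμβ2' : μ * β ^ 2 ≤ 1 / 10 ^ 13 * (σ / κ ^ 3) := by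
    rw [← mul_div_assoc, le_div_iff₀ (by positivity)]; exact hμβ2
  have hσ3q : σ / κ ^ 3 ≤ q := by rw [hq]; gcongr <;> norm_num
  have hμβq : μ * β ^ 2 ≤ 1 / 10 ^ 13 * q := by linarith
  have hμβ1 : μ * β ≤ 1 / 10 ^ 13 := by
    have h1 : 1 ≤ κ ^ 4 := one_le_pow₀ hκ
    have h2 : 0 < μ * β := by positivity
    nlinarith [g.hμβ]
  have hμbβ : μ * (2 * a) * β ^ 2 ≤ 2 / 10 ^ 13 * (σ * u) := by
    have h1 : μ * (2 * a) * β ^ 2 = 2 * a * (μ * β ^ 2) := by ring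
    have h2 : 2 / 10 ^ 13 * (σ * u) = 2 * a * (1 / 10 ^ 13 * (σ / κ ^ 3)) := by rw [hu]; ring
    rw [h1, h2]; gcongr
  have hρb : β / κ ^ 4 * a = σ * u := by
    rw [hu, hβe]; field_simp
  have hη0 : 0 < η := lt_of_lt_of_le (by positivity) hη1
  have hησ : σ * η ≤ 1 / 1000 * q := by
    calc σ * η ≤ σ * (1 / 1000 / κ ^ 2) := by gcongr
      _ = _ := by rw [hq]; ring
  have hησ' : 1 / 2000 * q ≤ σ * η := by
    calc _ = σ * (1 / 2000 / κ ^ 2) := by rw [hq]; ring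
      _ ≤ σ * η := by gcongr
  have hβη : β * η ≤ 1 / 1000 * p := by
    calc β * η ≤ β * (1 / 1000 / κ ^ 2) := by gcongr
      _ = _ := by rw [hp, hβe]; field_simp
  have hη3 : η ≤ 1 / 1000 := by
    refine hη2.trans ?_
    rw [div_le_iff₀ (by positivity)]
    have : 1 ≤ κ ^ 2 := one_le_pow₀ hκ
    linarith
  have hκγ : κ * γ ^ 2 ≤ σ / 10 ^ 6 := by
    refine le_trans ?_ hkγ
    have : 0 ≤ κ * γ ^ 2 := by positivity
    nlinarith [g.hk]
  have hγ2 : γ ^ 2 ≤ σ / 10 ^ 6 := by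
    refine le_trans ?_ hκγ
    nlinarith [sq_nonneg γ]
  have hbγ : 2 * a * γ ≤ 2 / 10 ^ 3 * σ := by
    apply abs_le_of_sq_le_sq' _ (by positivity) |>.2
    calc (2 * a * γ) ^ 2 = 4 * a ^ 2 * γ ^ 2 := by ring
      _ = 4 * σ * (κ * γ ^ 2) := by rw [ha2, hβe]; ring
      _ ≤ 4 * σ * (σ / 10 ^ 6) := by gcongr
      _ = _ := by ring
  have hηbγ : η * (2 * a) * γ ≤ 2 / 10 ^ 6 * q := by
    calc η * (2 * a) * γ = η * (2 * a * γ) := by ring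
      _ ≤ η * (2 / 10 ^ 3 * σ) := by gcongr
      _ = 2 / 10 ^ 3 * (σ * η) := by ring
      _ ≤ 2 / 10 ^ 3 * (1 / 1000 * q) := by gcongr
      _ = _ := by ring
  have hγη : γ ^ 2 * η ≤ 1 / 10 ^ 9 * q := by
    calc γ ^ 2 * η ≤ σ / 10 ^ 6 * η := by gcongr
      _ = 1 / 10 ^ 6 * (σ * η) := by ring
      _ ≤ 1 / 10 ^ 6 * (1 / 1000 * q) := by gcongr
      _ = _ := by ring
  have hbu : 2 * a * (1 / 4000000 * u) = 5 / 10 ^ 7 * q := by rw [← hau]; ring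
  have hkγβ : k * γ ^ 2 ≤ β := by
    have h0 : 0 ≤ k * γ ^ 2 := by have := g.hk; positivity
    have : k * γ ^ 2 ≤ k * κ * γ ^ 2 := by nlinarith
    linarith
  have huq : u * q ≤ u * σ := by gcongr; linarith
  have hup : u * p ≤ u * σ := by gcongr
  have hσu : 0 < σ * u := by positivity
  constructor
  case π_idem => exact g.π_idem
  case π_symm => exact g.π_symm
  case F_symm => exact g.F_symm
  case F_comm => exact g.F_comm
  case F_norm => exact g.F_norm
  case F_pos => exact g.F_pos
  case F_neg => exact g.F_neg
  case Δ_symm => exact g.Δ_symm t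
  case Δ_norm => exact g.hΔ t γ hγ hkγβ hI.Z_norm hI.i2 hI.i8
  case hM => intro v; rfl
  case hZp => intro x; exact g.hZp t x
  case hZtp => intro x; exact g.hZtp t x
  case Z_norm => exact hI.Z_norm
  case Zt_norm => intro x; rw [g.hZt]; exact hI.Z_norm x
  case hb0 => positivity
  case hb2 => rw [mul_pow, ha2]; norm_num
  case hβ => exact hβ
  case hσ => exact hσ
  case hσβ => exact hσβ
  case hμ => exact hμ
  case hμβ => linarith
  case hη => exact hη0
  case hη1 => linarith
  case hη2 =>
    have h1 : β * η * η ≤ 1 / 1000 * p * (1 / 1000) := by gcongr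
    have h2 : β * η ^ 2 = β * η * η := by ring
    rw [h2]; linarith
  case hζ => positivity
  case hθ => positivity
  case hρ => positivity
  case hρβ =>
    have : β / κ ^ 4 ≤ β := div_le_self hβ.le (one_le_pow₀ hκ)
    linarith
  case hD => positivity
  case hDβ => linarith
  case hγ => exact hγ
  case hs => exact hs
  case hγs => exact hγs
  case hE1 =>
    rw [hbu]
    have : μ * β ^ 2 * η ≤ 1 / 10 ^ 13 * q * 1 := by gcongr; linarith
    linarith
  case hE2 => linarith
  case hE3 => rw [hbu]; linarith
  case cB =>
    rw [hbu]
    have : (η + 10 * (μ * β)) * (401 / 10 ^ 5 * p) ≤ (1 / 100) * (401 / 10 ^ 5 * p) := by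
      gcongr; linarith
    linarith
  case cF =>
    have h1 : 1 / 4000000 * u * (401 / 10 ^ 5 * p) = 401 / (4000000 * 10 ^ 5) * (u * p) := by ring
    rw [h1]
    have h2 : 1 / 4000000 * u * σ / 160 = 1 / (4000000 * 160) * (σ * u) := by ring
    rw [h2]
    linarith
  case cC => linarith
  case cG =>
    have h1 : 1 / 10 ^ 9 * (β / κ ^ 4) * (2 * a) = 2 / 10 ^ 9 * (σ * u) := by
      rw [← hρb]; ring
    have h2 : 3 * (1 / 4000000 * u) * (6 * (52 / 10 ^ 8 * q) + η * (2 * a) * γ) ≤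
        3 * (1 / 4000000 * u) * (6 * (52 / 10 ^ 8 * q) + 2 / 10 ^ 6 * q) := by gcongr
    have h3 : 3 * (1 / 4000000 * u) * (6 * (52 / 10 ^ 8 * q) + 2 / 10 ^ 6 * q) =
        3 / 4000000 * (6 * (52 / 10 ^ 8) + 2 / 10 ^ 6) * (u * q) := by ring
    have h4 : 2 * (1 / 4000000 * u) * (32 / 10 ^ 6 * q) = 64 / 4000000 / 10 ^ 6 * (u * q) := by ring
    rw [h1, h4]
    linarith
  case i2 => exact hI.i2
  case i3 => exact hI.i3
  case i4 => exact hI.i4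
  case i5 => exact hI.i5
  case i6 => exact hI.i6
  case i7 =>
    intro x
    exact (hI.i7 x).trans (by gcongr)
  case i8 => exact hI.i8

lemma inv_step (g : Glob π F Δ Z Zt β σ μ κ k)
    (hη1 : 1 / 2000 / κ ^ 2 ≤ η) (hη2 : η ≤ 1 / 1000 / κ ^ 2) (hγ : 0 ≤ γ) (hs : 0 < s)
    (hγs : γ ≤ 3 * s) (hkγ : k * κ * γ ^ 2 ≤ σ / 10 ^ 6)
    (hr : r0 ≤ 1 / 10 ^ 9 * (β / κ ^ 4)) (hsσ : s ^ 2 ≤ σ / 8)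
    (hI : Inv π (Z t) (Zt t) (2 * √β) (1 / 4000000 * (√β / κ ^ 3)) η
      (1 / 4000000 * (√β / κ ^ 3)) γ s r0) :
    Inv π (Z (t + 1)) (Zt (t + 1)) (2 * √β) (1 / 4000000 * (√β / κ ^ 3)) η
      (1 / 4000000 * (√β / κ ^ 3)) ((1 + μ * σ / 160) * γ) ((1 + μ * σ / 8) * s)
      (r0 + 400 * μ ^ 2 * β ^ 3) := by
  have h := stepHyp_of g hη1 hη2 hγ hs hγs hkγ hr hI
  refine ⟨h.Zp_norm, fun x hx => (h.noise hx).1, fun x hx => (h.noise hx).2,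
    fun y hy => h.angle hy, fun y hy => h.bal_sig hy, fun y hy => h.growth hsσ hy,
    h.bal_norm r0 hI.i7, fun w => ?_⟩
  obtain ⟨y, -, hy⟩ := h.surj w
  exact ⟨y, hy⟩

lemma pow10 {a : ℝ} (h0 : 0 ≤ a) (h1 : a ≤ 1) : (1 + a / 160) ^ 10 ≤ 1 + a / 8 := by
  have h2 : (1 + a / 160) ^ 2 ≤ 1 + a / 79 := by nlinarith
  have h3 : (1 + a / 79) ^ 2 ≤ 1 + a / 39 := by nlinarith
  have h4 : (1 + a / 39) ^ 2 ≤ 1 + a / 19 := by nlinarith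
  calc (1 + a / 160) ^ 10 = (((1 + a / 160) ^ 2) ^ 2) ^ 2 * (1 + a / 160) ^ 2 := by ring
    _ ≤ ((1 + a / 79) ^ 2) ^ 2 * (1 + a / 79) := by gcongr
    _ ≤ (1 + a / 39) ^ 2 * (1 + a / 79) := by gcongr
    _ ≤ (1 + a / 19) * (1 + a / 79) := by gcongr
    _ ≤ _ := by nlinarith

/-- bound on the noise as long as the signal is small -/
lemma gamma_bound {γ0 s0 σ a c : ℝ} {n : ℕ} (hγ0 : 0 ≤ γ0) (hs0 : 0 < s0) (hσ : 0 < σ)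
    (h0 : 0 ≤ a) (h1 : a ≤ 1 / 100) (hγs : γ0 ≤ 3 * s0) (hc : γ0 ≤ √σ / 10 ^ 4)
    (hn : (1 + a / 8) ^ n * s0 ≤ (1 + a / 8) * √(σ / 8)) :
    ((1 + a / 160) ^ n * γ0) ^ 10 ≤ σ / 128 * γ0 ^ 8 := by
  have hp := pow10 h0 (by linarith)
  have hq : √(σ / 8) ≤ √σ := Real.sqrt_le_sqrt (by linarith)
  have hq2 : √σ * √σ = σ := Real.mul_self_sqrt hσ.le
  have hsq := Real.sqrt_nonneg σ
  calc ((1 + a / 160) ^ n * γ0) ^ 10 = ((1 + a / 160) ^ 10) ^ n * γ0 * γ0 * γ0 ^ 8 := by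
        rw [mul_pow, ← pow_mul, ← pow_mul, mul_comm n 10]; ring
    _ ≤ (1 + a / 8) ^ n * (3 * s0) * (√σ / 10 ^ 4) * γ0 ^ 8 := by gcongr
    _ = 3 * ((1 + a / 8) ^ n * s0) * (√σ / 10 ^ 4) * γ0 ^ 8 := by ring
    _ ≤ 3 * ((1 + a / 8) * √(σ / 8)) * (√σ / 10 ^ 4) * γ0 ^ 8 := by gcongr
    _ ≤ 3 * (2 * √σ) * (√σ / 10 ^ 4) * γ0 ^ 8 := by gcongr; linarith
    _ = 6 / 10 ^ 4 * (√σ * √σ) * γ0 ^ 8 := by ring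
    _ ≤ _ := by rw [hq2]; gcongr; linarith

lemma gamma_bound2 {γ γ0 σ κ k : ℝ} (hγ : 0 ≤ γ) (hγ0 : 0 ≤ γ0) (hσ : 0 < σ) (hκ : 1 ≤ κ)
    (hk : 1 ≤ k) (h : γ ^ 10 ≤ σ / 128 * γ0 ^ 8)
    (h8 : k ^ 8 * κ ^ 35 * γ0 ^ 8 ≤ σ ^ 4 / 10 ^ 32) : k * κ * γ ^ 2 ≤ σ / 10 ^ 6 := by
  refine le_of_pow_le_pow_left₀ (n := 5) (by norm_num) (by positivity) ?_
  calc (k * κ * γ ^ 2) ^ 5 = k ^ 5 * κ ^ 5 * γ ^ 10 := by ring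
    _ ≤ k ^ 5 * κ ^ 5 * (σ / 128 * γ0 ^ 8) := by gcongr
    _ ≤ k ^ 8 * κ ^ 35 * (σ / 128 * γ0 ^ 8) := by
      have := pow_le_pow_right₀ hk (show 5 ≤ 8 by norm_num)
      have := pow_le_pow_right₀ hκ (show 5 ≤ 35 by norm_num)
      gcongr
    _ = σ / 128 * (k ^ 8 * κ ^ 35 * γ0 ^ 8) := by ring
    _ ≤ σ / 128 * (σ ^ 4 / 10 ^ 32) := by gcongr
    _ ≤ _ := by
      have : 0 ≤ σ ^ 5 := by positivity
      have e1 : σ / 128 * (σ ^ 4 / 10 ^ 32) = 1 / (128 * 10 ^ 32) * σ ^ 5 := by ring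
      have e2 : (σ / 10 ^ 6) ^ 5 = 1 / 10 ^ 30 * σ ^ 5 := by ring
      rw [e1, e2]; gcongr; norm_num

/-- abstract second phase -/
lemma phase2_abs (g : Glob π F Δ Z Zt β σ μ κ k) (t₁ N : ℕ) (γ0 s0 : ℝ)
    (hη1 : 1 / 2000 / κ ^ 2 ≤ η) (hη2 : η ≤ 1 / 1000 / κ ^ 2) (hγ0 : 0 ≤ γ0) (hs0 : 0 < s0)
    (hγs : γ0 ≤ 3 * s0) (h8 : k ^ 8 * κ ^ 35 * γ0 ^ 8 ≤ σ ^ 4 / 10 ^ 32)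
    (hγσ : γ0 ≤ √σ / 10 ^ 4) (hs0σ : s0 ≤ √(σ / 8))
    (hr : r0 + 400 * μ ^ 2 * N * β ^ 3 ≤ 1 / 10 ^ 9 * (β / κ ^ 4))
    (hN : √(σ / 8) ≤ (1 + μ * σ / 8) ^ N * s0)
    (hI : Inv π (Z t₁) (Zt t₁) (2 * √β) (1 / 4000000 * (√β / κ ^ 3)) η
      (1 / 4000000 * (√β / κ ^ 3)) γ0 s0 r0) :
    ∃ n γ, n ≤ N ∧ γ0 ≤ γ ∧ γ ^ 10 ≤ σ / 128 * γ0 ^ 8 ∧ ∃ s, √(σ / 8) ≤ s ∧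
      Inv π (Z (t₁ + n)) (Zt (t₁ + n)) (2 * √β) (1 / 4000000 * (√β / κ ^ 3)) η
      (1 / 4000000 * (√β / κ ^ 3)) γ s (r0 + 400 * μ ^ 2 * n * β ^ 3) := by
  classical
  have hσ := g.hσ
  have hκ := g.hκ
  have hμ := g.hμ
  have hβ : 0 < β := by rw [g.hβ]; positivity
  have ha0 : 0 ≤ μ * σ := by positivity
  have ha1 : μ * σ ≤ 1 / 100 := by
    have h1 : 1 ≤ κ ^ 4 := one_le_pow₀ hκ
    have h2 : 0 < μ * β := by positivity
    have h3 : μ * β ≤ 1 / 10 ^ 13 := by nlinarith [g.hμβ]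
    have h4 : σ ≤ β := by rw [g.hβ]; nlinarith
    have : μ * σ ≤ μ * β := by gcongr
    linarith
  have hex : ∃ n, √(σ / 8) ≤ (1 + μ * σ / 8) ^ n * s0 := ⟨N, hN⟩
  set n := Nat.find hex with hn
  have hnN : n ≤ N := Nat.find_min' hex hN
  have hlt : ∀ j < n, (1 + μ * σ / 8) ^ j * s0 < √(σ / 8) := fun j hj =>
    not_le.1 (Nat.find_min hex hj)
  have hle : ∀ j ≤ n, (1 + μ * σ / 8) ^ j * s0 ≤ (1 + μ * σ / 8) * √(σ / 8) := by
    intro j hj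
    have hsq := Real.sqrt_nonneg (σ / 8)
    rcases j with _ | j
    · rw [pow_zero, one_mul]; nlinarith
    · have := (hlt j (by omega)).le
      calc _ = (1 + μ * σ / 8) * ((1 + μ * σ / 8) ^ j * s0) := by ring
        _ ≤ _ := by gcongr
  have hγb : ∀ j ≤ n, ((1 + μ * σ / 160) ^ j * γ0) ^ 10 ≤ σ / 128 * γ0 ^ 8 := fun j hj =>
    gamma_bound (c := 0) hγ0 hs0 hσ ha0 ha1 hγs hγσ (hle j hj)
  have main : ∀ j ≤ n, Inv π (Z (t₁ + j)) (Zt (t₁ + j)) (2 * √β) (1 / 4000000 * (√β / κ ^ 3)) η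
      (1 / 4000000 * (√β / κ ^ 3)) ((1 + μ * σ / 160) ^ j * γ0) ((1 + μ * σ / 8) ^ j * s0)
      (r0 + 400 * μ ^ 2 * j * β ^ 3) := by
    intro j
    induction j with
    | zero => intro _; simpa using hI
    | succ j ih =>
      intro hj
      have hI' := ih (by omega)
      have hst := inv_step g hη1 hη2 (by positivity) (by positivity) ?_
        (gamma_bound2 (by positivity) hγ0 hσ hκ g.hk (hγb j (by omega)) h8) ?_ ?_ hI'
      · have e1 : (1 + μ * σ / 160) * ((1 + μ * σ / 160) ^ j * γ0) =
          (1 + μ * σ / 160) ^ (j + 1) * γ0 := by ring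
        have e2 : (1 + μ * σ / 8) * ((1 + μ * σ / 8) ^ j * s0) =
          (1 + μ * σ / 8) ^ (j + 1) * s0 := by ring
        have e3 : r0 + 400 * μ ^ 2 * j * β ^ 3 + 400 * μ ^ 2 * β ^ 3 =
          r0 + 400 * μ ^ 2 * ((j + 1 : ℕ) : ℝ) * β ^ 3 := by push_cast; ring
        rw [e1, e2, e3] at hst
        exact hst
      · calc (1 + μ * σ / 160) ^ j * γ0 ≤ (1 + μ * σ / 8) ^ j * (3 * s0) := by
              gcongr
              · norm_num
          _ = _ := by ring
      · refine le_trans ?_ hr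
        have : (j : ℝ) ≤ N := by exact_mod_cast (by omega : j ≤ N)
        gcongr
      · have := (hlt j (by omega)).le
        calc _ ≤ √(σ / 8) ^ 2 := by gcongr
          _ = _ := Real.sq_sqrt (by positivity)
  refine ⟨n, _, hnN, ?_, hγb n le_rfl, _, Nat.find_spec hex, main n le_rfl⟩
  have : 1 ≤ (1 + μ * σ / 160) ^ n := one_le_pow₀ (by linarith)
  nlinarith

end Abstract

section MatrixLayer
open ContinuousLinearMap
variable {ι ι₁ ι₂ ι₃ : Type*} [Fintype ι] [Fintype ι₁] [Fintype ι₂] [Fintype ι₃]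
  [DecidableEq ι] [DecidableEq ι₁] [DecidableEq ι₂] [DecidableEq ι₃]

/-- a real matrix as a continuous linear map of Euclidean spaces -/
def toC (A : Matrix ι₁ ι₂ ℝ) : EuclideanSpace ℝ ι₂ →L[ℝ] EuclideanSpace ℝ ι₁ :=
  LinearMap.toContinuousLinearMap (Matrix.toEuclideanLin A)

lemma toC_apply (A : Matrix ι₁ ι₂ ℝ) (x : EuclideanSpace ℝ ι₂) :
    toC A x = WithLp.toLp 2 (A *ᵥ x.ofLp) := rfl

lemma toC_mul (A : Matrix ι₁ ι₂ ℝ) (B : Matrix ι₂ ι₃ ℝ) (x : EuclideanSpace ℝ ι₃) :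
    toC (A * B) x = toC A (toC B x) := by
  simp [toC_apply, Matrix.mulVec_mulVec]

lemma toC_add (A B : Matrix ι₁ ι₂ ℝ) (x : EuclideanSpace ℝ ι₂) :
    toC (A + B) x = toC A x + toC B x := by
  simp [toC_apply, Matrix.add_mulVec]

lemma toC_sub (A B : Matrix ι₁ ι₂ ℝ) (x : EuclideanSpace ℝ ι₂) :
    toC (A - B) x = toC A x - toC B x := by
  simp [toC_apply, Matrix.sub_mulVec]

lemma toC_smul (c : ℝ) (A : Matrix ι₁ ι₂ ℝ) (x : EuclideanSpace ℝ ι₂) :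
    toC (c • A) x = c • toC A x := by
  simp [toC_apply, Matrix.smul_mulVec]

lemma toC_neg (A : Matrix ι₁ ι₂ ℝ) (x : EuclideanSpace ℝ ι₂) :
    toC (-A) x = - toC A x := by
  simp [toC_apply, Matrix.neg_mulVec]

lemma toC_one (x : EuclideanSpace ℝ ι₁) : toC (1 : Matrix ι₁ ι₁ ℝ) x = x := by
  simp [toC_apply]

lemma toC_zero (x : EuclideanSpace ℝ ι₂) : toC (0 : Matrix ι₁ ι₂ ℝ) x = 0 := by
  simp [toC_apply]

lemma inner_eq (x y : EuclideanSpace ℝ ι) : inner ℝ x y = x.ofLp ⬝ᵥ y.ofLp := by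
  rw [EuclideanSpace.inner_eq_star_dotProduct, dotProduct_comm]; simp

lemma toC_inner (A : Matrix ι₁ ι₂ ℝ) (x : EuclideanSpace ℝ ι₂) (y : EuclideanSpace ℝ ι₁) :
    inner ℝ (toC A x) y = inner ℝ x (toC Aᵀ y) := by
  simp only [inner_eq, toC_apply]
  rw [Matrix.dotProduct_mulVec, Matrix.vecMul_transpose]

lemma toC_adj (A : Matrix ι₁ ι₂ ℝ) : adjoint (toC A) = toC Aᵀ := by
  symm
  rw [ContinuousLinearMap.eq_adjoint_iff]
  intro x y
  rw [toC_inner, Matrix.transpose_transpose]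

lemma euclNorm_eq (v : ι → ℝ) : euclNorm v = ‖(WithLp.toLp 2 v : EuclideanSpace ℝ ι)‖ := by
  rw [EuclideanSpace.norm_eq, euclNorm]; simp

lemma specNorm_bdd (A : Matrix ι₁ ι₂ ℝ) :
    BddAbove {c : ℝ | ∃ x : ι₂ → ℝ, euclNorm x ≤ 1 ∧ c = euclNorm (A.mulVec x)} := by
  refine ⟨‖toC A‖, ?_⟩
  rintro _ ⟨x, hx, rfl⟩
  rw [euclNorm_eq] at hx ⊢
  have := (toC A).le_opNorm (WithLp.toLp 2 x)
  rw [toC_apply] at this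
  refine this.trans ?_
  exact mul_le_of_le_one_right (norm_nonneg _) hx

lemma specNorm_nonneg (A : Matrix ι₁ ι₂ ℝ) : 0 ≤ specNorm A := by
  apply Real.sSup_nonneg
  rintro _ ⟨x, -, rfl⟩
  exact Real.sqrt_nonneg _

lemma le_specNorm (A : Matrix ι₁ ι₂ ℝ) (x : EuclideanSpace ℝ ι₂) :
    ‖toC A x‖ ≤ specNorm A * ‖x‖ := by
  rcases eq_or_ne x 0 with rfl | hx
  · simp
  · have hpos : 0 < ‖x‖ := norm_pos_iff.2 hx
    have h1 : ‖toC A (‖x‖⁻¹ • x)‖ ≤ specNorm A := by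
      apply le_csSup (specNorm_bdd A)
      refine ⟨(‖x‖⁻¹ • x).ofLp, ?_, ?_⟩
      · rw [euclNorm_eq]
        simp only [WithLp.toLp_ofLp]
        rw [norm_smul, norm_inv, norm_norm, inv_mul_cancel₀ hpos.ne']
      · rw [euclNorm_eq]; rfl
    rw [map_smul, norm_smul, norm_inv, norm_norm, inv_mul_le_iff₀ hpos] at h1
    linarith

lemma specNorm_le {A : Matrix ι₁ ι₂ ℝ} {c : ℝ} (hc : 0 ≤ c) (h : ∀ x, ‖toC A x‖ ≤ c * ‖x‖) :
    specNorm A ≤ c := by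
  apply Real.sSup_le _ hc
  rintro _ ⟨x, hx, rfl⟩
  rw [euclNorm_eq] at hx ⊢
  exact (h (WithLp.toLp 2 x)).trans (mul_le_of_le_one_right hc hx)

lemma norm_toC_of_orth {P : Matrix ι₁ ι₂ ℝ} (hP : Pᵀ * P = 1) (x : EuclideanSpace ℝ ι₂) :
    ‖toC P x‖ = ‖x‖ := by
  have h : ‖toC P x‖ ^ 2 = ‖x‖ ^ 2 := by
    rw [← real_inner_self_eq_norm_sq, toC_inner, ← toC_mul, hP, toC_one,
      real_inner_self_eq_norm_sq]
  exact (sq_eq_sq₀ (norm_nonneg _) (norm_nonneg _)).1 h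

lemma card_le_of_orth {P : Matrix ι₁ ι₂ ℝ} (hP : Pᵀ * P = 1) :
    Fintype.card ι₂ ≤ Fintype.card ι₁ := by
  have h1 : (Pᵀ * P).rank ≤ P.rank := Matrix.rank_mul_le_right _ _
  rw [hP, Matrix.rank_one] at h1
  exact h1.trans (Matrix.rank_le_card_height P)

/-- an orthonormal family together with an orthonormal family of its complement is complete -/
lemma complete_of_orth {P : Matrix ι ι₁ ℝ} {Q : Matrix ι ι₂ ℝ} (hP : Pᵀ * P = 1)
    (hQ : Qᵀ * Q = 1) (hPQ : Pᵀ * Q = 0)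
    (hc : Fintype.card ι₁ + Fintype.card ι₂ = Fintype.card ι) : P * Pᵀ + Q * Qᵀ = 1 := by
  have hQP : Qᵀ * P = 0 := by
    have := congrArg Matrix.transpose hPQ
    simpa using this
  have h1 : (Matrix.fromCols P Q)ᵀ * Matrix.fromCols P Q = 1 := by
    rw [Matrix.transpose_fromCols, Matrix.fromRows_mul_fromCols, hP, hQ, hPQ, hQP,
      Matrix.fromBlocks_one]
  have h2 : Matrix.fromCols P Q * (Matrix.fromCols P Q)ᵀ = 1 :=
    (Matrix.mul_eq_one_comm_of_card_eq _ _ _ (by simpa using hc)).1 h1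
  rwa [Matrix.transpose_fromCols, Matrix.fromCols_mul_fromRows] at h2

lemma norm_toC_compl {P : Matrix ι ι₁ ℝ} {Q : Matrix ι ι₂ ℝ}
    (hQ : Qᵀ * Q = 1) (hPQ : P * Pᵀ + Q * Qᵀ = 1) (x : EuclideanSpace ℝ ι) :
    ‖toC Qᵀ x‖ = ‖x - toC (P * Pᵀ) x‖ := by
  have : x - toC (P * Pᵀ) x = toC Q (toC Qᵀ x) := by
    have h1 := toC_one x
    rw [← hPQ, toC_add] at h1
    rw [← toC_mul, sub_eq_iff_eq_add, add_comm, h1]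
  rw [this, norm_toC_of_orth hQ]

lemma norm_toC_transpose {P : Matrix ι ι₁ ℝ} (hP : Pᵀ * P = 1) (x : EuclideanSpace ℝ ι) :
    ‖toC Pᵀ x‖ = ‖toC (P * Pᵀ) x‖ := by
  rw [toC_mul, norm_toC_of_orth hP]

lemma sigmaInf_le (A : Matrix ι₁ ι₂ ℝ) (x : EuclideanSpace ℝ ι₂) :
    sInf {c : ℝ | ∃ x : ι₂ → ℝ, euclNorm x = 1 ∧ c = euclNorm (A.mulVec x)} * ‖x‖ ≤ ‖toC A x‖ := by
  rcases eq_or_ne x 0 with rfl | hx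
  · simp
  · have hpos : 0 < ‖x‖ := norm_pos_iff.2 hx
    have h1 : sInf {c : ℝ | ∃ x : ι₂ → ℝ, euclNorm x = 1 ∧ c = euclNorm (A.mulVec x)}
        ≤ ‖toC A (‖x‖⁻¹ • x)‖ := by
      apply csInf_le
      · refine ⟨0, ?_⟩
        rintro _ ⟨x, -, rfl⟩
        exact Real.sqrt_nonneg _
      refine ⟨(‖x‖⁻¹ • x).ofLp, ?_, ?_⟩
      · rw [euclNorm_eq]
        simp only [WithLp.toLp_ofLp]
        rw [norm_smul, norm_inv, norm_norm, inv_mul_cancel₀ hpos.ne']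
      · rw [euclNorm_eq]; rfl
    rw [map_smul, norm_smul, norm_inv, norm_norm, le_inv_mul_iff₀ hpos] at h1
    linarith

lemma sigmaInf_ge [Nonempty ι₂] {A : Matrix ι₁ ι₂ ℝ} {c : ℝ} (h : ∀ x, c * ‖x‖ ≤ ‖toC A x‖) :
    c ≤ sInf {c : ℝ | ∃ x : ι₂ → ℝ, euclNorm x = 1 ∧ c = euclNorm (A.mulVec x)} := by
  apply le_csInf
  · obtain ⟨i⟩ := ‹Nonempty ι₂›
    refine ⟨_, Pi.single i 1, ?_, rfl⟩
    simp [euclNorm, Pi.single_apply]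
  · rintro _ ⟨x, hx, rfl⟩
    rw [euclNorm_eq] at hx ⊢
    have := h (WithLp.toLp 2 x)
    rw [hx, mul_one] at this
    exact this

/-- if there are more columns than rows, the column infimum vanishes -/
lemma sigmaInf_eq_zero (A : Matrix ι₁ ι₂ ℝ) (h : Fintype.card ι₁ < Fintype.card ι₂) :
    sInf {c : ℝ | ∃ x : ι₂ → ℝ, euclNorm x = 1 ∧ c = euclNorm (A.mulVec x)} ≤ 0 := by
  have : ∃ x : EuclideanSpace ℝ ι₂, x ≠ 0 ∧ toC A x = 0 := by
    have hk := LinearMap.ker_ne_bot_of_finrank_lt (f := (toC A : EuclideanSpace ℝ ι₂ →ₗ[ℝ] EuclideanSpace ℝ ι₁))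
      (by simpa using h)
    obtain ⟨x, hx, hx0⟩ := (Submodule.ne_bot_iff _).1 hk
    exact ⟨x, hx0, hx⟩
  obtain ⟨x, hx, h0⟩ := this
  have h1 := sigmaInf_le A x
  rw [h0, norm_zero] at h1
  have hpos : 0 < ‖x‖ := norm_pos_iff.2 hx
  by_contra hlt
  push Not at hlt
  nlinarith

lemma sigmaMin_eq (A : Matrix ι₁ ι₂ ℝ) : sigmaMin A = sigmaMin Aᵀ := by
  unfold sigmaMin
  rw [Matrix.transpose_transpose, max_comm]

lemma sigmaMin_nonneg (A : Matrix ι₁ ι₂ ℝ) : 0 ≤ sigmaMin A := by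
  apply le_max_of_le_left
  apply Real.sInf_nonneg
  rintro _ ⟨x, -, rfl⟩
  exact Real.sqrt_nonneg _

end MatrixLayer

section Rip
open ContinuousLinearMap
variable {n₁ n₂ m k r : ℕ}

lemma minner_add_left (M M' N : Matrix (Fin n₁) (Fin n₂) ℝ) :
    minner (M + M') N = minner M N + minner M' N := by
  simp [minner, add_mul, Finset.sum_add_distrib]

lemma minner_smul_left (c : ℝ) (M N : Matrix (Fin n₁) (Fin n₂) ℝ) :
    minner (c • M) N = c * minner M N := by
  simp [minner, Finset.mul_sum, mul_assoc]

lemma minner_comm (M N : Matrix (Fin n₁) (Fin n₂) ℝ) : minner M N = minner N M := by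
  simp [minner, mul_comm]

lemma minner_add_right (M N N' : Matrix (Fin n₁) (Fin n₂) ℝ) :
    minner M (N + N') = minner M N + minner M N' := by
  rw [minner_comm, minner_add_left, minner_comm N, minner_comm N']

lemma minner_smul_right (c : ℝ) (M N : Matrix (Fin n₁) (Fin n₂) ℝ) :
    minner M (c • N) = c * minner M N := by
  rw [minner_comm, minner_smul_left, minner_comm N]

lemma frobNorm_sq (M : Matrix (Fin n₁) (Fin n₂) ℝ) : frobNorm M ^ 2 = minner M M := by
  rw [frobNorm, Real.sq_sqrt (by positivity)]
  simp [minner, sq]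

lemma frobNorm_nonneg (M : Matrix (Fin n₁) (Fin n₂) ℝ) : 0 ≤ frobNorm M := Real.sqrt_nonneg _

/-- the defect of isometry, as a bilinear form -/
def defect (A : Fin m → Matrix (Fin n₁) (Fin n₂) ℝ) (M N : Matrix (Fin n₁) (Fin n₂) ℝ) : ℝ :=
  minner M N - ∑ i, minner (A i) M * minner (A i) N

lemma defect_add_left (A : Fin m → Matrix (Fin n₁) (Fin n₂) ℝ)
    (M M' N : Matrix (Fin n₁) (Fin n₂) ℝ) :
    defect A (M + M') N = defect A M N + defect A M' N := by
  simp only [defect, minner_add_left, minner_add_right, add_mul, Finset.sum_add_distrib]; ring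

lemma defect_zero_left (A : Fin m → Matrix (Fin n₁) (Fin n₂) ℝ)
    (N : Matrix (Fin n₁) (Fin n₂) ℝ) : defect A 0 N = 0 := by
  simp [defect, minner]

lemma defect_sum_left {ι : Type*} (s : Finset ι) (A : Fin m → Matrix (Fin n₁) (Fin n₂) ℝ)
    (M : ι → Matrix (Fin n₁) (Fin n₂) ℝ) (N : Matrix (Fin n₁) (Fin n₂) ℝ) :
    defect A (∑ j ∈ s, M j) N = ∑ j ∈ s, defect A (M j) N := by
  classical
  induction s using Finset.induction_on with
  | empty => simp [defect_zero_left]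
  | insert a s ha ih => rw [Finset.sum_insert ha, Finset.sum_insert ha, defect_add_left, ih]

lemma defect_self_le {A : Fin m → Matrix (Fin n₁) (Fin n₂) ℝ} {s : ℕ} {δ : ℝ}
    (h : HasRIP A s δ) {M : Matrix (Fin n₁) (Fin n₂) ℝ} (hM : M.rank ≤ s) :
    |defect A M M| ≤ δ * minner M M := by
  obtain ⟨h1, h2⟩ := h M hM
  rw [frobNorm_sq] at h1 h2
  have e : defect A M M = minner M M - ∑ i, calA A M i ^ 2 := by
    simp [defect, calA, sq]
  rw [e, abs_le]
  constructor <;> linarith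

lemma defect_quad (A : Fin m → Matrix (Fin n₁) (Fin n₂) ℝ) (a : ℝ)
    (Y E : Matrix (Fin n₁) (Fin n₂) ℝ) :
    defect A (Y + a • E) (Y + a • E) = defect A Y Y + 2 * a * defect A Y E
      + a ^ 2 * defect A E E := by
  simp only [defect, minner_add_left, minner_add_right, minner_smul_left, minner_smul_right]
  rw [minner_comm E Y]
  have : ∑ i, (minner (A i) Y + a * minner (A i) E) * (minner (A i) Y + a * minner (A i) E) =
    ∑ i, minner (A i) Y * minner (A i) Y + 2 * a * ∑ i, minner (A i) Y * minner (A i) E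
     + a ^ 2 * ∑ i, minner (A i) E * minner (A i) E := by
    rw [Finset.mul_sum, Finset.mul_sum, ← Finset.sum_add_distrib, ← Finset.sum_add_distrib]
    exact Finset.sum_congr rfl fun i _ => by ring
  rw [this]; ring

lemma minner_quad (a : ℝ) (Y E : Matrix (Fin n₁) (Fin n₂) ℝ) :
    minner (Y + a • E) (Y + a • E) = minner Y Y + 2 * a * minner Y E + a ^ 2 * minner E E := by
  simp only [minner_add_left, minner_add_right, minner_smul_left, minner_smul_right]
  rw [minner_comm E Y]; ring

lemma frob_eq_zero {M : Matrix (Fin n₁) (Fin n₂) ℝ} (h : frobNorm M = 0) : M = 0 := by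
  have h1 := frobNorm_sq M
  rw [h] at h1
  ext i j
  have h2 : ∑ i, ∑ j, M i j * M i j = 0 := by
    rw [← minner, ← h1]; norm_num
  have h3 := (Finset.sum_eq_zero_iff_of_nonneg
    (fun i _ => Finset.sum_nonneg fun j _ => mul_self_nonneg (M i j))).1 h2 i (Finset.mem_univ _)
  have h4 := (Finset.sum_eq_zero_iff_of_nonneg
    (fun j _ => mul_self_nonneg (M i j))).1 h3 j (Finset.mem_univ _)
  simpa using h4

lemma mrank_add_le (M N : Matrix (Fin n₁) (Fin n₂) ℝ) : (M + N).rank ≤ M.rank + N.rank := by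
  unfold Matrix.rank
  rw [Matrix.mulVecLin_add]
  refine le_trans (Submodule.finrank_mono ?_) (Submodule.finrank_add_le_finrank_add_finrank _ _)
  rintro _ ⟨x, rfl⟩
  exact Submodule.add_mem_sup ⟨x, rfl⟩ ⟨x, rfl⟩

lemma defect_le {A : Fin m → Matrix (Fin n₁) (Fin n₂) ℝ} {s : ℕ} {δ : ℝ}
    (h : HasRIP A (s + 1) δ) {Y E : Matrix (Fin n₁) (Fin n₂) ℝ} (hY : Y.rank ≤ s)
    (hE : E.rank ≤ 1) : |defect A Y E| ≤ δ * (frobNorm Y * frobNorm E) := by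
  have hrank : ∀ a : ℝ, (Y + a • E).rank ≤ s + 1 := by
    intro a
    refine (mrank_add_le _ _).trans (add_le_add hY ?_)
    have : a • E = E * (a • (1 : Matrix (Fin n₂) (Fin n₂) ℝ)) := by simp
    rw [this]
    exact (Matrix.rank_mul_le_left _ _).trans hE
  have key : ∀ a : ℝ, |4 * a * defect A Y E| ≤ 2 * δ * (minner Y Y + a ^ 2 * minner E E) := by
    intro a
    have h1 := defect_self_le h (hrank a)
    have h2 := defect_self_le h (hrank (-a))
    rw [defect_quad, minner_quad] at h1 h2
    rw [abs_le] at h1 h2 ⊢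
    constructor <;> nlinarith
  rcases eq_or_ne (frobNorm Y) 0 with h0 | h0
  · rw [frob_eq_zero h0, defect_zero_left]; simp [frobNorm]
  rcases eq_or_ne (frobNorm E) 0 with h0' | h0'
  · rw [frob_eq_zero h0']; simp [frobNorm, defect, minner]
  have hYp : 0 < frobNorm Y := lt_of_le_of_ne (frobNorm_nonneg _) h0.symm
  have hEp : 0 < frobNorm E := lt_of_le_of_ne (frobNorm_nonneg _) h0'.symm
  have h1 := key (frobNorm Y / frobNorm E)
  rw [← frobNorm_sq, ← frobNorm_sq, abs_mul, abs_of_pos (by positivity)] at h1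
  have e1 : 2 * δ * (frobNorm Y ^ 2 + (frobNorm Y / frobNorm E) ^ 2 * frobNorm E ^ 2)
      = 4 * (frobNorm Y / frobNorm E) * (δ * (frobNorm Y * frobNorm E)) := by
    field_simp; ring
  rw [e1] at h1
  exact le_of_mul_le_mul_left h1 (by positivity)

lemma frob_vecMulVec (x : EuclideanSpace ℝ (Fin n₁)) (y : EuclideanSpace ℝ (Fin n₂)) :
    frobNorm (Matrix.vecMulVec x.ofLp y.ofLp) = ‖x‖ * ‖y‖ := by
  rw [EuclideanSpace.norm_eq, EuclideanSpace.norm_eq, ← Real.sqrt_mul (by positivity), frobNorm,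
    Finset.sum_mul]
  congr 1
  refine Finset.sum_congr rfl fun i _ => ?_
  rw [Finset.mul_sum]
  refine Finset.sum_congr rfl fun j _ => ?_
  simp [Matrix.vecMulVec_apply, mul_pow]

lemma minner_vecMulVec (M : Matrix (Fin n₁) (Fin n₂) ℝ) (x : EuclideanSpace ℝ (Fin n₁))
    (y : EuclideanSpace ℝ (Fin n₂)) :
    minner M (Matrix.vecMulVec x.ofLp y.ofLp) = inner ℝ x (toC M y) := by
  rw [inner_eq, toC_apply]
  simp only [minner, dotProduct, Matrix.mulVec, Matrix.vecMulVec_apply, Finset.mul_sum]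
  refine Finset.sum_congr rfl fun i _ => Finset.sum_congr rfl fun j _ => by ring

lemma defect_vecMulVec (A : Fin m → Matrix (Fin n₁) (Fin n₂) ℝ) (Y : Matrix (Fin n₁) (Fin n₂) ℝ)
    (x : EuclideanSpace ℝ (Fin n₁)) (y : EuclideanSpace ℝ (Fin n₂)) :
    inner ℝ x (toC (Y - AstarA A Y) y) = defect A Y (Matrix.vecMulVec x.ofLp y.ofLp) := by
  have h1 : ∀ (s : Finset (Fin m)), minner (∑ i ∈ s, minner (A i) Y • A i)
      (Matrix.vecMulVec x.ofLp y.ofLp)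
      = ∑ i ∈ s, minner (A i) Y * minner (A i) (Matrix.vecMulVec x.ofLp y.ofLp) := by
    intro s
    classical
    induction s using Finset.induction_on with
    | empty => simp [minner]
    | insert a s ha ih =>
      rw [Finset.sum_insert ha, Finset.sum_insert ha, minner_add_left, ih, minner_smul_left]
  rw [toC_sub, inner_sub_right, ← minner_vecMulVec, ← minner_vecMulVec, AstarA, h1]
  rfl

lemma norm_col_sum (B : Matrix (Fin n₁) (Fin r) ℝ) :
    ∑ i, ∑ j, B i j ^ 2 = ∑ j, ‖toC B (EuclideanSpace.single j 1)‖ ^ 2 := by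
  rw [Finset.sum_comm]
  refine Finset.sum_congr rfl fun j _ => ?_
  rw [EuclideanSpace.norm_sq_eq]
  refine Finset.sum_congr rfl fun i _ => ?_
  simp [toC_apply]

lemma frob_mul_le {B : Matrix (Fin n₁) (Fin r) ℝ} {C : Matrix (Fin n₂) (Fin r) ℝ} {b c : ℝ}
    (hb : 0 ≤ b) (hc : 0 ≤ c) (hB : ∀ x, ‖toC B x‖ ≤ b * ‖x‖) (hC : ∀ x, ‖toC C x‖ ≤ c * ‖x‖) :
    frobNorm (B * Cᵀ) ≤ √r * (b * c) := by
  apply Real.sqrt_le_iff.2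
  refine ⟨by positivity, ?_⟩
  rw [norm_col_sum]
  have h1 : ∀ j, ‖toC (B * Cᵀ) (EuclideanSpace.single j 1)‖ ^ 2 ≤
      b ^ 2 * ‖toC Cᵀ (EuclideanSpace.single j 1)‖ ^ 2 := by
    intro j
    rw [toC_mul, ← mul_pow]
    gcongr
    exact hB _
  calc _ ≤ ∑ j, b ^ 2 * ‖toC Cᵀ (EuclideanSpace.single j 1)‖ ^ 2 :=
        Finset.sum_le_sum fun j _ => h1 j
    _ = b ^ 2 * ∑ i, ∑ j, Cᵀ i j ^ 2 := by rw [← Finset.mul_sum, norm_col_sum]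
    _ = b ^ 2 * ∑ j, ‖toC C (EuclideanSpace.single j 1)‖ ^ 2 := by
      rw [← norm_col_sum, Finset.sum_comm]; rfl
    _ ≤ b ^ 2 * ∑ j : Fin r, c ^ 2 := by
      gcongr with j
      have := hC (EuclideanSpace.single j 1)
      simpa using this
    _ = _ := by
      rw [Finset.sum_const, Finset.card_univ, Fintype.card_fin, nsmul_eq_mul, mul_pow,
        Real.sq_sqrt (by positivity)]
      ring

lemma frob_sub_le (M N : Matrix (Fin n₁) (Fin n₂) ℝ) :
    frobNorm (M - N) ≤ frobNorm M + frobNorm N := by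
  letI := Matrix.frobeniusSeminormedAddCommGroup (m := Fin n₁) (n := Fin n₂) (α := ℝ)
  have e : ∀ M : Matrix (Fin n₁) (Fin n₂) ℝ, frobNorm M = ‖M‖ := by
    intro M
    rw [Matrix.frobenius_norm_def, frobNorm, Real.sqrt_eq_rpow]
    simp
  rw [e, e, e]
  exact norm_sub_le _ _

lemma exists_Q {G : Matrix (Fin r) (Fin k) ℝ} (hG : Function.Surjective (toC G)) :
    ∃ Q : Matrix (Fin k) (Fin r) ℝ, Qᵀ * Q = 1 ∧ G * (1 - Q * Qᵀ) = 0 := by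
  set S := LinearMap.ker (toC G : EuclideanSpace ℝ (Fin k) →ₗ[ℝ] EuclideanSpace ℝ (Fin r)) with hS
  have hfr : Module.finrank ℝ Sᗮ = r := by
    have h1 := S.finrank_add_finrank_orthogonal
    have h2 := LinearMap.finrank_range_add_finrank_ker
      (toC G : EuclideanSpace ℝ (Fin k) →ₗ[ℝ] EuclideanSpace ℝ (Fin r))
    rw [LinearMap.range_eq_top.2 hG, finrank_top, finrank_euclideanSpace_fin,
      finrank_euclideanSpace_fin] at h2
    rw [← hS] at h2
    rw [finrank_euclideanSpace_fin] at h1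
    omega
  set bs := (stdOrthonormalBasis ℝ Sᗮ).reindex (finCongr hfr) with hbs
  set Q : Matrix (Fin k) (Fin r) ℝ := Matrix.of fun i j => (bs j : EuclideanSpace ℝ (Fin k)) i
  have hQa : ∀ (w : EuclideanSpace ℝ (Fin k)) j, (toC Qᵀ w) j
      = inner ℝ (bs j : EuclideanSpace ℝ (Fin k)) w := by
    intro w j
    rw [inner_eq, toC_apply]
    simp [Q, Matrix.mulVec, dotProduct]
  have hQQ : Qᵀ * Q = 1 := by
    ext i j
    have h1 := orthonormal_iff_ite.1 bs.orthonormal i j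
    rw [Submodule.coe_inner, inner_eq] at h1
    rw [Matrix.one_apply, ← h1]
    simp [Q, Matrix.mul_apply, dotProduct]
  refine ⟨Q, hQQ, ?_⟩
  have h0 : ∀ x, toC (G * (1 - Q * Qᵀ)) x = 0 := by
    intro x
    rw [toC_mul]
    set w := toC (1 - Q * Qᵀ) x with hw
    have h1 : toC Qᵀ w = 0 := by
      rw [hw, ← toC_mul, Matrix.mul_sub, ← Matrix.mul_assoc, hQQ]; simp [toC_zero]
    have h2 : w ∈ Sᗮᗮ := by
      rw [Submodule.mem_orthogonal]
      intro v hv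
      have h3 := bs.sum_repr ⟨v, hv⟩
      have h4 : v = ∑ j, bs.repr ⟨v, hv⟩ j • (bs j : EuclideanSpace ℝ (Fin k)) := by
        have := congrArg (Subtype.val) h3
        simpa using this.symm
      rw [h4, sum_inner]
      refine Finset.sum_eq_zero fun j _ => ?_
      rw [inner_smul_left, ← hQa, h1]; simp
    rw [Submodule.orthogonal_orthogonal] at h2
    exact h2
  ext i j
  have := congrArg (fun v : EuclideanSpace ℝ (Fin r) => v i) (h0 (EuclideanSpace.single j 1))
  simpa [toC_apply] using this

lemma delta_bound {A : Fin m → Matrix (Fin n₁) (Fin n₂) ℝ} {δ β γ : ℝ} (hr : 1 ≤ r)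
    (hRIP : HasRIP A (2 * r + 1) δ) (hδ : 0 ≤ δ) (hβ : 0 ≤ β)
    {X : Matrix (Fin n₁) (Fin n₂) ℝ} {PX : Matrix (Fin n₁) (Fin r) ℝ} (hPX : PXᵀ * PX = 1)
    {C : Matrix (Fin n₂) (Fin r) ℝ} (hX : X = PX * Cᵀ) (hC : ∀ x, ‖toC C x‖ ≤ β * ‖x‖)
    {V : Matrix (Fin n₁) (Fin k) ℝ} {W : Matrix (Fin n₂) (Fin k) ℝ} {G : Matrix (Fin r) (Fin k) ℝ}
    (hG : Function.Surjective (toC G))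
    (hV : ∀ x, ‖toC V x‖ ^ 2 + ‖toC W x‖ ^ 2 ≤ 8 * β * ‖x‖ ^ 2)
    (hγ : ∀ x, toC G x = 0 → ‖toC V x‖ ^ 2 + ‖toC W x‖ ^ 2 ≤ 2 * γ ^ 2 * ‖x‖ ^ 2)
    (x : EuclideanSpace ℝ (Fin n₁)) (y : EuclideanSpace ℝ (Fin n₂)) :
    |inner ℝ x (toC ((V * Wᵀ - X) - AstarA A (V * Wᵀ - X)) y)|
      ≤ δ * (9 * √r * β + k * γ ^ 2) * (‖x‖ * ‖y‖) := by
  obtain ⟨Q, hQ, hGQ⟩ := exists_Q hG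
  set Pr : Matrix (Fin k) (Fin k) ℝ := 1 - Q * Qᵀ with hPr
  have hPrt : Prᵀ = Pr := by simp [hPr, Matrix.transpose_sub]
  have hPr2 : Pr * Pr = Pr := by
    have : Q * Qᵀ * (Q * Qᵀ) = Q * Qᵀ := by
      rw [Matrix.mul_assoc, ← Matrix.mul_assoc Qᵀ, hQ, Matrix.one_mul]
    simp only [hPr, Matrix.mul_sub, Matrix.sub_mul, this]; simp
  have hPrn : ∀ x, ‖toC Pr x‖ ≤ ‖x‖ := by
    intro x
    have h1 : ‖toC Pr x‖ ^ 2 = inner ℝ x (toC Pr x) := by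
      rw [← real_inner_self_eq_norm_sq, toC_inner, hPrt, ← toC_mul, hPr2]
    have h2 := real_inner_le_norm x (toC Pr x)
    have h3 := norm_nonneg (toC Pr x)
    by_contra hlt
    push Not at hlt
    nlinarith [norm_nonneg x]
  have hb8 : ∀ x, ‖toC V x‖ ≤ √(8 * β) * ‖x‖ := by
    intro x
    apply abs_le_of_sq_le_sq' _ (by positivity) |>.2
    rw [mul_pow, Real.sq_sqrt (by positivity)]
    nlinarith [hV x, sq_nonneg ‖toC W x‖]
  have hb8' : ∀ x, ‖toC W x‖ ≤ √(8 * β) * ‖x‖ := by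
    intro x
    apply abs_le_of_sq_le_sq' _ (by positivity) |>.2
    rw [mul_pow, Real.sq_sqrt (by positivity)]
    nlinarith [hV x, sq_nonneg ‖toC V x‖]
  set E := Matrix.vecMulVec x.ofLp y.ofLp with hE
  have hErank : E.rank ≤ 1 := Matrix.rank_vecMulVec_le _ _
  set Y0 := V * Q * (W * Q)ᵀ - X with hY0
  have hsplit : V * Wᵀ - X = Y0 + ∑ j, Matrix.vecMulVec
      (toC (V * Pr) (EuclideanSpace.single j 1)).ofLp
      (toC (W * Pr) (EuclideanSpace.single j 1)).ofLp := by
    have h1 : ∑ j, Matrix.vecMulVec (toC (V * Pr) (EuclideanSpace.single j 1)).ofLp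
      (toC (W * Pr) (EuclideanSpace.single j 1)).ofLp = (V * Pr) * (W * Pr)ᵀ := by
      ext a b
      rw [Matrix.mul_apply]
      simp only [Matrix.sum_apply, Matrix.vecMulVec_apply, toC_apply]
      simp [-Matrix.transpose_mul]
    rw [h1, hY0, Matrix.transpose_mul, Matrix.transpose_mul, hPrt]
    have h2 : V * Pr * (Pr * Wᵀ) = V * Pr * Wᵀ := by
      rw [← Matrix.mul_assoc, Matrix.mul_assoc V, hPr2]
    rw [h2, hPr, Matrix.mul_sub, Matrix.sub_mul, Matrix.mul_one]
    simp only [Matrix.mul_assoc]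
    abel
  have hrk : Y0.rank ≤ 2 * r := by
    rw [hY0, sub_eq_add_neg, two_mul]
    refine (mrank_add_le _ _).trans (add_le_add ?_ ?_)
    · refine (Matrix.rank_mul_le_right _ _).trans ?_
      simpa using Matrix.rank_le_card_height (W * Q)ᵀ
    · rw [hX, ← Matrix.mul_neg]
      refine (Matrix.rank_mul_le_right _ _).trans ?_
      simpa using Matrix.rank_le_card_height (-Cᵀ)
  have hfr : frobNorm Y0 ≤ 9 * √r * β := by
    have h1 : frobNorm (V * Q * (W * Q)ᵀ) ≤ √r * (√(8 * β) * √(8 * β)) := by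
      apply frob_mul_le (by positivity) (by positivity)
      · intro x; rw [toC_mul]
        exact (hb8 _).trans (by rw [norm_toC_of_orth hQ])
      · intro x; rw [toC_mul]
        exact (hb8' _).trans (by rw [norm_toC_of_orth hQ])
    rw [Real.mul_self_sqrt (by positivity)] at h1
    have h2 : frobNorm X ≤ √r * (1 * β) := by
      rw [hX]
      apply frob_mul_le (by positivity) (by positivity) _ hC
      intro x; rw [norm_toC_of_orth hPX, one_mul]
    have h3 := frob_sub_le (V * Q * (W * Q)ᵀ) X
    linarith
  have hEf : frobNorm E = ‖x‖ * ‖y‖ := frob_vecMulVec x y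
  rw [defect_vecMulVec, hsplit, defect_add_left, defect_sum_left]
  have hA1 : |defect A Y0 E| ≤ δ * (9 * √r * β * (‖x‖ * ‖y‖)) := by
    refine (defect_le hRIP hrk hErank).trans ?_
    rw [hEf]; gcongr
  have hA2 : ∀ j : Fin k, |defect A (Matrix.vecMulVec
      (toC (V * Pr) (EuclideanSpace.single j 1)).ofLp
      (toC (W * Pr) (EuclideanSpace.single j 1)).ofLp) E| ≤ δ * (γ ^ 2 * (‖x‖ * ‖y‖)) := by
    intro j
    refine (defect_le hRIP ((Matrix.rank_vecMulVec_le _ _).trans (by omega)) hErank).trans ?_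
    rw [hEf, frob_vecMulVec]
    set e := toC Pr (EuclideanSpace.single j 1) with he
    have hen : ‖e‖ ≤ 1 := by simpa using hPrn (EuclideanSpace.single j 1)
    have h1 := hγ e (by rw [he, ← toC_mul, hGQ, toC_zero])
    have h2 : ‖toC V e‖ * ‖toC W e‖ ≤ γ ^ 2 := by
      have h3 : 2 * γ ^ 2 * ‖e‖ ^ 2 ≤ 2 * γ ^ 2 * 1 ^ 2 := by gcongr
      nlinarith [sq_nonneg (‖toC V e‖ - ‖toC W e‖)]
    rw [toC_mul, toC_mul, ← he]
    gcongr
  have hA3 := Finset.abs_sum_le_sum_abs (fun j : Fin k => defect A (Matrix.vecMulVec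
      (toC (V * Pr) (EuclideanSpace.single j 1)).ofLp
      (toC (W * Pr) (EuclideanSpace.single j 1)).ofLp) E) Finset.univ
  have hA4 := Finset.sum_le_sum fun (j : Fin k) (_ : j ∈ Finset.univ) => hA2 j
  rw [Finset.sum_const, Finset.card_univ, Fintype.card_fin, nsmul_eq_mul] at hA4
  have hA5 := abs_add_le (defect A Y0 E) (∑ j : Fin k, defect A (Matrix.vecMulVec
      (toC (V * Pr) (EuclideanSpace.single j 1)).ofLp
      (toC (W * Pr) (EuclideanSpace.single j 1)).ofLp) E)
  calc _ ≤ _ := hA5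
    _ ≤ δ * (9 * √r * β * (‖x‖ * ‖y‖)) + k * (δ * (γ ^ 2 * (‖x‖ * ‖y‖))) :=
      add_le_add hA1 (hA3.trans hA4)
    _ = _ := by ring

end Rip

section Concrete
open ContinuousLinearMap
variable {n₁ n₂ m k r : ℕ}

lemma toC_inner' {ι₁ ι₂ : Type*} [Fintype ι₁] [Fintype ι₂] [DecidableEq ι₁] [DecidableEq ι₂]
    (A : Matrix ι₁ ι₂ ℝ) (x : EuclideanSpace ℝ ι₂) (y : EuclideanSpace ℝ ι₁) :
    inner ℝ (toC Aᵀ y) x = inner ℝ y (toC A x) := by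
  rw [toC_inner, Matrix.transpose_transpose]

lemma inv_sqrt_two_sq : (√2)⁻¹ * (√2)⁻¹ = (1 / 2 : ℝ) := by
  rw [← mul_inv, Real.mul_self_sqrt (by norm_num)]; norm_num

lemma zs_mul {p q : ℕ} (V : Matrix (Fin n₁) (Fin p) ℝ) (W : Matrix (Fin n₂) (Fin p) ℝ)
    (B : Matrix (Fin p) (Fin q) ℝ) : Zstack V W * B = Zstack (V * B) (W * B) := by
  rw [Zstack, Zstack, Matrix.smul_mul, Matrix.fromRows_mul]

lemma sym_zs {p : ℕ} (X : Matrix (Fin n₁) (Fin n₂) ℝ) (V : Matrix (Fin n₁) (Fin p) ℝ)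
    (W : Matrix (Fin n₂) (Fin p) ℝ) : symMat X * Zstack V W = Zstack (X * W) (Xᵀ * V) := by
  rw [Zstack, Zstack, symMat, Matrix.mul_smul, Matrix.fromBlocks_mul_fromRows]
  simp

lemma zs_t_zs {p q : ℕ} (V : Matrix (Fin n₁) (Fin p) ℝ) (W : Matrix (Fin n₂) (Fin p) ℝ)
    (V' : Matrix (Fin n₁) (Fin q) ℝ) (W' : Matrix (Fin n₂) (Fin q) ℝ) :
    (Zstack V W)ᵀ * Zstack V' W' = (1 / 2 : ℝ) • (Vᵀ * V' + Wᵀ * W') := by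
  rw [Zstack, Zstack, Matrix.transpose_smul, Matrix.smul_mul, Matrix.mul_smul, smul_smul,
    inv_sqrt_two_sq, Matrix.transpose_fromRows, Matrix.fromCols_mul_fromRows]

lemma zs_zs_t {p : ℕ} (V V' : Matrix (Fin n₁) (Fin p) ℝ) (W W' : Matrix (Fin n₂) (Fin p) ℝ) :
    Zstack V W * (Zstack V' W')ᵀ - Zstack V (-W) * (Zstack V' (-W'))ᵀ
      = Matrix.fromBlocks 0 (V * W'ᵀ) (W * V'ᵀ) 0 := by
  simp only [Zstack, Matrix.transpose_smul, Matrix.smul_mul, Matrix.mul_smul, smul_smul,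
    inv_sqrt_two_sq, Matrix.transpose_fromRows, Matrix.fromRows_mul_fromCols]
  ext (i | i) (j | j) <;> simp <;> ring

lemma zs_norm {p : ℕ} (V : Matrix (Fin n₁) (Fin p) ℝ) (W : Matrix (Fin n₂) (Fin p) ℝ)
    (x : EuclideanSpace ℝ (Fin p)) :
    ‖toC (Zstack V W) x‖ ^ 2 = 1 / 2 * (‖toC V x‖ ^ 2 + ‖toC W x‖ ^ 2) := by
  rw [← real_inner_self_eq_norm_sq, toC_inner, ← toC_mul, zs_t_zs, toC_smul, toC_add,
    inner_smul_right, inner_add_right, toC_mul, toC_mul, ← toC_inner, ← toC_inner,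
    real_inner_self_eq_norm_sq, real_inner_self_eq_norm_sq]

lemma zs_norm_neg {p : ℕ} (V : Matrix (Fin n₁) (Fin p) ℝ) (W : Matrix (Fin n₂) (Fin p) ℝ)
    (x : EuclideanSpace ℝ (Fin p)) :
    ‖toC (Zstack V (-W)) x‖ = ‖toC (Zstack V W) x‖ := by
  have h : ‖toC (Zstack V (-W)) x‖ ^ 2 = ‖toC (Zstack V W) x‖ ^ 2 := by
    rw [zs_norm, zs_norm, toC_neg, norm_neg]
  exact (sq_eq_sq₀ (norm_nonneg _) (norm_nonneg _)).1 h

lemma symMat_t (X : Matrix (Fin n₁) (Fin n₂) ℝ) : (symMat X)ᵀ = symMat X := by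
  simp [symMat, Matrix.fromBlocks_transpose]

lemma symMat_add (X Y : Matrix (Fin n₁) (Fin n₂) ℝ) : symMat (X + Y) = symMat X + symMat Y := by
  simp [symMat, Matrix.fromBlocks_add]

lemma symMat_neg (X : Matrix (Fin n₁) (Fin n₂) ℝ) : symMat (-X) = -symMat X := by
  simp [symMat, Matrix.fromBlocks_neg]

lemma symMat_sub (X Y : Matrix (Fin n₁) (Fin n₂) ℝ) : symMat (X - Y) = symMat X - symMat Y := by
  rw [sub_eq_add_neg, symMat_add, symMat_neg, sub_eq_add_neg]

lemma symMat_norm {M : Matrix (Fin n₁) (Fin n₂) ℝ} {c : ℝ} (hc : 0 ≤ c)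
    (h : ∀ x y, |inner ℝ x (toC M y)| ≤ c * (‖x‖ * ‖y‖))
    (v : EuclideanSpace ℝ (Fin n₁ ⊕ Fin n₂)) : ‖toC (symMat M) v‖ ≤ c * ‖v‖ := by
  have h1 : ∀ y, ‖toC M y‖ ≤ c * ‖y‖ := by
    intro y
    have := (le_abs_self _).trans (h (toC M y) y)
    rw [real_inner_self_eq_norm_sq] at this
    by_contra hlt
    push Not at hlt
    have h0 : 0 < ‖toC M y‖ := lt_of_le_of_lt (by positivity) hlt
    nlinarith
  have h2 : ∀ x, ‖toC Mᵀ x‖ ≤ c * ‖x‖ := by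
    intro x
    have := (le_abs_self _).trans (h x (toC Mᵀ x))
    rw [← toC_inner' , real_inner_self_eq_norm_sq] at this
    by_contra hlt
    push Not at hlt
    have h0 : 0 < ‖toC Mᵀ x‖ := lt_of_le_of_lt (by positivity) hlt
    nlinarith
  set v1 : EuclideanSpace ℝ (Fin n₁) := WithLp.toLp 2 fun i => v (Sum.inl i) with hv1
  set v2 : EuclideanSpace ℝ (Fin n₂) := WithLp.toLp 2 fun i => v (Sum.inr i) with hv2
  have e1 : ‖v‖ ^ 2 = ‖v1‖ ^ 2 + ‖v2‖ ^ 2 := by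
    simp [EuclideanSpace.norm_sq_eq, hv1, hv2]
  have e2 : ‖toC (symMat M) v‖ ^ 2 = ‖toC M v2‖ ^ 2 + ‖toC Mᵀ v1‖ ^ 2 := by
    simp [EuclideanSpace.norm_sq_eq, hv1, hv2, toC_apply, symMat, Matrix.mulVec, dotProduct]
  apply abs_le_of_sq_le_sq' _ (by positivity) |>.2
  rw [mul_pow, e1, e2]
  have h3 := pow_le_pow_left₀ (norm_nonneg _) (h1 v2) 2
  have h4 := pow_le_pow_left₀ (norm_nonneg _) (h2 v1) 2
  nlinarith

lemma norm_diag (d : Fin r → ℝ) (x : EuclideanSpace ℝ (Fin r)) :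
    inner ℝ (toC (Matrix.diagonal d) x) x = ∑ i, d i * x i ^ 2 := by
  rw [inner_eq, toC_apply]
  simp only [dotProduct, Matrix.mulVec_diagonal]
  exact Finset.sum_congr rfl fun i _ => by ring

section Svd
variable {X : Matrix (Fin n₁) (Fin n₂) ℝ}
    {PX : Matrix (Fin n₁) (Fin r) ℝ} {QX : Matrix (Fin n₂) (Fin r) ℝ} {σX : Fin r → ℝ}

lemma norm_X_eq (hPX : PXᵀ * PX = 1) (hX : X = PX * Matrix.diagonal σX * QXᵀ)
    (x : EuclideanSpace ℝ (Fin n₂)) :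
    ‖toC X x‖ = ‖toC (Matrix.diagonal σX) (toC QXᵀ x)‖ := by
  rw [hX, Matrix.mul_assoc, toC_mul, norm_toC_of_orth hPX, toC_mul]

lemma norm_X_single (hPX : PXᵀ * PX = 1) (hQX : QXᵀ * QX = 1) (hσ : ∀ i, 0 < σX i)
    (hX : X = PX * Matrix.diagonal σX * QXᵀ) (i : Fin r) :
    ‖toC X (toC QX (EuclideanSpace.single i 1))‖ = σX i := by
  rw [norm_X_eq hPX hX, ← toC_mul QXᵀ, hQX, toC_one]
  have : toC (Matrix.diagonal σX) (EuclideanSpace.single i 1) = EuclideanSpace.single i (σX i) := by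
    rw [toC_apply]
    ext j
    simp [Matrix.mulVec_diagonal, Pi.single_apply]
    by_cases h : j = i <;> simp [h]
  rw [this]; simp [abs_of_pos (hσ i)]

lemma sigmaPos_le (hPX : PXᵀ * PX = 1) (hQX : QXᵀ * QX = 1) (hσ : ∀ i, 0 < σX i)
    (hX : X = PX * Matrix.diagonal σX * QXᵀ) (i : Fin r) : sigmaPos X ≤ σX i := by
  apply csInf_le
  · refine ⟨0, ?_⟩
    rintro _ ⟨x, -, -, rfl⟩
    exact Real.sqrt_nonneg _
  refine ⟨(toC QX (EuclideanSpace.single i 1)).ofLp, ?_, ?_, ?_⟩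
  · rw [euclNorm_eq]; simp only [WithLp.toLp_ofLp]
    rw [norm_toC_of_orth hQX]; simp
  · intro y hy
    have h1 : toC X (WithLp.toLp 2 y) = 0 := by rw [toC_apply]; simp [hy]
    have h2 := norm_X_eq hPX hX (WithLp.toLp 2 y)
    rw [h1, norm_zero, eq_comm, norm_eq_zero] at h2
    have h3 := congrArg (fun v : EuclideanSpace ℝ (Fin r) => v i) h2
    rw [toC_apply] at h3
    simp only [Matrix.mulVec_diagonal] at h3
    have h4 : (toC QXᵀ (WithLp.toLp 2 y)).ofLp i = 0 := by
      rcases mul_eq_zero.1 h3 with h | h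
      · exact absurd h (hσ i).ne'
      · exact h
    have h5 := toC_inner QX (EuclideanSpace.single i 1) (WithLp.toLp 2 y)
    rw [inner_eq] at h5
    rw [h5]
    rw [EuclideanSpace.inner_single_left, h4]; simp
  · rw [euclNorm_eq]; exact (norm_X_single hPX hQX hσ hX i).symm

lemma sigmaPos_pos (hr : 1 ≤ r) (hPX : PXᵀ * PX = 1) (hQX : QXᵀ * QX = 1) (hσ : ∀ i, 0 < σX i)
    (hanti : Antitone σX) (hX : X = PX * Matrix.diagonal σX * QXᵀ) : 0 < sigmaPos X := by
  set l : Fin r := ⟨r - 1, by omega⟩ with hl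
  have hle : ∀ i, σX l ≤ σX i := fun i => hanti (by rw [Fin.le_def, hl]; simp; omega)
  have hd : ∀ v : EuclideanSpace ℝ (Fin r), σX l * ‖v‖ ≤ ‖toC (Matrix.diagonal σX) v‖ := by
    intro v
    apply abs_le_of_sq_le_sq' _ (norm_nonneg _) |>.2
    rw [mul_pow, EuclideanSpace.norm_sq_eq, EuclideanSpace.norm_sq_eq, Finset.mul_sum]
    refine Finset.sum_le_sum fun i _ => ?_
    rw [toC_apply]
    simp only [Matrix.mulVec_diagonal, norm_mul, mul_pow, Real.norm_eq_abs, sq_abs]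
    have := pow_le_pow_left₀ (hσ l).le (hle i) 2
    gcongr
  refine lt_of_lt_of_le (hσ l) ?_
  apply le_csInf
  · refine ⟨_, (toC QX (EuclideanSpace.single l 1)).ofLp, ?_, ?_, rfl⟩
    · rw [euclNorm_eq]; simp only [WithLp.toLp_ofLp]
      rw [norm_toC_of_orth hQX]; simp
    · intro y hy
      have h1 : toC X (WithLp.toLp 2 y) = 0 := by rw [toC_apply]; simp [hy]
      have h2 := norm_X_eq hPX hX (WithLp.toLp 2 y)
      rw [h1, norm_zero] at h2
      have h3 := hd (toC QXᵀ (WithLp.toLp 2 y))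
      rw [← h2] at h3
      have h4 : ‖toC QXᵀ (WithLp.toLp 2 y)‖ = 0 :=
        le_antisymm (by nlinarith [hσ l]) (norm_nonneg _)
      have h5 := toC_inner QX (EuclideanSpace.single l 1) (WithLp.toLp 2 y)
      rw [inner_eq, norm_eq_zero.1 h4, inner_zero_right] at h5
      exact h5
  · rintro _ ⟨x, hx, hk, rfl⟩
    rw [euclNorm_eq] at hx ⊢
    set x' : EuclideanSpace ℝ (Fin n₂) := WithLp.toLp 2 x with hx'
    have e0 : WithLp.toLp 2 (X *ᵥ x) = toC X x' := rfl
    rw [e0, norm_X_eq hPX hX]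
    refine le_trans ?_ (hd _)
    have hker : toC X (x' - toC (QX * QXᵀ) x') = 0 := by
      rw [← norm_eq_zero, norm_X_eq hPX hX, map_sub, ← toC_mul, ← Matrix.mul_assoc, hQX,
        Matrix.one_mul, sub_self]; simp
    have h1 := hk (x' - toC (QX * QXᵀ) x').ofLp (by
      have := congrArg WithLp.ofLp hker
      simpa [toC_apply] using this)
    have h2 : inner ℝ x' (x' - toC (QX * QXᵀ) x') = 0 := by rw [inner_eq]; exact h1
    rw [inner_sub_right, real_inner_self_eq_norm_sq, toC_mul, ← toC_inner', 
      real_inner_self_eq_norm_sq, hx] at h2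
    have : ‖toC QXᵀ x'‖ = 1 := by nlinarith [norm_nonneg (toC QXᵀ x')]
    rw [this, mul_one]

lemma sigmaPos_le_spec (hr : 1 ≤ r) (hPX : PXᵀ * PX = 1) (hQX : QXᵀ * QX = 1)
    (hσ : ∀ i, 0 < σX i) (hX : X = PX * Matrix.diagonal σX * QXᵀ) : sigmaPos X ≤ specNorm X := by
  have h1 := sigmaPos_le hPX hQX hσ hX ⟨0, hr⟩
  have h2 := le_specNorm X (toC QX (EuclideanSpace.single ⟨0, hr⟩ 1))
  rw [norm_X_single hPX hQX hσ hX, norm_toC_of_orth hQX] at h2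
  simp at h2
  linarith

lemma LX_orth (hPX : PXᵀ * PX = 1) (hQX : QXᵀ * QX = 1) :
    (Zstack PX QX)ᵀ * Zstack PX QX = 1 := by
  rw [zs_t_zs, hPX, hQX, ← two_smul ℝ, smul_smul]; norm_num

lemma F_LX (hPX : PXᵀ * PX = 1) (hQX : QXᵀ * QX = 1)
    (hX : X = PX * Matrix.diagonal σX * QXᵀ) :
    symMat X * Zstack PX QX = Zstack PX QX * Matrix.diagonal σX := by
  have h1 : X * QX = PX * Matrix.diagonal σX := by
    rw [hX, Matrix.mul_assoc, hQX, Matrix.mul_one]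
  have h2 : Xᵀ * PX = QX * Matrix.diagonal σX := by
    rw [hX, Matrix.transpose_mul, Matrix.transpose_mul, Matrix.diagonal_transpose,
      Matrix.transpose_transpose, Matrix.mul_assoc, Matrix.mul_assoc, hPX, Matrix.mul_one]
  rw [sym_zs, zs_mul, h1, h2]

lemma F_eq (hX : X = PX * Matrix.diagonal σX * QXᵀ) :
    symMat X = Zstack PX QX * Matrix.diagonal σX * (Zstack PX QX)ᵀ
      - Zstack PX (-QX) * Matrix.diagonal σX * (Zstack PX (-QX))ᵀ := by
  rw [zs_mul, zs_mul, Matrix.neg_mul, zs_zs_t, symMat, hX]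
  congr 1
  rw [Matrix.transpose_mul, Matrix.transpose_mul, Matrix.diagonal_transpose,
      Matrix.transpose_transpose, Matrix.mul_assoc]

end Svd

end Concrete

section Concrete
open ContinuousLinearMap
variable {n₁ n₂ m k r : ℕ}

lemma zs_lin {p : ℕ} (V V' : Matrix (Fin n₁) (Fin p) ℝ) (W W' : Matrix (Fin n₂) (Fin p) ℝ) (c : ℝ) :
    Zstack (V + c • V') (W + c • W') = Zstack V W + c • Zstack V' W' := by
  simp only [Zstack]
  ext (i | i) j <;> simp <;> ring

/-- the error matrix -/
def Em (A : Fin m → Matrix (Fin n₁) (Fin n₂) ℝ) (X : Matrix (Fin n₁) (Fin n₂) ℝ)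
    (V : Matrix (Fin n₁) (Fin k) ℝ) (W : Matrix (Fin n₂) (Fin k) ℝ) :
    Matrix (Fin n₁) (Fin n₂) ℝ := (V * Wᵀ - X) - AstarA A (V * Wᵀ - X)

lemma step_eq (A : Fin m → Matrix (Fin n₁) (Fin n₂) ℝ) (X : Matrix (Fin n₁) (Fin n₂) ℝ)
    (V : Matrix (Fin n₁) (Fin k) ℝ) (W : Matrix (Fin n₂) (Fin k) ℝ) :
    -symMat (AstarA A (V * Wᵀ - X)) = symMat X - Zstack V W * (Zstack V W)ᵀ
      + Zstack V (-W) * (Zstack V (-W))ᵀ + symMat (Em A X V W) := by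
  have h1 := zs_zs_t V V W W
  have h2 : Matrix.fromBlocks 0 (V * Wᵀ) (W * Vᵀ) 0 = symMat (V * Wᵀ) := by
    rw [symMat, Matrix.transpose_mul, Matrix.transpose_transpose]
  rw [h2] at h1
  rw [Em, symMat_sub, symMat_sub, ← h1]
  abel

lemma Zit_succ (A : Fin m → Matrix (Fin n₁) (Fin n₂) ℝ) (X : Matrix (Fin n₁) (Fin n₂) ℝ)
    (μ : ℝ) (V₀ : Matrix (Fin n₁) (Fin k) ℝ) (W₀ : Matrix (Fin n₂) (Fin k) ℝ) (t : ℕ) :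
    Zit A X μ V₀ W₀ (t + 1) = Zit A X μ V₀ W₀ t + μ • ((symMat X
      - Zit A X μ V₀ W₀ t * (Zit A X μ V₀ W₀ t)ᵀ + Ztil A X μ V₀ W₀ t * (Ztil A X μ V₀ W₀ t)ᵀ
      + symMat (Em A X (iter A X μ V₀ W₀ t).1 (iter A X μ V₀ W₀ t).2)) * Zit A X μ V₀ W₀ t) := by
  simp only [Zit, Ztil]
  rw [← step_eq, Matrix.neg_mul, sym_zs, smul_neg, ← neg_smul, ← zs_lin]
  simp only [iter, neg_smul, ← sub_eq_add_neg]

lemma Ztil_succ (A : Fin m → Matrix (Fin n₁) (Fin n₂) ℝ) (X : Matrix (Fin n₁) (Fin n₂) ℝ)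
    (μ : ℝ) (V₀ : Matrix (Fin n₁) (Fin k) ℝ) (W₀ : Matrix (Fin n₂) (Fin k) ℝ) (t : ℕ) :
    Ztil A X μ V₀ W₀ (t + 1) = Ztil A X μ V₀ W₀ t - μ • ((symMat X
      - Zit A X μ V₀ W₀ t * (Zit A X μ V₀ W₀ t)ᵀ + Ztil A X μ V₀ W₀ t * (Ztil A X μ V₀ W₀ t)ᵀ
      + symMat (Em A X (iter A X μ V₀ W₀ t).1 (iter A X μ V₀ W₀ t).2)) * Ztil A X μ V₀ W₀ t) := by
  simp only [Zit, Ztil]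
  rw [← step_eq, Matrix.neg_mul, sym_zs, smul_neg, sub_neg_eq_add, ← zs_lin]
  simp only [iter, Matrix.mul_neg, smul_neg, ← sub_eq_add_neg, neg_sub]
  congr 1
  abel

section Main
variable {A : Fin m → Matrix (Fin n₁) (Fin n₂) ℝ} {X : Matrix (Fin n₁) (Fin n₂) ℝ}
    {PX : Matrix (Fin n₁) (Fin r) ℝ} {QX : Matrix (Fin n₂) (Fin r) ℝ} {σX : Fin r → ℝ}

lemma pi_zero_iff {ι : Type*} [Fintype ι] [DecidableEq ι] {L : Matrix ι (Fin r) ℝ} (hL : Lᵀ * L = 1)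
    (v : EuclideanSpace ℝ ι) : toC (L * Lᵀ) v = 0 ↔ toC Lᵀ v = 0 := by
  rw [← norm_eq_zero, ← norm_toC_transpose hL, norm_eq_zero]

lemma pi_eq_iff {ι : Type*} [Fintype ι] [DecidableEq ι] {L : Matrix ι (Fin r) ℝ} (hL : Lᵀ * L = 1)
    (v w : EuclideanSpace ℝ ι) : toC (L * Lᵀ) v = toC (L * Lᵀ) w ↔ toC Lᵀ v = toC Lᵀ w := by
  rw [← sub_eq_zero, ← map_sub, pi_zero_iff hL, map_sub, sub_eq_zero]

lemma G_surj {ι : Type*} [Fintype ι] [DecidableEq ι] {L : Matrix ι (Fin r) ℝ} (hL : Lᵀ * L = 1)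
    {Z : Matrix ι (Fin k) ℝ}
    (h : ∀ w, ∃ x, toC (L * Lᵀ) (toC Z x) = toC (L * Lᵀ) w) :
    Function.Surjective (toC (Lᵀ * Z)) := by
  intro y
  obtain ⟨x, hx⟩ := h (toC L y)
  refine ⟨x, ?_⟩
  rw [pi_eq_iff hL, ← toC_mul, ← toC_mul, hL, toC_one] at hx
  exact hx

lemma glob_of {μ δ κ : ℝ} {V₀ : Matrix (Fin n₁) (Fin k) ℝ} {W₀ : Matrix (Fin n₂) (Fin k) ℝ}
    (hr : 1 ≤ r) (hk : 1 ≤ k)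
    (hPX : PXᵀ * PX = 1) (hQX : QXᵀ * QX = 1)
    (hσpos : ∀ i, 0 < σX i) (hσanti : Antitone σX)
    (hX : X = PX * Matrix.diagonal σX * QXᵀ) (hμ : 0 < μ) (hκ : κ = condNum X)
    (hδ0 : 0 < δ) (hδ : δ ≤ 1 / 10 ^ 9 / (κ ^ 3 * √r))
    (hRIP : HasRIP A (2 * r + 1) δ)
    (hμb : μ ≤ 1 / 10 ^ 13 / (κ ^ 4 * specNorm X)) :
    Glob (toC (Zstack PX QX * (Zstack PX QX)ᵀ)) (toC (symMat X))
      (fun t => toC (symMat (Em A X (iter A X μ V₀ W₀ t).1 (iter A X μ V₀ W₀ t).2)))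
      (fun t => toC (Zit A X μ V₀ W₀ t)) (fun t => toC (Ztil A X μ V₀ W₀ t))
      (specNorm X) (sigmaPos X) μ κ k := by
  have hσ := sigmaPos_pos hr hPX hQX hσpos hσanti hX
  have hσβ := sigmaPos_le_spec hr hPX hQX hσpos hX
  have hL := LX_orth hPX hQX
  have hFL := F_LX hPX hQX hX
  set L := Zstack PX QX with hLdef
  set β := specNorm X with hβ
  set σ := sigmaPos X with hσd
  have hβ0 : 0 < β := by linarith
  have hκe : κ = β / σ := hκ
  have hκ1 : 1 ≤ κ := by rw [hκe, le_div_iff₀ hσ]; linarith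
  have hβκ : β = κ * σ := by rw [hκe]; field_simp
  have hκ0 : 0 < κ := by linarith
  have hr0 : (0 : ℝ) < √r := Real.sqrt_pos.2 (by exact_mod_cast hr)
  have hLF : Lᵀ * symMat X = Matrix.diagonal σX * Lᵀ := by
    have := congrArg Matrix.transpose hFL
    rwa [Matrix.transpose_mul, Matrix.transpose_mul, symMat_t, Matrix.diagonal_transpose] at this
  have hs : ∀ M : Matrix (Fin n₁) (Fin n₂) ℝ, ∀ x y,
      inner ℝ (toC (symMat M) x) y = inner ℝ x (toC (symMat M) y) := by
    intro M x y; rw [toC_inner, symMat_t]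
  refine
  { π_idem := ?_
    π_symm := ?_
    F_symm := hs X
    F_comm := ?_
    F_norm := ?_
    F_pos := ?_
    F_neg := ?_
    Δ_symm := fun t => hs _
    hZp := ?_
    hZtp := ?_
    hZt := fun t x => zs_norm_neg _ _ _
    hβ := hβκ
    hσ := hσ
    hκ := hκ1
    hμ := hμ
    hμβ := ?_
    hk := by exact_mod_cast hk
    hΔ := ?_ }
  · intro x
    rw [← toC_mul, Matrix.mul_assoc, ← Matrix.mul_assoc Lᵀ, hL, Matrix.one_mul]
  · intro x y
    rw [toC_inner, Matrix.transpose_mul, Matrix.transpose_transpose]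
  · intro x
    rw [← toC_mul, ← toC_mul, Matrix.mul_assoc, hLF, ← Matrix.mul_assoc,
      ← Matrix.mul_assoc (symMat X), hFL]
  · refine symMat_norm hβ0.le fun x y => ?_
    refine (abs_real_inner_le_norm _ _).trans ?_
    have := le_specNorm X y
    calc _ ≤ ‖x‖ * (β * ‖y‖) := by gcongr
      _ = _ := by ring
  · intro x
    rw [toC_mul L, norm_toC_of_orth hL, ← toC_mul (symMat X), hFL, toC_mul L, toC_inner,
      ← toC_mul Lᵀ L, hL, toC_one,
      norm_diag, EuclideanSpace.norm_sq_eq, Finset.mul_sum]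
    refine Finset.sum_le_sum fun i _ => ?_
    rw [Real.norm_eq_abs, sq_abs]
    have := sigmaPos_le hPX hQX hσpos hX i
    gcongr
  · intro x hx
    rw [pi_zero_iff hL] at hx
    rw [F_eq hX, toC_sub, ← hLdef, toC_mul, hx, map_zero, zero_sub, inner_neg_left, toC_mul,
      toC_mul, toC_inner, norm_diag]
    have : 0 ≤ ∑ i, σX i * (toC (Zstack PX (-QX))ᵀ x) i ^ 2 :=
      Finset.sum_nonneg fun i _ => mul_nonneg (hσpos i).le (sq_nonneg _)
    linarith
  · intro t x
    simp only [toC_adj]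
    rw [Zit_succ]
    simp only [toC_add, toC_smul, toC_sub, toC_mul]
  · intro t x
    simp only [toC_adj]
    rw [Ztil_succ]
    simp only [toC_add, toC_smul, toC_sub, toC_mul]
  · rw [le_div_iff₀ (by positivity)] at hμb
    linarith
  · intro t γ hγ hkγ hZ hker hsur
    have hG := G_surj hL hsur
    set V := (iter A X μ V₀ W₀ t).1 with hV
    set W := (iter A X μ V₀ W₀ t).2 with hW
    have hZe : Zit A X μ V₀ W₀ t = Zstack V W := rfl
    rw [hZe] at hG hker hZ
    have hX' : X = PX * (Xᵀ * PX)ᵀ := by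
      rw [Matrix.transpose_mul, Matrix.transpose_transpose, ← Matrix.mul_assoc]
      conv_rhs => rw [hX]
      rw [← Matrix.mul_assoc, ← Matrix.mul_assoc, Matrix.mul_assoc PX, hPX, Matrix.mul_one]
      exact hX
    have hXt : ∀ x, ‖toC Xᵀ x‖ ≤ β * ‖x‖ := by
      intro x
      by_contra hlt
      push Not at hlt
      have h1 : ‖toC Xᵀ x‖ ^ 2 ≤ ‖x‖ * (β * ‖toC Xᵀ x‖) := by
        rw [← real_inner_self_eq_norm_sq, toC_inner']
        refine (real_inner_le_norm _ _).trans ?_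
        gcongr
        exact le_specNorm X _
      have h0 : 0 < ‖toC Xᵀ x‖ := lt_of_le_of_lt (by positivity) hlt
      nlinarith
    have hδb : 10 * (δ * √r * β) ≤ 11 / 10 ^ 9 * (σ / κ ^ 2) := by
      rw [le_div_iff₀ (by positivity)] at hδ
      have h1 : δ * √r * β * κ ^ 3 ≤ 1 / 10 ^ 9 * β := by nlinarith
      have h2 : δ * √r * β ≤ 1 / 10 ^ 9 * β / κ ^ 3 := by
        rw [le_div_iff₀ (by positivity)]; exact h1
      have h3 : 1 / 10 ^ 9 * β / κ ^ 3 = 1 / 10 ^ 9 * (σ / κ ^ 2) := by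
        rw [hβκ]; field_simp
      have : 0 < σ / κ ^ 2 := by positivity
      linarith
    refine symMat_norm (by positivity) fun x y => ?_
    have hmain := delta_bound (A := A) (γ := γ) (V := V) (W := W) hr hRIP hδ0.le hβ0.le hPX hX'
      (by intro x; rw [toC_mul]; exact (hXt _).trans (by rw [norm_toC_of_orth hPX])) hG
      (by
        intro x
        have h1 := zs_norm V W x
        have h2 := pow_le_pow_left₀ (norm_nonneg _) (hZ x) 2
        rw [mul_pow, mul_pow, Real.sq_sqrt hβ0.le] at h2
        linarith)
      (by
        intro x hx
        have h1 := zs_norm V W x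
        have h2 := pow_le_pow_left₀ (norm_nonneg _)
          (hker x (by rw [pi_zero_iff hL, ← toC_mul]; exact hx)) 2
        rw [mul_pow] at h2
        linarith) x y
    refine hmain.trans ?_
    refine mul_le_mul_of_nonneg_right ?_ (by positivity)
    have h1 : (1 : ℝ) ≤ √r := by
      rw [Real.one_le_sqrt]; exact_mod_cast hr
    have h2 : 9 * √r * β + k * γ ^ 2 ≤ 10 * √r * β := by nlinarith
    calc _ ≤ δ * (10 * √r * β) := by gcongr
      _ ≤ _ := by linarith
end Main

end Concrete

section Conversion
open ContinuousLinearMap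
variable {ι : Type*} [Fintype ι] [DecidableEq ι] {k r p : ℕ}

lemma orth_space {L : Matrix ι (Fin r) ℝ} (hL : Lᵀ * L = 1) (v : EuclideanSpace ℝ ι) :
    ‖v‖ ^ 2 = ‖toC (L * Lᵀ) v‖ ^ 2 + ‖v - toC (L * Lᵀ) v‖ ^ 2 := by
  have h1 : inner ℝ (toC (L * Lᵀ) v) (v - toC (L * Lᵀ) v) = 0 := by
    rw [toC_inner, Matrix.transpose_mul, Matrix.transpose_transpose, map_sub, ← toC_mul (L * Lᵀ),
      Matrix.mul_assoc, ← Matrix.mul_assoc Lᵀ, hL, Matrix.one_mul, sub_self, inner_zero_right]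
  have h2 := norm_add_sq_eq_norm_sq_add_norm_sq_real h1
  rw [add_sub_cancel] at h2
  nlinarith

lemma square_surj {S : Matrix (Fin r) (Fin r) ℝ} :
    Function.Injective (toC S) ↔ Function.Surjective (toC S) :=
  LinearMap.injective_iff_surjective
    (f := (toC S : EuclideanSpace ℝ (Fin r) →ₗ[ℝ] EuclideanSpace ℝ (Fin r)))

lemma inj_of_zero {S : Matrix ι (Fin r) ℝ} (h : ∀ q, toC S q = 0 → q = 0) :
    Function.Injective (toC S) := by
  intro a b hab
  have := h (a - b) (by rw [map_sub, hab, sub_self])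
  exact sub_eq_zero.1 this

/-- the kernel of `G` in terms of `Q` -/
lemma ker_char {G : Matrix (Fin r) (Fin k) ℝ} {Q : Matrix (Fin k) (Fin r) ℝ}
    (hG : G * Q * Qᵀ = G) (hinj : ∀ q, toC (G * Q) q = 0 → q = 0)
    (x : EuclideanSpace ℝ (Fin k)) (hx : toC G x = 0) : toC Qᵀ x = 0 := by
  apply hinj
  rw [← toC_mul, hG, hx]

lemma ker_char' {G : Matrix (Fin r) (Fin k) ℝ} {Q : Matrix (Fin k) (Fin r) ℝ}
    (hG : G * Q * Qᵀ = G) (x : EuclideanSpace ℝ (Fin k)) (hx : toC Qᵀ x = 0) : toC G x = 0 := by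
  rw [← hG, toC_mul, hx, map_zero]

lemma expand_right {Q : Matrix (Fin k) (Fin r) ℝ} {Qp : Matrix (Fin k) (Fin p) ℝ}
    (hc : Q * Qᵀ + Qp * Qpᵀ = 1) (x : EuclideanSpace ℝ (Fin k)) :
    x = toC Q (toC Qᵀ x) + toC Qp (toC Qpᵀ x) := by
  rw [← toC_mul, ← toC_mul, ← toC_add, hc, toC_one]

lemma sigma_row_ge {G : Matrix (Fin r) (Fin k) ℝ} (hr : 1 ≤ r) {s : ℝ} (hs : 0 ≤ s)
    (hsur : Function.Surjective (toC G))
    (h : ∀ y, (∀ x, toC G x = 0 → inner ℝ x y = 0) → s * ‖y‖ ≤ ‖toC G y‖) : s ≤ sigmaMin G := by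
  rw [sigmaMin]
  apply le_max_of_le_right
  have : Nonempty (Fin r) := ⟨⟨0, hr⟩⟩
  apply sigmaInf_ge
  intro w
  obtain ⟨z, hz⟩ := hsur w
  obtain ⟨y, x, hyx, hy, hx⟩ := exists_decomp (ContinuousLinearMap.id ℝ _) (toC G) z
  have hGy : toC G y = w := by
    have hx' : toC G x = 0 := hx
    rw [← hz, hyx, map_add, hx', add_zero]
  have h1 := h y hy
  rw [hGy] at h1
  have h2 : ‖w‖ ^ 2 ≤ ‖y‖ * ‖toC Gᵀ w‖ := by
    rw [← real_inner_self_eq_norm_sq]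
    nth_rewrite 1 [← hGy]
    rw [toC_inner]
    exact real_inner_le_norm _ _
  rcases eq_or_ne w 0 with rfl | hw
  · simp
  have hw0 : 0 < ‖w‖ := norm_pos_iff.2 hw
  have h3 : s * ‖w‖ ^ 2 ≤ ‖w‖ * ‖toC Gᵀ w‖ := by
    calc _ ≤ s * (‖y‖ * ‖toC Gᵀ w‖) := by gcongr
      _ = (s * ‖y‖) * ‖toC Gᵀ w‖ := by ring
      _ ≤ _ := by gcongr
  have h4 : ‖w‖ * (s * ‖w‖) ≤ ‖w‖ * ‖toC Gᵀ w‖ := by linarith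
  exact le_of_mul_le_mul_left h4 hw0

lemma sigma_le_Q {G : Matrix (Fin r) (Fin k) ℝ} {Q : Matrix (Fin k) (Fin r) ℝ}
    (hQ : Qᵀ * Q = 1) (hG : G * Q * Qᵀ = G) (q : EuclideanSpace ℝ (Fin r)) :
    sigmaMin G * ‖q‖ ≤ ‖toC (G * Q) q‖ := by
  rw [sigmaMin, max_mul_of_nonneg _ _ (norm_nonneg q)]
  apply max_le
  · have := sigmaInf_le G (toC Q q)
    rwa [norm_toC_of_orth hQ, ← toC_mul] at this
  · set a := sInf {c : ℝ | ∃ x : Fin r → ℝ, euclNorm x = 1 ∧ c = euclNorm (Gᵀ.mulVec x)} with ha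
    have h1 : ∀ w, a * ‖w‖ ≤ ‖toC (G * Q)ᵀ w‖ := by
      intro w
      have h := sigmaInf_le Gᵀ w
      have e : Gᵀ = Q * (G * Q)ᵀ := by
        conv_lhs => rw [← hG]
        rw [Matrix.transpose_mul, Matrix.transpose_transpose]
      have e2 : ‖toC Gᵀ w‖ = ‖toC (G * Q)ᵀ w‖ := by
        conv_lhs => rw [e]
        rw [toC_mul, norm_toC_of_orth hQ]
      rw [← e2]; exact h
    rcases le_or_gt a 0 with h0 | h0
    · exact (mul_nonpos_of_nonpos_of_nonneg h0 (norm_nonneg _)).trans (norm_nonneg _)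
    have hinj : Function.Injective (toC (G * Q)ᵀ) := by
      apply inj_of_zero
      intro w hw
      have := h1 w
      rw [hw, norm_zero] at this
      have h2 : ‖w‖ ≤ 0 := by
        by_contra hlt
        push Not at hlt
        nlinarith
      exact norm_le_zero_iff.1 h2
    obtain ⟨w, hw⟩ := square_surj.1 hinj q
    have h2 := h1 w
    rw [hw] at h2
    have h3 : ‖q‖ ^ 2 ≤ ‖w‖ * ‖toC (G * Q) q‖ := by
      rw [← real_inner_self_eq_norm_sq]
      nth_rewrite 1 [← hw]
      rw [toC_inner']
      exact real_inner_le_norm _ _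
    rcases eq_or_ne q 0 with rfl | hq
    · simp
    have hq0 : 0 < ‖q‖ := norm_pos_iff.2 hq
    have h4 : ‖q‖ * (a * ‖q‖) ≤ ‖q‖ * ‖toC (G * Q) q‖ := by
      calc _ = a * ‖q‖ ^ 2 := by ring
        _ ≤ a * (‖w‖ * ‖toC (G * Q) q‖) := by gcongr
        _ = (a * ‖w‖) * ‖toC (G * Q) q‖ := by ring
        _ ≤ _ := by gcongr
    exact le_of_mul_le_mul_left h4 hq0

/-- `σ_min` of a tall matrix is attained on columns -/
lemma sigma_tall {M : Matrix ι (Fin r) ℝ} (hc : r < Fintype.card ι) (q : EuclideanSpace ℝ (Fin r)) :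
    sigmaMin M * ‖q‖ ≤ ‖toC M q‖ := by
  rw [sigmaMin, max_mul_of_nonneg _ _ (norm_nonneg q)]
  apply max_le
  · exact sigmaInf_le M q
  · have := sigmaInf_eq_zero Mᵀ (by simpa using hc)
    exact (mul_nonpos_of_nonpos_of_nonneg this (norm_nonneg _)).trans (norm_nonneg _)

section OrthCol
variable {ι' : Type*} [Fintype ι'] [DecidableEq ι']

lemma orthCol_inj {M P : Matrix ι (Fin r) ℝ} (h : IsOrthCol P M) (q : EuclideanSpace ℝ (Fin r))
    (hq : toC M q = 0) : q = 0 := by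
  obtain ⟨h1, ⟨C, hC⟩, h3⟩ := h
  have h4 : (Pᵀ * M) * C = 1 := by rw [Matrix.mul_assoc, ← hC, h1]
  have h5 : C * (Pᵀ * M) = 1 := mul_eq_one_comm.1 h4
  rw [← toC_one q, ← h5, toC_mul, toC_mul, hq]; simp

lemma orthCol_bound {M P : Matrix ι (Fin r) ℝ} (h : IsOrthCol P M) (B : Matrix ι' ι ℝ)
    {c : ℝ} (hB : specNorm (B * P) ≤ c) (q : EuclideanSpace ℝ (Fin r)) :
    ‖toC B (toC M q)‖ ≤ c * ‖toC M q‖ := by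
  obtain ⟨h1, -, h3⟩ := h
  have e : toC M q = toC P (toC Pᵀ (toC M q)) := by
    rw [← toC_mul, ← toC_mul, h3]
  have e2 : ‖toC M q‖ = ‖toC Pᵀ (toC M q)‖ := by
    conv_lhs => rw [e]
    rw [norm_toC_of_orth h1]
  rw [e2]
  conv_lhs => rw [e, ← toC_mul B P]
  exact (le_specNorm _ _).trans (by gcongr)

lemma orthCol_bound' {M P : Matrix ι (Fin r) ℝ} (h : IsOrthCol P M) (B : Matrix ι' ι ℝ)
    {c : ℝ} (hc : 0 ≤ c) (hB : ∀ q, ‖toC B (toC M q)‖ ≤ c * ‖toC M q‖) : specNorm (B * P) ≤ c := by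
  obtain ⟨h1, ⟨C, hC⟩, h3⟩ := h
  apply specNorm_le hc
  intro x
  have h2 := hB (toC C x)
  rwa [← toC_mul M, ← hC, norm_toC_of_orth h1, ← toC_mul B] at h2

end OrthCol

lemma angle_conv {L : Matrix ι (Fin r) ℝ} (hL : Lᵀ * L = 1) {η0 : ℝ} (h0 : 0 ≤ η0) (h1 : η0 < 1)
    (v : EuclideanSpace ℝ ι) :
    ‖v - toC (L * Lᵀ) v‖ ≤ η0 * ‖v‖ ↔
      ‖v - toC (L * Lᵀ) v‖ ≤ η0 / √(1 - η0 ^ 2) * ‖toC (L * Lᵀ) v‖ := by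
  have h := orth_space hL v
  have hpos : 0 < 1 - η0 ^ 2 := by nlinarith
  have hs : 0 < √(1 - η0 ^ 2) := Real.sqrt_pos.2 hpos
  set a := ‖toC (L * Lᵀ) v‖
  set b := ‖v - toC (L * Lᵀ) v‖
  have ha : 0 ≤ a := norm_nonneg _
  have hb : 0 ≤ b := norm_nonneg _
  have hv : 0 ≤ ‖v‖ := norm_nonneg _
  rw [← sq_le_sq₀ hb (by positivity), ← sq_le_sq₀ hb (by positivity), mul_pow, mul_pow, div_pow,
    Real.sq_sqrt hpos.le, h, div_mul_eq_mul_div, le_div_iff₀ hpos]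
  constructor <;> intro h <;> nlinarith

section Init
variable {L : Matrix ι (Fin r) ℝ} {Lp : Matrix ι (Fin p) ℝ} {Z Zt : Matrix ι (Fin k) ℝ}
  {Q P' : Matrix (Fin k) (Fin r) ℝ} {Qp : Matrix (Fin k) (Fin (k - r)) ℝ}
  {P : Matrix ι (Fin r) ℝ}

lemma init_inj (hL : Lᵀ * L = 1) (hLp : Lpᵀ * Lp = 1) (hLc : L * Lᵀ + Lp * Lpᵀ = 1)
    (hP : IsOrthCol P (Z * Q)) {η0 : ℝ} (h1 : η0 ≤ 1 / 3) (ha2 : specNorm (Lpᵀ * P) ≤ η0)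
    (q : EuclideanSpace ℝ (Fin r)) : 2 / 3 * ‖toC (Z * Q) q‖ ≤ ‖toC (Lᵀ * Z * Q) q‖ := by
  have h2 := orthCol_bound hP Lpᵀ ha2 q
  rw [norm_toC_compl hLp hLc] at h2
  rw [Matrix.mul_assoc, toC_mul Lᵀ, norm_toC_transpose hL]
  set v := toC (Z * Q) q
  have h3 : ‖v‖ ≤ ‖toC (L * Lᵀ) v‖ + ‖v - toC (L * Lᵀ) v‖ := by
    calc ‖v‖ = ‖toC (L * Lᵀ) v + (v - toC (L * Lᵀ) v)‖ := by rw [add_sub_cancel]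
      _ ≤ _ := norm_add_le _ _
  nlinarith [norm_nonneg v]

lemma init_inv (hr : 1 ≤ r) (hcard : r < Fintype.card ι)
    (hL : Lᵀ * L = 1) (hLp : Lpᵀ * Lp = 1) (hLc : L * Lᵀ + Lp * Lpᵀ = 1)
    (hQ : Qᵀ * Q = 1) (hG : Lᵀ * Z * Q * Qᵀ = Lᵀ * Z) (hQp : Qpᵀ * Qp = 1) (hQQp : Qᵀ * Qp = 0)
    (hP : IsOrthCol P (Z * Q)) {η0 θ ζ b : ℝ} (h0 : 0 ≤ η0) (h1 : η0 ≤ 1 / 3)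
    (ha1 : specNorm (Z * Qp) ≤ 2 * sigmaMin (Z * Q))
    (ha2 : specNorm (Lpᵀ * P) ≤ η0) (ha3 : specNorm Z ≤ b)
    (ha4 : specNorm (Ztᵀ * Z * Qp) ≤ ζ * specNorm (Z * Qp)) (ha5 : specNorm (Ztᵀ * P) ≤ θ) :
    0 < sigmaMin (Lᵀ * Z) ∧ specNorm (Z * Qp) ≤ 3 * sigmaMin (Lᵀ * Z) ∧
    Inv (toC (L * Lᵀ)) (toC Z) (toC Zt) b ζ (η0 / √(1 - η0 ^ 2)) θ (specNorm (Z * Qp))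
      (sigmaMin (Lᵀ * Z)) (specNorm (Ztᵀ * Z)) := by
  have hrk : r ≤ k := by simpa using card_le_of_orth hQ
  have hQc : Q * Qᵀ + Qp * Qpᵀ = 1 := complete_of_orth hQ hQp hQQp (by simp; omega)
  have hlow := init_inj hL hLp hLc hP h1 ha2
  have hinj : ∀ q, toC (Lᵀ * Z * Q) q = 0 → q = 0 := by
    intro q hq
    have h2 := hlow q
    rw [hq, norm_zero] at h2
    exact orthCol_inj hP q (norm_le_zero_iff.1 (by linarith))
  have hsurj : Function.Surjective (toC (Lᵀ * Z)) := by
    intro w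
    obtain ⟨q, hq⟩ := square_surj.1 (inj_of_zero hinj) w
    exact ⟨toC Q q, by rw [← toC_mul, hq]⟩
  have hker : ∀ x, toC (L * Lᵀ) (toC Z x) = 0 → x = toC Qp (toC Qpᵀ x) := by
    intro x hx
    rw [pi_zero_iff hL, ← toC_mul] at hx
    have h2 := expand_right hQc x
    rwa [ker_char hG hinj x hx, map_zero, zero_add] at h2
  have hR' : ∀ y, (∀ x, toC (Lᵀ * Z) x = 0 → inner ℝ x y = 0) → y = toC Q (toC Qᵀ y) := by
    intro y hy
    have h3 : toC Qpᵀ y = 0 := by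
      have h4 := hy (toC Qp (toC Qpᵀ y)) (ker_char' hG _ (by rw [← toC_mul, hQQp, toC_zero]))
      rw [toC_inner, real_inner_self_eq_norm_sq] at h4
      simpa using h4
    have h2 := expand_right hQc y
    rwa [h3, map_zero, add_zero] at h2
  have hR : ∀ y, InR (toC (L * Lᵀ)) (toC Z) y → y = toC Q (toC Qᵀ y) := by
    intro y hy
    refine hR' y fun x hx => hy x ?_
    rw [pi_zero_iff hL, ← toC_mul, hx]
  have hQn : ∀ y, y = toC Q (toC Qᵀ y) → ‖y‖ = ‖toC Qᵀ y‖ := by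
    intro y hy
    conv_lhs => rw [hy]
    rw [norm_toC_of_orth hQ]
  have hs1 : 2 / 3 * sigmaMin (Z * Q) ≤ sigmaMin (Lᵀ * Z) := by
    refine sigma_row_ge hr (mul_nonneg (by norm_num) (sigmaMin_nonneg _)) hsurj ?_
    intro y hy
    have h2 := hR' y hy
    rw [hQn y h2]
    have h3 := sigma_tall (M := Z * Q) hcard (toC Qᵀ y)
    have h4 := hlow (toC Qᵀ y)
    rw [toC_mul (Lᵀ * Z), ← h2] at h4
    linarith
  have hs0 : 0 < sigmaMin (Lᵀ * Z) := by
    obtain ⟨c, hc, hc2⟩ := LinearMap.exists_antilipschitzWith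
      (toC (Lᵀ * Z * Q) : EuclideanSpace ℝ (Fin r) →ₗ[ℝ] EuclideanSpace ℝ (Fin r))
      (LinearMap.ker_eq_bot.2 (inj_of_zero hinj))
    have hc' : (0 : ℝ) < c := hc
    have h2 : ∀ q, ‖q‖ ≤ c * ‖toC (Lᵀ * Z * Q) q‖ := by
      intro q
      have := hc2.le_mul_dist q 0
      simpa using this
    refine lt_of_lt_of_le (inv_pos.2 hc') (sigma_row_ge hr (inv_pos.2 hc').le hsurj ?_)
    intro y hy
    have h3 := hR' y hy
    rw [inv_mul_le_iff₀ hc', hQn y h3]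
    have h4 := h2 (toC Qᵀ y)
    rwa [toC_mul (Lᵀ * Z), ← h3] at h4
  refine ⟨hs0, by linarith, ?_⟩
  have hRZ : ∀ y, InR (toC (L * Lᵀ)) (toC Z) y → toC Z y = toC (Z * Q) (toC Qᵀ y) := by
    intro y hy
    rw [toC_mul, ← hR y hy]
  refine
  { Z_norm := fun x => (le_specNorm _ _).trans (by gcongr)
    i2 := ?_
    i3 := ?_
    i4 := ?_
    i5 := ?_
    i6 := ?_
    i7 := ?_
    i8 := ?_ }
  · intro x hx
    have h2 := hker x hx
    have h3 : ‖x‖ = ‖toC Qpᵀ x‖ := by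
      conv_lhs => rw [h2]
      rw [norm_toC_of_orth hQp]
    rw [h3]
    conv_lhs => rw [h2, ← toC_mul]
    exact le_specNorm _ _
  · intro x hx
    have h2 := hker x hx
    have h3 : ‖x‖ = ‖toC Qpᵀ x‖ := by
      conv_lhs => rw [h2]
      rw [norm_toC_of_orth hQp]
    rw [h3, toC_adj]
    conv_lhs => rw [h2, ← toC_mul, ← toC_mul]
    exact (le_specNorm _ _).trans (by gcongr)
  · intro y hy
    rw [← angle_conv hL h0 (by linarith), hRZ y hy, ← norm_toC_compl hLp hLc]
    exact orthCol_bound hP Lpᵀ ha2 _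
  · intro y hy
    rw [hRZ y hy, toC_adj]
    exact orthCol_bound hP Ztᵀ ha5 _
  · intro y hy
    have h2 := hR y hy
    rw [← norm_toC_transpose hL, hQn y h2, hRZ y hy, ← toC_mul, ← Matrix.mul_assoc]
    exact sigma_le_Q hQ hG _
  · intro x
    rw [toC_adj, ← toC_mul]
    exact le_specNorm _ _
  · intro w
    obtain ⟨x, hx⟩ := hsurj (toC Lᵀ w)
    exact ⟨x, by rw [pi_eq_iff hL, ← toC_mul, hx]⟩

lemma final_conv (hr : 1 ≤ r)
    (hL : Lᵀ * L = 1) (hLp : Lpᵀ * Lp = 1) (hLc : L * Lᵀ + Lp * Lpᵀ = 1)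
    {η0 θ ζ b γ s r0 : ℝ} (h0 : 0 ≤ η0) (h1 : η0 ≤ 1 / 3) (hθ : 0 ≤ θ) (hζ : 0 ≤ ζ) (hb : 0 ≤ b)
    (hγ : 0 ≤ γ) (hs : 0 ≤ s) (hr0 : 0 ≤ r0)
    (hI : Inv (toC (L * Lᵀ)) (toC Z) (toC Zt) b ζ (η0 / √(1 - η0 ^ 2)) θ γ s r0) :
    s ≤ sigmaMin (Lᵀ * Z) ∧ specNorm Z ≤ b ∧ specNorm (Ztᵀ * Z) ≤ r0 ∧ (Lᵀ * Z).rank = r ∧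
    ∀ (Q : Matrix (Fin k) (Fin r) ℝ) (Qp : Matrix (Fin k) (Fin (k - r)) ℝ)
        (P : Matrix ι (Fin r) ℝ),
        Qᵀ * Q = 1 → Lᵀ * Z * Q * Qᵀ = Lᵀ * Z →
        Qpᵀ * Qp = 1 → Qᵀ * Qp = 0 → IsOrthCol P (Z * Q) →
        specNorm (Z * Qp) ≤ γ ∧ specNorm (Lpᵀ * P) ≤ η0 ∧
        specNorm (Ztᵀ * Z * Qp) ≤ ζ * γ ∧ specNorm (Ztᵀ * P) ≤ θ := by
  have hsurj := G_surj hL hI.i8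
  refine ⟨?_, specNorm_le hb hI.Z_norm, specNorm_le hr0 ?_, ?_, ?_⟩
  · refine sigma_row_ge hr hs hsurj ?_
    intro y hy
    rw [toC_mul, norm_toC_transpose hL]
    refine hI.i6 y fun x hx => hy x ?_
    rw [pi_zero_iff hL, ← toC_mul] at hx
    exact hx
  · intro x
    rw [toC_mul, ← toC_adj]
    exact hI.i7 x
  · have h2 : LinearMap.range (Lᵀ * Z).mulVecLin = ⊤ := by
      rw [LinearMap.range_eq_top]
      intro w
      obtain ⟨x, hx⟩ := hsurj (WithLp.toLp 2 w)
      refine ⟨x.ofLp, ?_⟩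
      rw [toC_apply] at hx
      exact congrArg WithLp.ofLp hx
    rw [Matrix.rank, h2, finrank_top]; simp
  · intro Q Qp P hQ hG hQp hQQp hP
    have hinj : ∀ q, toC (Lᵀ * Z * Q) q = 0 → q = 0 := by
      have h2 : Function.Surjective (toC (Lᵀ * Z * Q)) := by
        intro w
        obtain ⟨x, hx⟩ := hsurj w
        refine ⟨toC Qᵀ x, ?_⟩
        rw [← toC_mul, hG, hx]
      intro q hq
      exact square_surj.2 h2 (by rw [hq, map_zero])
    have hkerQp : ∀ c, toC (L * Lᵀ) (toC Z (toC Qp c)) = 0 := by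
      intro c
      rw [pi_zero_iff hL, ← toC_mul]
      exact ker_char' hG _ (by rw [← toC_mul, hQQp, toC_zero])
    have hRQ : ∀ q, InR (toC (L * Lᵀ)) (toC Z) (toC Q q) := by
      intro q x hx
      rw [pi_zero_iff hL, ← toC_mul] at hx
      rw [← toC_inner', ker_char hG hinj x hx, inner_zero_left]
    refine ⟨specNorm_le hγ fun c => ?_, orthCol_bound' hP _ h0 fun q => ?_,
      specNorm_le (by positivity) fun c => ?_, orthCol_bound' hP _ hθ fun q => ?_⟩
    · have := hI.i2 _ (hkerQp c)
      rwa [norm_toC_of_orth hQp, ← toC_mul] at this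
    · rw [norm_toC_compl hLp hLc, angle_conv hL h0 (by linarith), toC_mul]
      exact hI.i4 _ (hRQ q)
    · have := hI.i3 _ (hkerQp c)
      rwa [norm_toC_of_orth hQp, toC_adj, ← toC_mul, ← toC_mul] at this
    · have := hI.i5 _ (hRQ q)
      rwa [toC_adj, ← toC_mul Z] at this
end Init

end Conversion

lemma num_h8 {σ κ g : ℝ} {k : ℝ} (hσ : 0 < σ) (hκ : 1 ≤ κ) (hk : 1 ≤ k) (hg : 0 ≤ g)
    (h : g ≤ 1 / 10 ^ 4 * √σ / (k * κ ^ ((35 : ℝ) / 8))) :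
    k ^ 8 * κ ^ 35 * g ^ 8 ≤ σ ^ 4 / 10 ^ 32 ∧ g ≤ √σ / 10 ^ 4 := by
  have hκ0 : 0 < κ := by linarith
  have hp : 1 ≤ κ ^ ((35 : ℝ) / 8) := Real.one_le_rpow hκ (by norm_num)
  have hp8 : (κ ^ ((35 : ℝ) / 8)) ^ 8 = κ ^ 35 := by
    rw [← Real.rpow_natCast, ← Real.rpow_mul hκ0.le, ← Real.rpow_natCast κ 35]
    norm_num
  set c := κ ^ ((35 : ℝ) / 8)
  have hc : 1 ≤ k * c := one_le_mul_of_one_le_of_one_le hk hp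
  have hc0 : 0 < k * c := by linarith
  rw [le_div_iff₀ hc0] at h
  have hs := Real.sqrt_nonneg σ
  constructor
  · have h2 := pow_le_pow_left₀ (by positivity) h 8
    have h3 : (√σ) ^ 8 = σ ^ 4 := by
      have := Real.sq_sqrt hσ.le
      calc (√σ) ^ 8 = ((√σ) ^ 2) ^ 4 := by ring
        _ = _ := by rw [this]
    rw [mul_pow, mul_pow, mul_pow, hp8, h3] at h2
    nlinarith
  · nlinarith

lemma num_hN {σ μ s0 : ℝ} {N : ℕ} (hσ : 0 < σ) (hμ : 0 < μ) (hs0 : 0 < s0)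
    (hN : N = ⌈Real.log (√σ / (√8 * s0)) / Real.log (1 + μ / 8 * σ)⌉₊) :
    √(σ / 8) ≤ (1 + μ * σ / 8) ^ N * s0 := by
  have h1 : 1 < 1 + μ / 8 * σ := by
    have : 0 < μ / 8 * σ := by positivity
    linarith
  have hl := Real.log_pos h1
  have h2 := Nat.le_ceil (Real.log (√σ / (√8 * s0)) / Real.log (1 + μ / 8 * σ))
  rw [← hN, div_le_iff₀ hl, ← Real.log_pow] at h2
  have h3 : 0 < √σ / (√8 * s0) := by positivity
  have h4 := (Real.log_le_log_iff h3 (by positivity)).1 h2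
  have h5 : √(σ / 8) = √σ / (√8 * s0) * s0 := by
    rw [Real.sqrt_div hσ.le]; field_simp
  rw [h5, show 1 + μ * σ / 8 = 1 + μ / 8 * σ by ring]
  gcongr

lemma num_gamma {σ γ g : ℝ} (hσ : 0 < σ) (hg : 0 ≤ g) (h : γ ^ 10 ≤ σ / 128 * g ^ 8) :
    γ ≤ (1 / 128 : ℝ) ^ ((1 : ℝ) / 10) * σ ^ ((1 : ℝ) / 10) * g ^ ((4 : ℝ) / 5) := by
  apply le_of_pow_le_pow_left₀ (n := 10) (by norm_num) (by positivity)
  have e1 : ((1 / 128 : ℝ) ^ ((1 : ℝ) / 10)) ^ 10 = 1 / 128 := by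
    rw [← Real.rpow_natCast, ← Real.rpow_mul (by norm_num)]; norm_num
  have e2 : (σ ^ ((1 : ℝ) / 10)) ^ 10 = σ := by
    rw [← Real.rpow_natCast, ← Real.rpow_mul hσ.le]; norm_num
  have e3 : (g ^ ((4 : ℝ) / 5)) ^ 10 = g ^ 8 := by
    rw [← Real.rpow_natCast, ← Real.rpow_mul hg, ← Real.rpow_natCast g 8]; norm_num
  rw [mul_pow, mul_pow, e1, e2, e3]
  linarith

lemma num_eta {κ : ℝ} (hκ : 1 ≤ κ) :
    1 / 2000 / κ ^ 2 ≤ (1 / 2000 / κ ^ 2) / √(1 - (1 / 2000 / κ ^ 2) ^ 2) ∧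
    (1 / 2000 / κ ^ 2) / √(1 - (1 / 2000 / κ ^ 2) ^ 2) ≤ 1 / 1000 / κ ^ 2 ∧
    0 ≤ 1 / 2000 / κ ^ 2 ∧ 1 / 2000 / κ ^ 2 ≤ 1 / 3 := by
  have hk2 : 1 ≤ κ ^ 2 := one_le_pow₀ hκ
  have h0 : 0 ≤ 1 / 2000 / κ ^ 2 := by positivity
  have h1 : 1 / 2000 / κ ^ 2 ≤ 1 / 3 := by
    rw [div_le_iff₀ (by linarith)]; linarith
  have e : 1 / 1000 / κ ^ 2 = 2 * (1 / 2000 / κ ^ 2) := by ring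
  rw [e]
  set x := 1 / 2000 / κ ^ 2
  have h2 : √(1 - x ^ 2) ≤ 1 := Real.sqrt_le_one.2 (by nlinarith)
  have h3 : 1 / 2 ≤ √(1 - x ^ 2) := Real.le_sqrt_of_sq_le (by nlinarith)
  have h4 : 0 < √(1 - x ^ 2) := by linarith
  refine ⟨?_, ?_, h0, h1⟩
  · rw [le_div_iff₀ h4]; nlinarith
  · rw [div_le_iff₀ h4]; nlinarith

/-- main lemma for Phase 2 (saddle avoidance). -/
theorem statement18_phase2 :
    ∃ c1 c2 c3 c4 c5 c6 c7 : ℝ,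
      0 < c1 ∧ 0 < c2 ∧ 0 < c3 ∧ 0 < c4 ∧ 0 < c5 ∧ 0 < c6 ∧ 0 < c7 ∧
    ∀
    (n₁ n₂ m k r : ℕ)
    (A : Fin m → Matrix (Fin n₁) (Fin n₂) ℝ) (X : Matrix (Fin n₁) (Fin n₂) ℝ)
    (PX : Matrix (Fin n₁) (Fin r) ℝ) (QX : Matrix (Fin n₂) (Fin r) ℝ) (σX : Fin r → ℝ)
    (hPX : PXᵀ * PX = 1) (hQX : QXᵀ * QX = 1)
    (hσpos : ∀ i, 0 < σX i) (hσanti : Antitone σX)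
    (hXsvd : X = PX * Matrix.diagonal σX * QXᵀ)
    (μ : ℝ) (hμ : 0 < μ)
    (V₀ : Matrix (Fin n₁) (Fin k) ℝ) (W₀ : Matrix (Fin n₂) (Fin k) ℝ)
    (Z Z' : ℕ → Matrix (Fin n₁ ⊕ Fin n₂) (Fin k) ℝ)
    (hZ : Z = Zit A X μ V₀ W₀) (hZ' : Z' = Ztil A X μ V₀ W₀)
    (LX : Matrix (Fin n₁ ⊕ Fin n₂) (Fin r) ℝ) (hLX : LX = Zstack PX QX)
    (κ σm : ℝ) (hκ : κ = condNum X) (hσm : σm = sigmaPos X)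
    (LXp : Matrix (Fin n₁ ⊕ Fin n₂) (Fin (n₁ + n₂ - r)) ℝ)
    (hLXp1 : LXpᵀ * LXp = 1) (hLXp2 : LXᵀ * LXp = 0)
    (δ : ℝ) (hδ0 : 0 < δ) (hδ : δ ≤ c1 / (κ ^ 3 * Real.sqrt r))
    (hRIP : HasRIP A (2 * r + 1) δ)
    (hμbound : μ ≤ c2 / (κ ^ 4 * specNorm X))
    (t₁ : ℕ)
    (hsmall : sigmaMin (LXᵀ * Z t₁) ≤ Real.sqrt (σm / 8))
    (Q1 : Matrix (Fin k) (Fin r) ℝ) (hQ11 : Q1ᵀ * Q1 = 1)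
    (hQ12 : LXᵀ * Z t₁ * Q1 * Q1ᵀ = LXᵀ * Z t₁)
    (Q1p : Matrix (Fin k) (Fin (k - r)) ℝ) (hQ1p1 : Q1pᵀ * Q1p = 1) (hQ1p2 : Q1ᵀ * Q1p = 0)
    (P1 : Matrix (Fin n₁ ⊕ Fin n₂) (Fin r) ℝ) (hP1 : IsOrthCol P1 (Z t₁ * Q1))
    (N : ℕ)
    (hN : N = ⌈Real.log (Real.sqrt σm / (Real.sqrt 8 * sigmaMin (LXᵀ * Z t₁)))
        / Real.log (1 + μ / 8 * σm)⌉₊)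
    (ha1 : specNorm (Z t₁ * Q1p)
      ≤ min (2 * sigmaMin (Z t₁ * Q1)) (c3 * Real.sqrt σm / (k * κ ^ ((35 : ℝ) / 8))))
    (ha2 : specNorm (LXpᵀ * P1) ≤ c4 / κ ^ 2)
    (ha3 : specNorm (Z t₁) ≤ 2 * Real.sqrt (specNorm X))
    (ha4 : specNorm ((Z' t₁)ᵀ * Z t₁ * Q1p)
      ≤ c4 * c5 * Real.sqrt (specNorm X) / κ ^ 3 * specNorm (Z t₁ * Q1p))
    (ha5 : specNorm ((Z' t₁)ᵀ * P1) ≤ c4 * c6 * Real.sqrt (specNorm X) / κ ^ 3)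
    (ha6 : specNorm ((Z' t₁)ᵀ * Z t₁) + 400 * μ ^ 2 * (N : ℝ) * specNorm X ^ 3
      ≤ c7 / κ ^ 4 * specNorm X),
    ∃ (t₂ : ℕ) (γ : ℝ),
      t₁ ≤ t₂ ∧ t₂ - t₁ ≤ N ∧
      specNorm (Z t₁ * Q1p) ≤ γ ∧
      γ ≤ (1 / 128 : ℝ) ^ ((1 : ℝ) / 10) * σm ^ ((1 : ℝ) / 10)
          * specNorm (Z t₁ * Q1p) ^ ((4 : ℝ) / 5) ∧
      Real.sqrt (σm / 8) ≤ sigmaMin (LXᵀ * Z t₂) ∧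
      specNorm (Z t₂) ≤ 2 * Real.sqrt (specNorm X) ∧
      specNorm ((Z' t₂)ᵀ * Z t₂)
        ≤ specNorm ((Z' t₁)ᵀ * Z t₁) + 400 * μ ^ 2 * ((t₂ - t₁ : ℕ) : ℝ) * specNorm X ^ 3 ∧
      (LXᵀ * Z t₂).rank = r ∧
      ∀ (Q2 : Matrix (Fin k) (Fin r) ℝ) (Q2p : Matrix (Fin k) (Fin (k - r)) ℝ)
        (P2 : Matrix (Fin n₁ ⊕ Fin n₂) (Fin r) ℝ),
        Q2ᵀ * Q2 = 1 → LXᵀ * Z t₂ * Q2 * Q2ᵀ = LXᵀ * Z t₂ →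
        Q2pᵀ * Q2p = 1 → Q2ᵀ * Q2p = 0 → IsOrthCol P2 (Z t₂ * Q2) →
        specNorm (Z t₂ * Q2p) ≤ γ ∧
        specNorm (LXpᵀ * P2) ≤ c4 / κ ^ 2 ∧
        specNorm ((Z' t₂)ᵀ * Z t₂ * Q2p) ≤ c4 * c5 * Real.sqrt (specNorm X) * γ / κ ^ 3 ∧
        specNorm ((Z' t₂)ᵀ * P2) ≤ c4 * c6 * Real.sqrt (specNorm X) / κ ^ 3 := by
  refine ⟨1 / 10 ^ 9, 1 / 10 ^ 13, 1 / 10 ^ 4, 1 / 2000, 1 / 2000, 1 / 2000, 1 / 10 ^ 9,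
    by norm_num, by norm_num, by norm_num, by norm_num, by norm_num, by norm_num, by norm_num, ?_⟩
  intro n₁ n₂ m k r A X PX QX σX hPX hQX hσpos hσanti hXsvd μ hμ V₀ W₀ Z Z' hZ hZ' LX hLX κ σm
    hκ hσm LXp hLXp1 hLXp2 δ hδ0 hδ hRIP hμbound t₁ hsmall Q1 hQ11 hQ12 Q1p hQ1p1 hQ1p2 P1 hP1
    N hN ha1 ha2 ha3 ha4 ha5 ha6
  have hr : 1 ≤ r := by
    rcases Nat.eq_zero_or_pos r with h | h
    · exfalso
      have : (r : ℝ) = 0 := by exact_mod_cast h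
      rw [this, Real.sqrt_zero, mul_zero, div_zero] at hδ
      linarith
    · exact h
  have hrk : r ≤ k := by simpa using card_le_of_orth hQ11
  have hrn₁ : r ≤ n₁ := by simpa using card_le_of_orth hPX
  have hrn₂ : r ≤ n₂ := by simpa using card_le_of_orth hQX
  have hk : 1 ≤ k := hr.trans hrk
  have g := glob_of (V₀ := V₀) (W₀ := W₀) hr hk hPX hQX hσpos hσanti hXsvd hμ hκ hδ0 hδ hRIP
    hμbound
  have hL := LX_orth hPX hQX
  subst hZ hZ' hLX hσm
  have hLc := complete_of_orth hL hLXp1 hLXp2 (by simp; omega)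
  have hσ := g.hσ
  have hκ1 := g.hκ
  obtain ⟨he1, he2, he3, he4⟩ := num_eta hκ1
  have hcard : r < Fintype.card (Fin n₁ ⊕ Fin n₂) := by simp; omega
  have ecz : ∀ y : ℝ, (1 / 2000 : ℝ) * (1 / 2000) * y / κ ^ 3 = 1 / 4000000 * (y / κ ^ 3) := by
    intro y; ring
  rw [ecz] at ha4 ha5
  obtain ⟨hs0, hγs, hI⟩ := init_inv hr hcard hL hLXp1 hLc hQ11 hQ12 hQ1p1 hQ1p2 hP1 he3 he4
    (ha1.trans (min_le_left _ _)) ha2 ha3 ha4 ha5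
  have hγ0 := specNorm_nonneg (Zit A X μ V₀ W₀ t₁ * Q1p)
  have hk' : (1 : ℝ) ≤ k := by exact_mod_cast hk
  obtain ⟨h8, hγσ⟩ := num_h8 hσ hκ1 hk' hγ0 (ha1.trans (min_le_right _ _))
  have hκ0 : 0 < κ := by linarith
  have hr6 : specNorm ((Ztil A X μ V₀ W₀ t₁)ᵀ * Zit A X μ V₀ W₀ t₁)
      + 400 * μ ^ 2 * (N : ℝ) * specNorm X ^ 3 ≤ 1 / 10 ^ 9 * (specNorm X / κ ^ 4) := by
    refine ha6.trans (le_of_eq ?_)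
    ring
  obtain ⟨n, γ, hn, hγ1, hγ2, s, hs, hI2⟩ := phase2_abs g t₁ N _ _ he1 he2 hγ0 hs0 hγs h8 hγσ
    hsmall hr6 (num_hN hσ hμ hs0 hN) hI
  have hβ := specNorm_nonneg X
  have hγ' : 0 ≤ γ := hγ0.trans hγ1
  have hr00 := specNorm_nonneg ((Ztil A X μ V₀ W₀ t₁)ᵀ * Zit A X μ V₀ W₀ t₁)
  obtain ⟨f1, f2, f3, f4, f5⟩ := final_conv hr hL hLXp1 hLc he3 he4 (by positivity)
    (by positivity) (by positivity) hγ' ((Real.sqrt_nonneg _).trans hs) (by positivity) hI2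
  refine ⟨t₁ + n, γ, Nat.le_add_right _ _, by simpa using hn, hγ1, num_gamma hσ hγ0 hγ2,
    hs.trans f1, f2, ?_, f4, ?_⟩
  · rw [Nat.add_sub_cancel_left]; exact f3
  · intro Q2 Q2p P2 h1 h2 h3 h4 h5
    obtain ⟨e1, e2, e3, e4⟩ := f5 Q2 Q2p P2 h1 h2 h3 h4 h5
    refine ⟨e1, e2, e3.trans (le_of_eq ?_), e4.trans (le_of_eq ?_)⟩
    · ring
    · ring

end AsymMatrixSensing
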